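/- Let n ≥ 3 and let Ω ⊂ ℝⁿ be a bounded strictly convex open set with smooth boundary which is rotationally symmetric about the xₙ-axis. Let f : ℝ → ℝ be real analytic and nondecreasing, and let u be a positive solution of the Dirichlet problem div(∇u/√(1+|∇u|²)) = f(u) in Ω, u = 0 on ∂Ω, real analytic in Ω and C¹ up to the closure of Ω. Then every critical point p of u (∇u(p) = 0) lies on the xₙ-axis, i.e. p₁ = ⋯ = p_{n−1} = 0, and at any such point the Hessian D²u(p) is a diagonal matrix that is negative definite: ∂ᵢ∂ⱼu(p) = 0 for i ≠ j and ∂ᵢ∂ᵢu(p) < 0 for every 1 ≤ i ≤ n. -/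

import Mathlib

open Set Metric

noncomputable section

/-- The coefficients `a_{ij}(p) = (1+|p|²)^{-1/2}(δ_{ij} − pᵢpⱼ/(1+|p|²))`
of the mean curvature operator. -/
def mcCoeff {n : ℕ} (p : EuclideanSpace ℝ (Fin n)) (i j : Fin n) : ℝ :=
  (Real.sqrt (1 + ‖p‖ ^ 2))⁻¹ * ((if i = j then 1 else 0) - p i * p j / (1 + ‖p‖ ^ 2))

/-- Second partial derivative `∂²u/∂xᵢ∂xⱼ`. -/
def hessEntry {n : ℕ} (u : EuclideanSpace ℝ (Fin n) → ℝ) (x : EuclideanSpace ℝ (Fin n))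
    (i j : Fin n) : ℝ :=
  iteratedFDeriv ℝ 2 u x ![EuclideanSpace.single i 1, EuclideanSpace.single j 1]

/-- The Hessian matrix `D²u(x)`. -/
def hessMatrix {n : ℕ} (u : EuclideanSpace ℝ (Fin n) → ℝ) (x : EuclideanSpace ℝ (Fin n)) :
    Matrix (Fin n) (Fin n) ℝ :=
  Matrix.of fun i j => hessEntry u x i j

/-- The mean curvature operator `L u = div(∇u/√(1+|∇u|²)) = Σ a_{ij}(∇u) ∂²u/∂xᵢ∂xⱼ`. -/
def meanCurv {n : ℕ} (u : EuclideanSpace ℝ (Fin n) → ℝ) (x : EuclideanSpace ℝ (Fin n)) : ℝ :=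
  ∑ i, ∑ j, mcCoeff (gradient u x) i j * hessEntry u x i j

/-- A solution of the Dirichlet problem `L u = f(u)` in `Ω`, `u = 0` on `∂Ω`:
`u ∈ C²(Ω) ∩ C(closure Ω)`. -/
def IsMCSolution {n : ℕ} (Ω : Set (EuclideanSpace ℝ (Fin n))) (f : ℝ → ℝ)
    (u : EuclideanSpace ℝ (Fin n) → ℝ) : Prop :=
  ContDiffOn ℝ 2 u Ω ∧ ContinuousOn u (closure Ω) ∧
    (∀ x ∈ Ω, meanCurv u x = f (u x)) ∧ (∀ x ∈ frontier Ω, u x = 0)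

/-- `Ω` has smooth boundary: near each boundary point there is a smooth local defining
function with nonvanishing differential. -/
def HasSmoothBoundary {n : ℕ} (Ω : Set (EuclideanSpace ℝ (Fin n))) : Prop :=
  ∀ x ∈ frontier Ω, ∃ V : Set (EuclideanSpace ℝ (Fin n)), ∃ φ : EuclideanSpace ℝ (Fin n) → ℝ,
    IsOpen V ∧ x ∈ V ∧ ContDiffOn ℝ (⊤ : ℕ∞) φ V ∧ (∀ y ∈ V, fderiv ℝ φ y ≠ 0) ∧
    (∀ y ∈ V, (y ∈ Ω ↔ φ y < 0)) ∧ (∀ y ∈ V, (y ∈ frontier Ω ↔ φ y = 0))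

/-- A rotation about the `k`-th coordinate axis: a linear isometry fixing `e_k` and
preserving the hyperplane spanned by the other coordinate vectors. -/
def IsAxisRotation {n : ℕ} (k : Fin n)
    (g : EuclideanSpace ℝ (Fin n) ≃ₗᵢ[ℝ] EuclideanSpace ℝ (Fin n)) : Prop :=
  g (EuclideanSpace.single k 1) = EuclideanSpace.single k 1 ∧
    ∀ x : EuclideanSpace ℝ (Fin n), x k = 0 → g x k = 0

open Filter Topology
open scoped RealInnerProductSpace

section EllipticForm

variable {n : ℕ}

/-- The polynomial form `(1+|q|²) tr B - B(q,q)` of the mean curvature operator with gradient `q`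
frozen, applied to a bilinear form `B`. -/
def mcForm (q : EuclideanSpace ℝ (Fin n))
    (B : EuclideanSpace ℝ (Fin n) →L[ℝ] EuclideanSpace ℝ (Fin n) →L[ℝ] ℝ) : ℝ :=
  (1 + ‖q‖ ^ 2) * ∑ i, B (EuclideanSpace.single i 1) (EuclideanSpace.single i 1) - B q q

lemma euclidean_eq_sum_single (q : EuclideanSpace ℝ (Fin n)) :
    q = ∑ i, q i • EuclideanSpace.single i (1 : ℝ) := by
  ext j
  simp [Pi.single_apply]

lemma bilin_eq_sum_single
    (B : EuclideanSpace ℝ (Fin n) →L[ℝ] EuclideanSpace ℝ (Fin n) →L[ℝ] ℝ)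
    (q : EuclideanSpace ℝ (Fin n)) :
    B q q = ∑ i, ∑ j, q i * q j *
      B (EuclideanSpace.single i 1) (EuclideanSpace.single j 1) := by
  conv_lhs => rw [euclidean_eq_sum_single q]
  simp only [map_sum, sum_apply, map_smul, smul_apply,
    smul_eq_mul, Finset.mul_sum]
  rw [Finset.sum_comm]
  refine Finset.sum_congr rfl fun i _ => ?_
  refine Finset.sum_congr rfl fun j _ => ?_
  ring

lemma bilin_le_trace
    (B : EuclideanSpace ℝ (Fin n) →L[ℝ] EuclideanSpace ℝ (Fin n) →L[ℝ] ℝ)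
    (hB : ∀ ξ, 0 ≤ B ξ ξ) (q : EuclideanSpace ℝ (Fin n)) :
    B q q ≤ ‖q‖ ^ 2 * ∑ i, B (EuclideanSpace.single i 1) (EuclideanSpace.single i 1) := by
  set b : Fin n → Fin n → ℝ := fun i j =>
    B (EuclideanSpace.single i 1) (EuclideanSpace.single j 1) with hb
  have h1 : ∀ i j, 0 ≤ q j ^ 2 * b i i - q i * q j * b i j - q j * q i * b j i
      + q i ^ 2 * b j j := by
    intro i j
    have := hB (q j • EuclideanSpace.single i (1 : ℝ) - q i • EuclideanSpace.single j (1 : ℝ))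
    simp only [map_sub, map_smul, sub_apply, smul_apply,
      smul_eq_mul] at this
    simp only [hb]
    linarith
  have h2 : 0 ≤ ∑ i, ∑ j, (q j ^ 2 * b i i - q i * q j * b i j - q j * q i * b j i
      + q i ^ 2 * b j j) := Finset.sum_nonneg fun i _ => Finset.sum_nonneg fun j _ => h1 i j
  have h3 : B q q = ∑ i, ∑ j, q i * q j * b i j := bilin_eq_sum_single B q
  have h4 : ∑ i, ∑ j, q j * q i * b j i = ∑ i, ∑ j, q i * q j * b i j := by
    rw [Finset.sum_comm]
  have h5 : ‖q‖ ^ 2 = ∑ i, q i ^ 2 := EuclideanSpace.real_norm_sq_eq q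
  have h6 : ∑ i, ∑ j, q i ^ 2 * b j j = ‖q‖ ^ 2 * ∑ i, b i i := by
    rw [h5, Finset.sum_mul_sum]
  have h7 : ∑ i, ∑ j, q j ^ 2 * b i i = ‖q‖ ^ 2 * ∑ i, b i i := by
    rw [Finset.sum_comm, h6]
  simp only [Finset.sum_add_distrib, Finset.sum_sub_distrib] at h2
  rw [h4, h6, h7] at h2
  rw [h3]
  linarith

lemma mcForm_nonneg (q : EuclideanSpace ℝ (Fin n))
    (B : EuclideanSpace ℝ (Fin n) →L[ℝ] EuclideanSpace ℝ (Fin n) →L[ℝ] ℝ)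
    (hB : ∀ ξ, 0 ≤ B ξ ξ) : 0 ≤ mcForm q B := by
  have h1 := bilin_le_trace B hB q
  have h2 : 0 ≤ ∑ i, B (EuclideanSpace.single i 1) (EuclideanSpace.single i 1) :=
    Finset.sum_nonneg fun i _ => hB _
  unfold mcForm
  linarith

lemma mcForm_add (q : EuclideanSpace ℝ (Fin n))
    (B C : EuclideanSpace ℝ (Fin n) →L[ℝ] EuclideanSpace ℝ (Fin n) →L[ℝ] ℝ) :
    mcForm q (B + C) = mcForm q B + mcForm q C := by
  simp only [mcForm, add_apply, Finset.sum_add_distrib]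
  ring

lemma mcForm_smul (q : EuclideanSpace ℝ (Fin n)) (a : ℝ)
    (B : EuclideanSpace ℝ (Fin n) →L[ℝ] EuclideanSpace ℝ (Fin n) →L[ℝ] ℝ) :
    mcForm q (a • B) = a * mcForm q B := by
  simp only [mcForm, smul_apply, smul_eq_mul, ← Finset.mul_sum]
  ring

lemma mcForm_neg (q : EuclideanSpace ℝ (Fin n))
    (B : EuclideanSpace ℝ (Fin n) →L[ℝ] EuclideanSpace ℝ (Fin n) →L[ℝ] ℝ) :
    mcForm q (-B) = -mcForm q B := by
  rw [← neg_one_smul ℝ B, mcForm_smul, neg_one_mul]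

lemma mcForm_sub (q : EuclideanSpace ℝ (Fin n))
    (B C : EuclideanSpace ℝ (Fin n) →L[ℝ] EuclideanSpace ℝ (Fin n) →L[ℝ] ℝ) :
    mcForm q (B - C) = mcForm q B - mcForm q C := by
  rw [sub_eq_add_neg B C, mcForm_add, mcForm_neg, sub_eq_add_neg]

lemma le_mcForm_of_radial (q z : EuclideanSpace ℝ (Fin n)) {a b : ℝ} (ha : 0 ≤ a) (hb : 0 ≤ b)
    (B : EuclideanSpace ℝ (Fin n) →L[ℝ] EuclideanSpace ℝ (Fin n) →L[ℝ] ℝ)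
    (hB : ∀ ξ, B ξ ξ = a * inner ℝ z ξ ^ 2 - b * ‖ξ‖ ^ 2) :
    a * ‖z‖ ^ 2 - b * ((1 + ‖q‖ ^ 2) * n) ≤ mcForm q B := by
  have h1 : ∑ i, inner ℝ z (EuclideanSpace.single i (1 : ℝ)) ^ 2 = ‖z‖ ^ 2 := by
    rw [EuclideanSpace.real_norm_sq_eq]
    refine Finset.sum_congr rfl fun i _ => ?_
    simp [EuclideanSpace.inner_single_right]
  have h2 := abs_real_inner_le_norm z q
  have h3 : inner ℝ z q ^ 2 ≤ ‖z‖ ^ 2 * ‖q‖ ^ 2 := by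
    rw [← mul_pow]
    exact sq_le_sq' (by linarith [neg_abs_le (inner ℝ z q)]) (le_trans (le_abs_self _) h2)
  have h4 : ∀ i : Fin n, ‖EuclideanSpace.single i (1 : ℝ)‖ = 1 := by intro i; simp
  have h5 : ∑ i, B (EuclideanSpace.single i 1) (EuclideanSpace.single i 1)
      = a * ‖z‖ ^ 2 - b * n := by
    simp only [hB, Finset.sum_sub_distrib, ← Finset.mul_sum, h1, h4]
    simp
  rw [mcForm, h5, hB]
  nlinarith [mul_le_mul_of_nonneg_left h3 ha, mul_nonneg hb (sq_nonneg ‖q‖)]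

end EllipticForm

section SecondDerivativeTest

lemma deriv_deriv_nonneg_of_isLocalMin {f : ℝ → ℝ} {a : ℝ} (h : IsLocalMin f a)
    (hc : ContinuousAt f a) : 0 ≤ deriv (deriv f) a := by
  by_contra! hneg
  have h1 : deriv (deriv (-f)) a > 0 := by
    have : deriv (-f) = -deriv f := by ext x; simp
    rw [this]
    simpa using hneg
  have h2 : deriv (-f) a = 0 := by
    simp [h.deriv_eq_zero]
  have h3 := isLocalMin_of_deriv_deriv_pos h1 h2 hc.neg
  have h4 : ∀ᶠ x in 𝓝 a, f x = f a := by
    filter_upwards [h, h3] with x hx hx'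
    simp only [Pi.neg_apply, neg_le_neg_iff] at hx'
    exact le_antisymm hx' hx
  have h5 : deriv f =ᶠ[𝓝 a] deriv (fun _ => f a) := EventuallyEq.deriv h4
  have h6 := h5.deriv_eq
  simp at h6
  linarith

variable {E : Type*} [NormedAddCommGroup E] [NormedSpace ℝ E]

lemma eventually_hasDerivAt_line {g : E → ℝ} {x : E} (hg : ContDiffAt ℝ 2 g x) (ξ : E) :
    ∀ᶠ t in 𝓝 (0 : ℝ), HasDerivAt (fun t : ℝ => g (x + t • ξ)) (fderiv ℝ g (x + t • ξ) ξ) t := by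
  have h1 : ∀ᶠ y in 𝓝 x, DifferentiableAt ℝ g y :=
    (hg.eventually (by simp)).mono fun y hy => hy.differentiableAt (by simp)
  have h2 : Tendsto (fun t : ℝ => x + t • ξ) (𝓝 0) (𝓝 x) := by
    have : Continuous (fun t : ℝ => x + t • ξ) := by fun_prop
    simpa using this.tendsto 0
  filter_upwards [h2.eventually h1] with t ht
  have h3 : HasDerivAt (fun t : ℝ => x + t • ξ) ξ t := by
    simpa using ((hasDerivAt_id t).smul_const ξ).const_add x
  exact ht.hasFDerivAt.comp_hasDerivAt t h3

lemma hasDerivAt_fderiv_line {g : E → ℝ} {x : E} (hg : ContDiffAt ℝ 2 g x) (ξ : E) :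
    HasDerivAt (fun t : ℝ => fderiv ℝ g (x + t • ξ) ξ) (fderiv ℝ (fderiv ℝ g) x ξ ξ) 0 := by
  have h1 : DifferentiableAt ℝ (fderiv ℝ g) x :=
    (hg.fderiv_right (m := 1) (by norm_num)).differentiableAt (by simp)
  have h3 : HasDerivAt (fun t : ℝ => x + t • ξ) ξ 0 := by
    simpa using ((hasDerivAt_id (0 : ℝ)).smul_const ξ).const_add x
  have h4 : HasFDerivAt (fderiv ℝ g) (fderiv ℝ (fderiv ℝ g) x) (x + (0 : ℝ) • ξ) := by
    simpa using h1.hasFDerivAt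
  have h5 := h4.comp_hasDerivAt (0 : ℝ) h3
  exact h5.clm_apply (hasDerivAt_const (0 : ℝ) ξ) |>.congr_deriv (by simp)

lemma fderiv_fderiv_nonneg_of_isLocalMin {g : E → ℝ} {x : E} (hg : ContDiffAt ℝ 2 g x)
    (hmin : IsLocalMin g x) (ξ : E) : 0 ≤ fderiv ℝ (fderiv ℝ g) x ξ ξ := by
  have h2 : Tendsto (fun t : ℝ => x + t • ξ) (𝓝 0) (𝓝 x) := by
    have : Continuous (fun t : ℝ => x + t • ξ) := by fun_prop
    simpa using this.tendsto 0
  have h3 : IsLocalMin (fun t : ℝ => g (x + t • ξ)) 0 := by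
    have := h2.eventually hmin
    simpa [IsLocalMin, IsMinFilter] using this
  have h4 : ContinuousAt (fun t : ℝ => g (x + t • ξ)) 0 :=
    (eventually_hasDerivAt_line hg ξ).self_of_nhds.continuousAt
  have h5 := deriv_deriv_nonneg_of_isLocalMin h3 h4
  have h6 : deriv (fun t : ℝ => g (x + t • ξ)) =ᶠ[𝓝 0] fun t : ℝ => fderiv ℝ g (x + t • ξ) ξ :=
    (eventually_hasDerivAt_line hg ξ).mono fun t ht => ht.deriv
  rw [h6.deriv_eq, (hasDerivAt_fderiv_line hg ξ).deriv] at h5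
  exact h5

end SecondDerivativeTest

section HopfLemma

variable {n : ℕ}

/-- The exponential barrier of the Hopf lemma. -/
def expBarrier (a : ℝ) (y x : EuclideanSpace ℝ (Fin n)) : ℝ := Real.exp (-a * ‖x - y‖ ^ 2)

lemma contDiff_expBarrier (a : ℝ) (y : EuclideanSpace ℝ (Fin n)) {m : WithTop ℕ∞} :
    ContDiff ℝ m (expBarrier a y) := by
  unfold expBarrier
  exact (contDiff_const.mul ((contDiff_id.sub contDiff_const).norm_sq ℝ)).exp

lemma hasFDerivAt_expBarrier (a : ℝ) (y x : EuclideanSpace ℝ (Fin n)) :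
    HasFDerivAt (expBarrier a y)
      ((-2 * a * expBarrier a y x) • (innerSL ℝ (x - y))) x := by
  have h1 : HasFDerivAt (fun x : EuclideanSpace ℝ (Fin n) => x - y)
      (ContinuousLinearMap.id ℝ _) x := (hasFDerivAt_id x).sub_const y
  have h2 := (h1.norm_sq.const_mul (-a)).exp
  refine h2.congr_fderiv ?_
  ext ξ
  simp [expBarrier]
  ring

lemma fderiv_expBarrier (a : ℝ) (y x ξ : EuclideanSpace ℝ (Fin n)) :
    fderiv ℝ (expBarrier a y) x ξ = -2 * a * expBarrier a y x * inner ℝ (x - y) ξ := by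
  rw [(hasFDerivAt_expBarrier a y x).fderiv]
  simp [inner_sub_left]

lemma fderiv_fderiv_expBarrier (a : ℝ) (y x ξ : EuclideanSpace ℝ (Fin n)) :
    fderiv ℝ (fderiv ℝ (expBarrier a y)) x ξ ξ =
      (4 * a ^ 2 * expBarrier a y x) * inner ℝ (x - y) ξ ^ 2
        - (2 * a * expBarrier a y x) * ‖ξ‖ ^ 2 := by
  have h1 := hasDerivAt_fderiv_line ((contDiff_expBarrier a y).contDiffAt (x := x)) ξ
  have h3 : HasDerivAt (fun t : ℝ => x + t • ξ - y) ξ 0 := by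
    simpa using (((hasDerivAt_id (0 : ℝ)).smul_const ξ).const_add x).sub_const y
  have h4 : HasDerivAt (fun t : ℝ => inner ℝ (x + t • ξ - y) ξ) (‖ξ‖ ^ 2) 0 := by
    have := h3.inner ℝ (hasDerivAt_const (0 : ℝ) ξ)
    simpa using this
  have h5 := (eventually_hasDerivAt_line ((contDiff_expBarrier a y).contDiffAt (x := x)) ξ).self_of_nhds
  have h6 := ((h5.const_mul (-2 * a)).mul h4)
  have h7 : (fun t : ℝ => fderiv ℝ (expBarrier a y) (x + t • ξ) ξ) =
      fun t : ℝ => (-2 * a * expBarrier a y (x + t • ξ)) * inner ℝ (x + t • ξ - y) ξ := by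
    ext t
    rw [fderiv_expBarrier]
  rw [h7] at h1
  rw [h1.unique h6]
  simp only [zero_smul, add_zero, fderiv_expBarrier]
  ring

lemma norm_fderiv_expBarrier_le {a : ℝ} (ha : 0 ≤ a) (y x : EuclideanSpace ℝ (Fin n)) :
    ‖fderiv ℝ (expBarrier a y) x‖ ≤ 2 * a * expBarrier a y x * ‖x - y‖ := by
  have he : 0 < expBarrier a y x := Real.exp_pos _
  rw [(hasFDerivAt_expBarrier a y x).fderiv, norm_smul, innerSL_apply_norm]
  refine le_of_eq ?_
  rw [Real.norm_eq_abs, abs_mul, abs_mul, abs_of_pos he, abs_of_nonneg ha]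
  norm_num

lemma exists_expBarrier_strict {K R : ℝ} (hK : 0 ≤ K) (hR : 0 < R) : ∃ a : ℝ, 0 < a ∧
    ∀ (y x q : EuclideanSpace ℝ (Fin n)), R / 2 ≤ ‖x - y‖ → ‖x - y‖ ≤ R → ‖q‖ ≤ K →
      K * (‖fderiv ℝ (expBarrier a y) x‖ + expBarrier a y x) <
        mcForm q (fderiv ℝ (fderiv ℝ (expBarrier a y)) x) := by
  set C : ℝ := 2 * ((1 + K ^ 2) * n) + 2 * K * R with hC
  have hC0 : 0 ≤ C := by positivity
  refine ⟨(C + K + 1) / R ^ 2 + 1, by positivity, ?_⟩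
  set a : ℝ := (C + K + 1) / R ^ 2 + 1 with ha
  intro y x q h1 h2 hq
  have ha1 : 1 ≤ a := by
    have : 0 ≤ (C + K + 1) / R ^ 2 := by positivity
    linarith
  have haR : C + K + 1 ≤ a * R ^ 2 := by
    rw [ha, add_mul, div_mul_cancel₀ _ (by positivity)]
    nlinarith [sq_nonneg R]
  have he : 0 < expBarrier a y x := Real.exp_pos _
  have h3 := le_mcForm_of_radial q (x - y) (a := 4 * a ^ 2 * expBarrier a y x)
    (b := 2 * a * expBarrier a y x) (by positivity) (by positivity) _
    (fderiv_fderiv_expBarrier a y x)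
  have h4 := norm_fderiv_expBarrier_le (by linarith : 0 ≤ a) y x
  have h5 : ‖q‖ ^ 2 ≤ K ^ 2 := by gcongr
  have h6 : R ^ 2 / 4 ≤ ‖x - y‖ ^ 2 := by nlinarith
  refine lt_of_lt_of_le ?_ h3
  have h7 : K * (‖fderiv ℝ (expBarrier a y) x‖ + expBarrier a y x) ≤
      K * (2 * a * expBarrier a y x * R + expBarrier a y x) := by
    gcongr
    exact h4.trans (by gcongr)
  refine lt_of_le_of_lt h7 ?_
  have h8 : (1 + ‖q‖ ^ 2) * n ≤ (1 + K ^ 2) * n := by gcongr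
  have h9 : 4 * a ^ 2 * expBarrier a y x * (R ^ 2 / 4) - 2 * a * expBarrier a y x * ((1 + K ^ 2) * n)
      ≤ 4 * a ^ 2 * expBarrier a y x * ‖x - y‖ ^ 2
        - 2 * a * expBarrier a y x * ((1 + ‖q‖ ^ 2) * n) := by
    gcongr
  refine lt_of_lt_of_le ?_ h9
  have h10 : K * (2 * a * R + 1) < a * (a * R ^ 2) - 2 * a * ((1 + K ^ 2) * n) := by
    have : a * (C + K + 1) ≤ a * (a * R ^ 2) := by gcongr
    nlinarith
  nlinarith [mul_lt_mul_of_pos_left h10 he]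

/-- Quantitative Hopf lemma on a ball. -/
theorem hopf_lower_bound {K R : ℝ} (hK : 0 ≤ K) (hR : 0 < R) (y : EuclideanSpace ℝ (Fin n))
    {g : EuclideanSpace ℝ (Fin n) → ℝ} (hgc : ContinuousOn g (closedBall y R))
    (hg2 : ∀ x ∈ ball y R, ContDiffAt ℝ 2 g x) (hpos : ∀ x ∈ ball y R, 0 < g x)
    (hsuper : ∀ x ∈ ball y R, ∃ q, ‖q‖ ≤ K ∧
      mcForm q (fderiv ℝ (fderiv ℝ g) x) ≤ K * (‖fderiv ℝ g x‖ + g x)) :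
    ∃ c > 0, ∀ x, R / 2 ≤ ‖x - y‖ → ‖x - y‖ ≤ R → c * (R ^ 2 - ‖x - y‖ ^ 2) ≤ g x := by
  obtain ⟨a, ha, hbar⟩ := exists_expBarrier_strict (n := n) hK hR
  set e0 : ℝ := Real.exp (-a * R ^ 2) with he0
  have he0pos : 0 < e0 := Real.exp_pos _
  have hg0 : ∀ x ∈ closedBall y R, 0 ≤ g x := by
    intro x hx
    have hcl : closure (ball y R) = closedBall y R := closure_ball y hR.ne'
    rw [← hcl] at hx
    have : g x ∈ closure (Ici (0:ℝ)) := by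
      have hc : ContinuousWithinAt g (ball y R) x :=
        (hgc x (hcl ▸ hx)).mono ball_subset_closedBall
      exact hc.mem_closure hx (fun z hz => (hpos z hz).le)
    simpa using this
  -- positive lower bound on the inner ball
  obtain ⟨m, hm, hmle⟩ : ∃ m > 0, ∀ x ∈ closedBall y (R / 2), m ≤ g x := by
    have hcomp : IsCompact (closedBall y (R / 2)) := isCompact_closedBall _ _
    have hsub : closedBall y (R / 2) ⊆ ball y R := closedBall_subset_ball (by linarith)
    obtain ⟨z, hz, hzmin⟩ := hcomp.exists_isMinOn ⟨y, by simp; positivity⟩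
      (hgc.mono (hsub.trans ball_subset_closedBall))
    exact ⟨g z, hpos z (hsub hz), fun x hx => hzmin hx⟩
  set ε : ℝ := m with hε
  have hexp_le : ∀ x, expBarrier a y x ≤ 1 := by
    intro x
    refine Real.exp_le_one_iff.2 ?_
    nlinarith [sq_nonneg ‖x - y‖]
  have hkey : ∀ x, R / 2 ≤ ‖x - y‖ → ‖x - y‖ ≤ R → ε * (expBarrier a y x - e0) ≤ g x := by
    set A : Set (EuclideanSpace ℝ (Fin n)) := {x | R / 2 ≤ ‖x - y‖ ∧ ‖x - y‖ ≤ R} with hA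
    set ψ : EuclideanSpace ℝ (Fin n) → ℝ := fun x => g x - ε * (expBarrier a y x - e0) with hψ
    by_contra! hcon
    obtain ⟨x₁, hx₁, hx₁', hlt⟩ := hcon
    have hAcl : IsClosed A := by
      have hcn : Continuous fun x : EuclideanSpace ℝ (Fin n) => ‖x - y‖ := by fun_prop
      exact (isClosed_le continuous_const hcn).inter (isClosed_le hcn continuous_const)
    have hAsub : A ⊆ closedBall y R := fun x hx => by simpa [dist_eq_norm] using hx.2
    have hAcomp : IsCompact A := (isCompact_closedBall y R).of_isClosed_subset hAcl hAsub
    have hψc : ContinuousOn ψ A := by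
      refine (hgc.mono hAsub).sub (Continuous.continuousOn ?_)
      exact continuous_const.mul (((contDiff_expBarrier (m := 0) a y).continuous).sub
        continuous_const)
    obtain ⟨x, hxA, hxmin⟩ := hAcomp.exists_isMinOn ⟨x₁, hx₁, hx₁'⟩ hψc
    have hψneg : ψ x < 0 := lt_of_le_of_lt (hxmin ⟨hx₁, hx₁'⟩) (by simp only [hψ]; linarith)
    have hx2 : ‖x - y‖ ≠ R := by
      intro h
      have h1 : expBarrier a y x = e0 := by rw [expBarrier, h]
      have := hg0 x (hAsub hxA)
      simp only [hψ, h1] at hψneg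
      linarith
    have hx3 : ‖x - y‖ ≠ R / 2 := by
      intro h
      have h1 := hmle x (by simp [dist_eq_norm, h])
      have h2 := hexp_le x
      simp only [hψ] at hψneg
      nlinarith
    have hlt1 : R / 2 < ‖x - y‖ := lt_of_le_of_ne hxA.1 (Ne.symm hx3)
    have hlt2 : ‖x - y‖ < R := lt_of_le_of_ne hxA.2 hx2
    have hxball : x ∈ ball y R := by simpa [dist_eq_norm] using hlt2
    have hAnhds : A ∈ 𝓝 x := by
      have h1 : ∀ᶠ z in 𝓝 x, R / 2 < ‖z - y‖ :=
        (by fun_prop : Continuous fun z => ‖z - y‖).continuousAt.eventually (lt_mem_nhds hlt1)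
      have h2 : ∀ᶠ z in 𝓝 x, ‖z - y‖ < R :=
        (by fun_prop : Continuous fun z => ‖z - y‖).continuousAt.eventually (gt_mem_nhds hlt2)
      filter_upwards [h1, h2] with z hz1 hz2 using ⟨hz1.le, hz2.le⟩
    have hlocmin : IsLocalMin ψ x := hxmin.isLocalMin hAnhds
    have hgx := hg2 x hxball
    have hbx : ContDiffAt ℝ 2 (expBarrier a y) x := (contDiff_expBarrier a y).contDiffAt
    have hψx : ContDiffAt ℝ 2 ψ x :=
      hgx.sub (contDiffAt_const.mul (hbx.sub contDiffAt_const))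
    have hfd : ∀ᶠ z in 𝓝 x, fderiv ℝ ψ z = fderiv ℝ g z - ε • fderiv ℝ (expBarrier a y) z := by
      have h1 : ∀ᶠ z in 𝓝 x, DifferentiableAt ℝ g z :=
        (hgx.eventually (by simp)).mono fun z hz => hz.differentiableAt (by simp)
      filter_upwards [h1] with z hz
      have h2 : HasFDerivAt (expBarrier a y) (fderiv ℝ (expBarrier a y) z) z :=
        ((contDiff_expBarrier (m := 1) a y).differentiable (by simp) z).hasFDerivAt
      exact (hz.hasFDerivAt.sub ((h2.sub_const e0).const_mul ε)).fderiv
    have hD1 : fderiv ℝ g x = ε • fderiv ℝ (expBarrier a y) x := by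
      have h1 := hlocmin.fderiv_eq_zero
      rw [hfd.self_of_nhds] at h1
      exact sub_eq_zero.1 h1
    have hD2 : fderiv ℝ (fderiv ℝ ψ) x = fderiv ℝ (fderiv ℝ g) x
        - ε • fderiv ℝ (fderiv ℝ (expBarrier a y)) x := by
      rw [EventuallyEq.fderiv_eq hfd]
      have h1 : DifferentiableAt ℝ (fderiv ℝ g) x :=
        (hgx.fderiv_right (m := 1) (by norm_num)).differentiableAt (by simp)
      have h2 : DifferentiableAt ℝ (fderiv ℝ (expBarrier a y)) x :=
        (hbx.fderiv_right (m := 1) (by norm_num)).differentiableAt (by simp)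
      exact (h1.hasFDerivAt.sub (h2.hasFDerivAt.const_smul ε)).fderiv
    obtain ⟨q, hq, hqle⟩ := hsuper x hxball
    have h1 := mcForm_nonneg q _ (fderiv_fderiv_nonneg_of_isLocalMin hψx hlocmin)
    rw [hD2, mcForm_sub, mcForm_smul] at h1
    have h2 := hbar y x q hxA.1 hxA.2 hq
    rw [hD1, norm_smul, Real.norm_of_nonneg hm.le] at hqle
    have h3 : g x ≤ ε * expBarrier a y x := by
      simp only [hψ] at hψneg
      nlinarith
    have h4 := mul_lt_mul_of_pos_left h2 hm
    nlinarith [mul_le_mul_of_nonneg_left h3 hK]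
  refine ⟨ε * (a * e0), by positivity, fun x hx1 hx2 => le_trans ?_ (hkey x hx1 hx2)⟩
  have h1 : a * (R ^ 2 - ‖x - y‖ ^ 2) + 1 ≤ Real.exp (a * (R ^ 2 - ‖x - y‖ ^ 2)) :=
    Real.add_one_le_exp _
  have h2 : expBarrier a y x = e0 * Real.exp (a * (R ^ 2 - ‖x - y‖ ^ 2)) := by
    rw [expBarrier, he0, ← Real.exp_add]
    congr 1
    ring
  rw [h2]
  have h3 := mul_le_mul_of_nonneg_left h1 he0pos.le
  have h4 := mul_le_mul_of_nonneg_left h3 hm.le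
  nlinarith

/-- Hopf's boundary point lemma. -/
theorem hopf_hasDerivWithinAt_pos {K R : ℝ} (hK : 0 ≤ K) (hR : 0 < R)
    (y : EuclideanSpace ℝ (Fin n))
    {g : EuclideanSpace ℝ (Fin n) → ℝ} (hgc : ContinuousOn g (closedBall y R))
    (hg2 : ∀ x ∈ ball y R, ContDiffAt ℝ 2 g x) (hpos : ∀ x ∈ ball y R, 0 < g x)
    (hsuper : ∀ x ∈ ball y R, ∃ q, ‖q‖ ≤ K ∧
      mcForm q (fderiv ℝ (fderiv ℝ g) x) ≤ K * (‖fderiv ℝ g x‖ + g x))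
    {x e : EuclideanSpace ℝ (Fin n)} (hx : ‖x - y‖ = R) (hgx : g x = 0)
    (he : 0 < inner ℝ (y - x) e) {d : ℝ}
    (hd : HasDerivWithinAt (fun t : ℝ => g (x + t • e)) d (Ici 0) 0) : 0 < d := by
  obtain ⟨c, hc, hle⟩ := hopf_lower_bound hK hR y hgc hg2 hpos hsuper
  set b : ℝ := inner ℝ (y - x) e with hb
  have hsq : ∀ t : ℝ, ‖x + t • e - y‖ ^ 2 = R ^ 2 - 2 * t * b + t ^ 2 * ‖e‖ ^ 2 := by
    intro t
    have : x + t • e - y = (x - y) + t • e := by abel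
    rw [this, norm_add_sq_real, hx, norm_smul, mul_pow, inner_smul_right, Real.norm_eq_abs, sq_abs,
      ← neg_sub y x, inner_neg_left]
    ring
  have hlow : ∀ᶠ t in 𝓝[Ici 0] (0 : ℝ), t * (c * (2 * b - t * ‖e‖ ^ 2)) ≤ g (x + t • e) := by
    have h1 : ∀ᶠ t in 𝓝 (0 : ℝ), t * ‖e‖ ^ 2 < 2 * b :=
      (by fun_prop : Continuous fun t : ℝ => t * ‖e‖ ^ 2).continuousAt.eventually
        (gt_mem_nhds (by simpa using he))
    have h2 : ∀ᶠ t in 𝓝 (0 : ℝ), R / 2 < ‖x + t • e - y‖ :=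
      (by fun_prop : Continuous fun t : ℝ => ‖x + t • e - y‖).continuousAt.eventually
        (lt_mem_nhds (by simp [hx]; linarith))
    filter_upwards [h1.filter_mono nhdsWithin_le_nhds, h2.filter_mono nhdsWithin_le_nhds,
      self_mem_nhdsWithin] with t ht1 ht2 ht3
    have ht3 : 0 ≤ t := ht3
    have h3 : ‖x + t • e - y‖ ≤ R := by
      refine abs_le_of_sq_le_sq' ?_ hR.le |>.2
      rw [hsq]
      nlinarith
    refine le_trans (le_of_eq ?_) (hle _ ht2.le h3)
    rw [hsq]
    ring
  have h0 : HasDerivWithinAt (fun t : ℝ => t * (c * (2 * b - t * ‖e‖ ^ 2))) (c * (2 * b))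
      (Ici 0) 0 := by
    have h1 : HasDerivAt (fun t : ℝ => c * (2 * b - t * ‖e‖ ^ 2)) (c * (-(1 * ‖e‖ ^ 2))) 0 := by
      exact (((hasDerivAt_id (0 : ℝ)).mul_const (‖e‖ ^ 2)).const_sub (2 * b)).const_mul c
    have h2 := (hasDerivAt_id (0 : ℝ)).mul h1
    refine (h2.congr_deriv ?_).hasDerivWithinAt
    simp
  have h1 : HasDerivWithinAt (fun t : ℝ => g (x + t • e) - t * (c * (2 * b - t * ‖e‖ ^ 2)))
      (d - c * (2 * b)) (Ici 0) 0 := hd.sub h0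
  have h2 : 0 ≤ d - c * (2 * b) := by
    have h3 : Tendsto (slope (fun t : ℝ => g (x + t • e) - t * (c * (2 * b - t * ‖e‖ ^ 2))) 0)
        (𝓝[Ioi 0] 0) (𝓝 (d - c * (2 * b))) := by
      have := hasDerivWithinAt_iff_tendsto_slope.1 h1
      simpa using this
    refine ge_of_tendsto h3 ?_
    filter_upwards [hlow.filter_mono (nhdsWithin_mono _ Ioi_subset_Ici_self),
      self_mem_nhdsWithin] with t ht1 ht2
    have ht2 : 0 < t := ht2
    simp only [slope_def_field, zero_smul, add_zero, hgx, zero_mul, sub_zero]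
    exact div_nonneg (by linarith) ht2.le
  have h3 : 0 < c * (2 * b) := by positivity
  linarith

end HopfLemma

section StrongMaximumPrinciple

variable {n : ℕ}

/-- Near each of its critical zeros in `D`, the function `g` satisfies the differential inequality
`mcForm q (D²g) ≤ K (|Dg| + g)` with bounded frozen gradients `q`. -/
def IsLocSuper (D : Set (EuclideanSpace ℝ (Fin n))) (g : EuclideanSpace ℝ (Fin n) → ℝ) : Prop :=
  ∀ x ∈ D, g x = 0 → fderiv ℝ g x = 0 → ∃ K > 0, ∃ r > 0, ∀ y ∈ ball x r, y ∈ D →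
    ∃ q, ‖q‖ ≤ K ∧ mcForm q (fderiv ℝ (fderiv ℝ g) y) ≤ K * (‖fderiv ℝ g y‖ + g y)

lemma hasDerivWithinAt_line_of_hasFDerivAt {E : Type*} [NormedAddCommGroup E] [NormedSpace ℝ E]
    {g : E → ℝ} {x : E} {L : E →L[ℝ] ℝ} (h : HasFDerivAt g L x) (e : E) :
    HasDerivWithinAt (fun t : ℝ => g (x + t • e)) (L e) (Ici 0) 0 := by
  have h3 : HasDerivAt (fun t : ℝ => x + t • e) e 0 := by
    simpa using ((hasDerivAt_id (0 : ℝ)).smul_const e).const_add x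
  have h4 : HasFDerivAt g L (x + (0 : ℝ) • e) := by simpa using h
  exact (h4.comp_hasDerivAt (0 : ℝ) h3).hasDerivWithinAt

/-- Local form of the strong maximum principle: the zero set of a nonnegative supersolution is
open. -/
theorem IsLocSuper.eventually_eq_zero {D : Set (EuclideanSpace ℝ (Fin n))} (hD : IsOpen D)
    {g : EuclideanSpace ℝ (Fin n) → ℝ} (hg2 : ∀ x ∈ D, ContDiffAt ℝ 2 g x)
    (hg0 : ∀ x ∈ D, 0 ≤ g x) (hsuper : IsLocSuper D g) {x₀ : EuclideanSpace ℝ (Fin n)}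
    (hx₀ : x₀ ∈ D) (hgx₀ : g x₀ = 0) : ∀ᶠ x in 𝓝 x₀, g x = 0 := by
  have hcrit : ∀ x ∈ D, g x = 0 → fderiv ℝ g x = 0 := by
    intro x hx h
    refine IsLocalMin.fderiv_eq_zero ?_
    filter_upwards [hD.mem_nhds hx] with z hz
    rw [h]
    exact hg0 z hz
  obtain ⟨K, hK, r₁, hr₁, hineq⟩ := hsuper x₀ hx₀ hgx₀ (hcrit x₀ hx₀ hgx₀)
  obtain ⟨r₂, hr₂, hball⟩ := Metric.isOpen_iff.1 hD x₀ hx₀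
  set r := min r₁ r₂ with hr
  have hrpos : 0 < r := lt_min hr₁ hr₂
  have hrD : ball x₀ r ⊆ D := (ball_subset_ball (min_le_right _ _)).trans hball
  filter_upwards [ball_mem_nhds x₀ (by positivity : 0 < r / 4)] with y hy
  by_contra hne
  have hcB : closedBall x₀ (r / 2) ⊆ ball x₀ r := closedBall_subset_ball (by linarith)
  have hyD : y ∈ D := hrD (ball_subset_ball (by linarith) hy)
  have hygpos : 0 < g y := lt_of_le_of_ne (hg0 y hyD) (Ne.symm hne)
  set Z : Set (EuclideanSpace ℝ (Fin n)) := closedBall x₀ (r / 2) ∩ g ⁻¹' {0} with hZ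
  have hgc : ContinuousOn g D := fun x hx => (hg2 x hx).continuousAt.continuousWithinAt
  have hZcl : IsClosed Z :=
    (hgc.mono (hcB.trans hrD)).preimage_isClosed_of_isClosed isClosed_closedBall isClosed_singleton
  have hZcomp : IsCompact Z :=
    (isCompact_closedBall x₀ (r / 2)).of_isClosed_subset hZcl inter_subset_left
  have hx₀Z : x₀ ∈ Z := ⟨by simp; positivity, hgx₀⟩
  obtain ⟨x₁, hx₁Z, hx₁⟩ := hZcomp.exists_infDist_eq_dist ⟨x₀, hx₀Z⟩ y
  set R := dist y x₁ with hR
  have hR4 : R < r / 4 := by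
    have h1 : infDist y Z ≤ dist y x₀ := infDist_le_dist_of_mem hx₀Z
    rw [hx₁] at h1
    exact lt_of_le_of_lt h1 hy
  have hRpos : 0 < R := by
    rw [hR, dist_pos]
    rintro rfl
    exact hne hx₁Z.2
  have hsub : closedBall y R ⊆ closedBall x₀ (r / 2) := by
    refine closedBall_subset_closedBall' ?_
    have : dist y x₀ < r / 4 := hy
    linarith
  have hsubD : closedBall y R ⊆ D := hsub.trans (hcB.trans hrD)
  have hpos : ∀ x ∈ ball y R, 0 < g x := by
    intro x hx
    refine lt_of_le_of_ne (hg0 x (hsubD (ball_subset_closedBall hx))) fun h => ?_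
    have hxZ : x ∈ Z := ⟨hsub (ball_subset_closedBall hx), h.symm⟩
    have h1 : infDist y Z ≤ dist y x := infDist_le_dist_of_mem hxZ
    rw [hx₁, dist_comm y x] at h1
    exact absurd hx (not_lt.2 h1)
  have hx₁D : x₁ ∈ D := hrD (hcB hx₁Z.1)
  have hfd : HasFDerivAt g (0 : EuclideanSpace ℝ (Fin n) →L[ℝ] ℝ) x₁ := by
    rw [← hcrit x₁ hx₁D hx₁Z.2]
    exact ((hg2 x₁ hx₁D).differentiableAt (by simp)).hasFDerivAt
  have hd := hasDerivWithinAt_line_of_hasFDerivAt hfd (y - x₁)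
  have := hopf_hasDerivWithinAt_pos hK.le hRpos y (hgc.mono hsubD)
    (fun x hx => hg2 x (hsubD (ball_subset_closedBall hx))) hpos
    (fun x hx => hineq x (ball_subset_ball (min_le_left _ _)
      (hcB (hsub (ball_subset_closedBall hx)))) (hsubD (ball_subset_closedBall hx)))
    (x := x₁) (e := y - x₁) (by rw [hR, dist_comm, dist_eq_norm]) hx₁Z.2
    (by
      rw [real_inner_self_eq_norm_sq, ← dist_eq_norm]
      positivity) hd
  simp at this

/-- Strong maximum principle. -/
theorem IsLocSuper.pos_or_eq_zero {D : Set (EuclideanSpace ℝ (Fin n))} (hD : IsOpen D)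
    (hDc : IsPreconnected D)
    {g : EuclideanSpace ℝ (Fin n) → ℝ} (hg2 : ∀ x ∈ D, ContDiffAt ℝ 2 g x)
    (hg0 : ∀ x ∈ D, 0 ≤ g x) (hsuper : IsLocSuper D g) :
    (∀ x ∈ D, 0 < g x) ∨ ∀ x ∈ D, g x = 0 := by
  by_contra! hcon
  obtain ⟨⟨x₀, hx₀, hx₀'⟩, ⟨x₁, hx₁, hx₁'⟩⟩ := hcon
  have hx₀0 : g x₀ = 0 := le_antisymm hx₀' (hg0 x₀ hx₀)
  have hgc : ContinuousOn g D := fun x hx => (hg2 x hx).continuousAt.continuousWithinAt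
  have hU : IsOpen (D ∩ g ⁻¹' {0}ᶜ) := hgc.isOpen_inter_preimage hD isOpen_compl_singleton
  have hV : IsOpen {x | x ∈ D ∧ g x = 0} := by
    rw [isOpen_iff_mem_nhds]
    rintro x ⟨hx, hx'⟩
    filter_upwards [hsuper.eventually_eq_zero hD hg2 hg0 hx hx', hD.mem_nhds hx] with z hz hz'
    exact ⟨hz', hz⟩
  obtain ⟨z, hz, hzU, hzV⟩ := hDc _ _ hU hV (fun x hx => by
    by_cases h : g x = 0
    · exact Or.inr ⟨hx, h⟩
    · exact Or.inl ⟨hx, h⟩) ⟨x₁, hx₁, hx₁, hx₁'⟩ ⟨x₀, hx₀, hx₀, hx₀0⟩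
  exact hzU.2 hzV.2

/-- Weak maximum principle: a continuous function that is nonpositive on the boundary and a
subsolution where it is positive is nonpositive. -/
theorem nonpos_of_isLocSuper [NeZero n] {D : Set (EuclideanSpace ℝ (Fin n))} (hD : IsOpen D)
    (hDb : Bornology.IsBounded D) {w : EuclideanSpace ℝ (Fin n) → ℝ}
    (hwc : ContinuousOn w (closure D)) (hw2 : ∀ x ∈ D, ContDiffAt ℝ 2 w x)
    (hbd : ∀ x ∈ frontier D, w x ≤ 0)
    (hsuper : ∀ M > 0, (∀ x ∈ D, w x ≤ M) →
      IsLocSuper {x | x ∈ D ∧ 0 < w x} (fun x => M - w x)) :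
    ∀ x ∈ D, w x ≤ 0 := by
  by_contra! hcon
  obtain ⟨x₁, hx₁, hx₁pos⟩ := hcon
  have hcomp : IsCompact (closure D) := hDb.isCompact_closure
  obtain ⟨x₀, hx₀, hmax⟩ := hcomp.exists_isMaxOn ⟨x₁, subset_closure hx₁⟩ hwc
  set M := w x₀ with hM
  have hMpos : 0 < M := lt_of_lt_of_le hx₁pos (hmax (subset_closure hx₁))
  have hmemD : ∀ x ∈ closure D, 0 < w x → x ∈ D := by
    intro x hx hpos
    by_contra hxD
    have : x ∈ frontier D := by
      rw [hD.frontier_eq]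
      exact ⟨hx, hxD⟩
    linarith [hbd x this]
  set S : Set (EuclideanSpace ℝ (Fin n)) := closure D ∩ w ⁻¹' {M} with hS
  have hScl : IsClosed S := hwc.preimage_isClosed_of_isClosed isClosed_closure isClosed_singleton
  have hwcD : ContinuousOn w D := hwc.mono subset_closure
  have hD' : IsOpen {x | x ∈ D ∧ 0 < w x} := hwcD.isOpen_inter_preimage hD isOpen_Ioi
  have hSopen : IsOpen S := by
    rw [isOpen_iff_mem_nhds]
    rintro x ⟨hx, hxM⟩
    have hxM : w x = M := hxM
    have hxD : x ∈ D := hmemD x hx (hxM ▸ hMpos)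
    have := (hsuper M hMpos fun z hz => hmax (subset_closure hz)).eventually_eq_zero hD'
      (fun z hz => contDiffAt_const.sub (hw2 z hz.1))
      (fun z hz => sub_nonneg.2 (hmax (subset_closure hz.1)))
      (x₀ := x) ⟨hxD, hxM ▸ hMpos⟩ (sub_eq_zero.2 hxM.symm)
    filter_upwards [this, hD.mem_nhds hxD] with z hz hzD
    exact ⟨subset_closure hzD, by simp only [mem_preimage, mem_singleton_iff]; linarith⟩
  have hSuniv : S = univ := IsClopen.eq_univ ⟨hScl, hSopen⟩ ⟨x₀, hx₀, rfl⟩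
  have : IsCompact (univ : Set (EuclideanSpace ℝ (Fin n))) :=
    hSuniv ▸ hcomp.of_isClosed_subset hScl inter_subset_left
  have hnt : Nontrivial (EuclideanSpace ℝ (Fin n)) := inferInstance
  exact NoncompactSpace.noncompact_univ (X := EuclideanSpace ℝ (Fin n)) this

end StrongMaximumPrinciple

section DirectionalDerivative

variable {E F : Type*} [NormedAddCommGroup E] [NormedSpace ℝ E]
  [NormedAddCommGroup F] [NormedSpace ℝ F]

lemma fderiv_dirDeriv {u : E → F} {x : E} (hu : ContDiffAt ℝ 2 u x) (e : E) :
    fderiv ℝ (fun y => fderiv ℝ u y e) x = fderiv ℝ (fderiv ℝ u) x e := by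
  have h1 : DifferentiableAt ℝ (fderiv ℝ u) x :=
    (hu.fderiv_right (m := 1) (by norm_num)).differentiableAt (by simp)
  have h2 : IsSymmSndFDerivAt ℝ u x := hu.isSymmSndFDerivAt (by simp)
  rw [fderiv_clm_apply h1 (differentiableAt_const e)]
  ext ξ
  simpa using h2.eq ξ e

lemma fderiv_fderiv_dirDeriv {u : E → F} {x : E} (hu : ContDiffAt ℝ 3 u x) (e : E) :
    fderiv ℝ (fderiv ℝ (fun y => fderiv ℝ u y e)) x = fderiv ℝ (fderiv ℝ (fderiv ℝ u)) x e := by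
  have h1 : ∀ᶠ y in 𝓝 x, ContDiffAt ℝ 2 u y :=
    (hu.of_le (by norm_num)).eventually (by simp)
  have h2 : fderiv ℝ (fun y => fderiv ℝ u y e) =ᶠ[𝓝 x] fun y => fderiv ℝ (fderiv ℝ u) y e :=
    h1.mono fun y hy => fderiv_dirDeriv hy e
  rw [h2.fderiv_eq]
  exact fderiv_dirDeriv (hu.fderiv_right (m := 2) (by norm_num)) e

lemma ContDiffAt.dirDeriv {u : E → F} {x : E} {m k : WithTop ℕ∞} (hu : ContDiffAt ℝ k u x)
    (hmk : m + 1 ≤ k) (e : E) : ContDiffAt ℝ m (fun y => fderiv ℝ u y e) x :=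
  (hu.fderiv_right hmk).clm_apply contDiffAt_const

end DirectionalDerivative

section Equation

variable {n : ℕ}

lemma gradient_apply (u : EuclideanSpace ℝ (Fin n) → ℝ) (x : EuclideanSpace ℝ (Fin n))
    (i : Fin n) : gradient u x i = fderiv ℝ u x (EuclideanSpace.single i 1) := by
  have h := InnerProductSpace.toDual_symm_apply (𝕜 := ℝ) (x := EuclideanSpace.single i (1 : ℝ))
    (y := fderiv ℝ u x)
  rw [← h, EuclideanSpace.inner_single_right]
  simp [gradient]

lemma norm_gradient (u : EuclideanSpace ℝ (Fin n) → ℝ) (x : EuclideanSpace ℝ (Fin n)) :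
    ‖gradient u x‖ = ‖fderiv ℝ u x‖ := by
  simp [gradient]

lemma gradient_eq_sum (u : EuclideanSpace ℝ (Fin n) → ℝ) (x : EuclideanSpace ℝ (Fin n)) :
    gradient u x = ∑ i, fderiv ℝ u x (EuclideanSpace.single i 1) • EuclideanSpace.single i 1 := by
  simp only [← gradient_apply]
  exact euclidean_eq_sum_single _

lemma gradient_eq_zero_iff (u : EuclideanSpace ℝ (Fin n) → ℝ) (x : EuclideanSpace ℝ (Fin n)) :
    gradient u x = 0 ↔ fderiv ℝ u x = 0 := by
  rw [← norm_eq_zero, norm_gradient, norm_eq_zero]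

lemma continuousAt_gradient {u : EuclideanSpace ℝ (Fin n) → ℝ} {x : EuclideanSpace ℝ (Fin n)}
    (hu : ContDiffAt ℝ 1 u x) : ContinuousAt (gradient u) x := by
  have : gradient u = fun x => gradient u x := rfl
  rw [this]
  simp only [gradient_eq_sum]
  have := (hu.fderiv_right (m := 0) (by norm_num)).continuousAt
  fun_prop

/-- The mean curvature equation with the denominators cleared. -/
def IsMCEquation (Ω : Set (EuclideanSpace ℝ (Fin n))) (f : ℝ → ℝ)
    (u : EuclideanSpace ℝ (Fin n) → ℝ) : Prop :=
  ∀ x ∈ Ω, mcForm (gradient u x) (fderiv ℝ (fderiv ℝ u) x) =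
    √(1 + ‖gradient u x‖ ^ 2) ^ 3 * f (u x)

lemma hessEntry_eq (u : EuclideanSpace ℝ (Fin n) → ℝ) (x : EuclideanSpace ℝ (Fin n))
    (i j : Fin n) : hessEntry u x i j =
      fderiv ℝ (fderiv ℝ u) x (EuclideanSpace.single i 1) (EuclideanSpace.single j 1) := by
  simp [hessEntry, iteratedFDeriv_two_apply]

lemma mcForm_eq_meanCurv (u : EuclideanSpace ℝ (Fin n) → ℝ) (x : EuclideanSpace ℝ (Fin n)) :
    mcForm (gradient u x) (fderiv ℝ (fderiv ℝ u) x) =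
      √(1 + ‖gradient u x‖ ^ 2) ^ 3 * meanCurv u x := by
  set q := gradient u x
  set B := fderiv ℝ (fderiv ℝ u) x with hB
  have hpos : 0 < 1 + ‖q‖ ^ 2 := by positivity
  have hs : √(1 + ‖q‖ ^ 2) ^ 2 = 1 + ‖q‖ ^ 2 := Real.sq_sqrt hpos.le
  have hs0 : √(1 + ‖q‖ ^ 2) ≠ 0 := (Real.sqrt_pos.2 hpos).ne'
  have h1 : meanCurv u x = (√(1 + ‖q‖ ^ 2))⁻¹ * (∑ i, B (EuclideanSpace.single i 1)
      (EuclideanSpace.single i 1) - B q q / (1 + ‖q‖ ^ 2)) := by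
    rw [bilin_eq_sum_single B q, Finset.sum_div]
    simp only [Finset.sum_div, meanCurv, mcCoeff, hessEntry_eq]
    rw [← Finset.sum_sub_distrib, Finset.mul_sum]
    refine Finset.sum_congr rfl fun i _ => ?_
    have : B (EuclideanSpace.single i 1) (EuclideanSpace.single i 1) =
        ∑ j, (if i = j then (1 : ℝ) else 0) * B (EuclideanSpace.single i 1)
          (EuclideanSpace.single j 1) := by simp
    rw [this, ← Finset.sum_sub_distrib, Finset.mul_sum]
    refine Finset.sum_congr rfl fun j _ => ?_
    simp only [← hB]
    ring
  rw [h1, mcForm, pow_succ (√(1 + ‖q‖ ^ 2)), hs]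
  field_simp

lemma IsMCSolution.isMCEquation {Ω : Set (EuclideanSpace ℝ (Fin n))} {f : ℝ → ℝ}
    {u : EuclideanSpace ℝ (Fin n) → ℝ} (h : IsMCSolution Ω f u) : IsMCEquation Ω f u := by
  intro x hx
  rw [mcForm_eq_meanCurv, h.2.2.1 x hx]

lemma abs_trace_le (B : EuclideanSpace ℝ (Fin n) →L[ℝ] EuclideanSpace ℝ (Fin n) →L[ℝ] ℝ) :
    |∑ i, B (EuclideanSpace.single i 1) (EuclideanSpace.single i 1)| ≤ n * ‖B‖ := by
  refine (Finset.abs_sum_le_sum_abs _ _).trans ?_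
  have : ∀ i ∈ (Finset.univ : Finset (Fin n)),
      |B (EuclideanSpace.single i 1) (EuclideanSpace.single i 1)| ≤ ‖B‖ := by
    intro i _
    have := B.le_opNorm₂ (EuclideanSpace.single i 1) (EuclideanSpace.single i 1)
    simpa using this
  refine (Finset.sum_le_card_nsmul _ _ _ this).trans ?_
  simp

lemma exists_ball_le {X : Type*} [PseudoMetricSpace X] {F : X → ℝ} {x : X}
    (hF : ContinuousAt F x) : ∃ K > 0, ∃ r > 0, ∀ y ∈ ball x r, F y ≤ K := by
  have h : ∀ᶠ y in 𝓝 x, F y < |F x| + 1 :=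
    hF.eventually_lt_const (by linarith [le_abs_self (F x)])
  obtain ⟨r, hr, hr'⟩ := Metric.eventually_nhds_iff_ball.1 h
  exact ⟨|F x| + 1, by positivity, r, hr, fun y hy => (hr' y hy).le⟩

lemma abs_mcForm_sub_le (q q₁ : EuclideanSpace ℝ (Fin n))
    (B : EuclideanSpace ℝ (Fin n) →L[ℝ] EuclideanSpace ℝ (Fin n) →L[ℝ] ℝ) :
    |mcForm q B - mcForm q₁ B| ≤ (n + 1) * ‖B‖ * (‖q‖ + ‖q₁‖) * ‖q - q₁‖ := by
  have h1 : mcForm q B - mcForm q₁ B = (‖q‖ - ‖q₁‖) * (‖q‖ + ‖q₁‖) *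
      (∑ i, B (EuclideanSpace.single i 1) (EuclideanSpace.single i 1))
      - (B (q - q₁) q + B q₁ (q - q₁)) := by
    simp only [mcForm, map_sub, sub_apply]
    ring
  have h2 := abs_trace_le B
  have h3 := abs_norm_sub_norm_le q q₁
  have h4 : |B (q - q₁) q| ≤ ‖B‖ * ‖q - q₁‖ * ‖q‖ := B.le_opNorm₂ _ _
  have h5 : |B q₁ (q - q₁)| ≤ ‖B‖ * ‖q₁‖ * ‖q - q₁‖ := B.le_opNorm₂ _ _
  have h6 : |(‖q‖ - ‖q₁‖) * (‖q‖ + ‖q₁‖) *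
      (∑ i, B (EuclideanSpace.single i 1) (EuclideanSpace.single i 1))| ≤
      ‖q - q₁‖ * (‖q‖ + ‖q₁‖) * (n * ‖B‖) := by
    rw [abs_mul, abs_mul, abs_of_nonneg (by positivity : 0 ≤ ‖q‖ + ‖q₁‖)]
    gcongr
  rw [h1]
  refine (abs_sub _ _).trans ?_
  have := abs_add_le (B (q - q₁) q) (B q₁ (q - q₁))
  nlinarith

lemma abs_sqrt_cube_sub_le (q q₁ : EuclideanSpace ℝ (Fin n)) :
    |√(1 + ‖q‖ ^ 2) ^ 3 - √(1 + ‖q₁‖ ^ 2) ^ 3| ≤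
      (√(1 + ‖q‖ ^ 2) + √(1 + ‖q₁‖ ^ 2)) ^ 2 * ‖q - q₁‖ := by
  set s := √(1 + ‖q‖ ^ 2)
  set s₁ := √(1 + ‖q₁‖ ^ 2)
  have hs : s ^ 2 = 1 + ‖q‖ ^ 2 := Real.sq_sqrt (by positivity)
  have hs₁ : s₁ ^ 2 = 1 + ‖q₁‖ ^ 2 := Real.sq_sqrt (by positivity)
  have h0 : 0 < s := Real.sqrt_pos.2 (by positivity)
  have h0' : 0 < s₁ := Real.sqrt_pos.2 (by positivity)
  have hq : ‖q‖ ≤ s := Real.le_sqrt_of_sq_le (by linarith)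
  have hq₁ : ‖q₁‖ ≤ s₁ := Real.le_sqrt_of_sq_le (by linarith)
  have h3 := abs_norm_sub_norm_le q q₁
  have h4 : |s - s₁| ≤ ‖q - q₁‖ := by
    refine le_trans ?_ h3
    have h5 : |s - s₁| * (s + s₁) = |‖q‖ - ‖q₁‖| * (‖q‖ + ‖q₁‖) := by
      rw [← abs_of_pos (by positivity : 0 < s + s₁), ← abs_mul,
        ← abs_of_nonneg (by positivity : 0 ≤ ‖q‖ + ‖q₁‖), ← abs_mul]
      congr 1
      linear_combination hs - hs₁
    by_contra! hlt
    have : |‖q‖ - ‖q₁‖| * (‖q‖ + ‖q₁‖) < |s - s₁| * (s + s₁) := by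
      refine mul_lt_mul_of_nonneg_of_pos hlt (by linarith) (abs_nonneg _) (by positivity)
    linarith
  have h5 : s ^ 3 - s₁ ^ 3 = (s - s₁) * (s ^ 2 + s * s₁ + s₁ ^ 2) := by ring
  rw [h5, abs_mul, abs_of_pos (by positivity : 0 < s ^ 2 + s * s₁ + s₁ ^ 2)]
  nlinarith [mul_pos h0 h0', norm_nonneg (q - q₁), mul_nonneg (mul_pos h0 h0').le
    (norm_nonneg (q - q₁)), mul_le_mul_of_nonneg_right h4
    (by positivity : 0 ≤ s ^ 2 + s * s₁ + s₁ ^ 2)]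
end Equation

section Linearisation

variable {n : ℕ}

lemma hasDerivAt_comp_line {E F : Type*} [NormedAddCommGroup E] [NormedSpace ℝ E]
    [NormedAddCommGroup F] [NormedSpace ℝ F] {g : E → F} {x : E} {L : E →L[ℝ] F}
    (h : HasFDerivAt g L x) (e : E) : HasDerivAt (fun t : ℝ => g (x + t • e)) (L e) 0 := by
  have h3 : HasDerivAt (fun t : ℝ => x + t • e) e 0 := by
    simpa using ((hasDerivAt_id (0 : ℝ)).smul_const e).const_add x
  have h4 : HasFDerivAt g L (x + (0 : ℝ) • e) := by simpa using h
  exact h4.comp_hasDerivAt (0 : ℝ) h3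

lemma hasDerivAt_gradient_line {u : EuclideanSpace ℝ (Fin n) → ℝ} {x : EuclideanSpace ℝ (Fin n)}
    (hu : ContDiffAt ℝ 2 u x) (e : EuclideanSpace ℝ (Fin n)) :
    HasDerivAt (fun t : ℝ => gradient u (x + t • e)) (gradient (fun y => fderiv ℝ u y e) x) 0 := by
  have h1 : HasDerivAt (fun t : ℝ => fderiv ℝ u (x + t • e)) (fderiv ℝ (fderiv ℝ u) x e) 0 :=
    hasDerivAt_comp_line
      ((hu.fderiv_right (m := 1) (by norm_num)).differentiableAt (by simp)).hasFDerivAt e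
  simp only [gradient_eq_sum, fderiv_dirDeriv hu e]
  refine HasDerivAt.fun_sum fun i _ => ?_
  have h2 : HasDerivAt (fun t : ℝ => fderiv ℝ u (x + t • e) (EuclideanSpace.single i 1))
      (fderiv ℝ (fderiv ℝ u) x e (EuclideanSpace.single i 1)) 0 := by
    simpa using h1.clm_apply (hasDerivAt_const (0 : ℝ) (EuclideanSpace.single i (1 : ℝ)))
  exact h2.smul_const _

/-- The equation satisfied by a directional derivative of a solution. -/
lemma IsMCEquation.mcForm_dirDeriv {Ω : Set (EuclideanSpace ℝ (Fin n))} {f : ℝ → ℝ}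
    {u : EuclideanSpace ℝ (Fin n) → ℝ} (h : IsMCEquation Ω f u) (hΩ : IsOpen Ω)
    (hf : Differentiable ℝ f) {x : EuclideanSpace ℝ (Fin n)} (hx : x ∈ Ω)
    (hu : ContDiffAt ℝ 3 u x) (e : EuclideanSpace ℝ (Fin n)) :
    mcForm (gradient u x) (fderiv ℝ (fderiv ℝ fun y => fderiv ℝ u y e) x) =
      √(1 + ‖gradient u x‖ ^ 2) ^ 3 * deriv f (u x) * fderiv ℝ u x e
      + (3 * √(1 + ‖gradient u x‖ ^ 2) *
          inner ℝ (gradient u x) (gradient (fun y => fderiv ℝ u y e) x) * f (u x)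
        - 2 * inner ℝ (gradient u x) (gradient (fun y => fderiv ℝ u y e) x) *
            ∑ i, fderiv ℝ (fderiv ℝ u) x (EuclideanSpace.single i 1) (EuclideanSpace.single i 1)
        + fderiv ℝ (fderiv ℝ u) x (gradient (fun y => fderiv ℝ u y e) x) (gradient u x)
        + fderiv ℝ (fderiv ℝ u) x (gradient u x) (gradient (fun y => fderiv ℝ u y e) x)) := by
  set q' := gradient (fun y => fderiv ℝ u y e) x with hq'
  have hu2 : ContDiffAt ℝ 2 u x := hu.of_le (by norm_num)
  have hq : HasDerivAt (fun t : ℝ => gradient u (x + t • e)) q' 0 := hasDerivAt_gradient_line hu2 e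
  have hB : HasDerivAt (fun t : ℝ => fderiv ℝ (fderiv ℝ u) (x + t • e))
      (fderiv ℝ (fderiv ℝ fun y => fderiv ℝ u y e) x) 0 := by
    rw [fderiv_fderiv_dirDeriv hu e]
    exact hasDerivAt_comp_line (((hu.fderiv_right (m := 2) (by norm_num)).fderiv_right
      (m := 1) (by norm_num)).differentiableAt (by simp)).hasFDerivAt e
  have hut : HasDerivAt (fun t : ℝ => u (x + t • e)) (fderiv ℝ u x e) 0 :=
    hasDerivAt_comp_line (hu.differentiableAt (by simp)).hasFDerivAt e
  set B' := fderiv ℝ (fderiv ℝ fun y => fderiv ℝ u y e) x with hB'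
  have hBqq := (hB.clm_apply hq).clm_apply hq
  have hn : HasDerivAt (fun t : ℝ => 1 + ‖gradient u (x + t • e)‖ ^ 2)
      (2 * inner ℝ (gradient u (x + (0 : ℝ) • e)) q') 0 := by
    simpa using hq.norm_sq.const_add 1
  have hs := (hn.sqrt (by positivity)).pow 3
  have htr : HasDerivAt (fun t : ℝ => ∑ i, fderiv ℝ (fderiv ℝ u) (x + t • e)
      (EuclideanSpace.single i 1) (EuclideanSpace.single i 1))
      (∑ i, B' (EuclideanSpace.single i 1) (EuclideanSpace.single i 1)) 0 := by
    refine HasDerivAt.fun_sum fun i _ => ?_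
    simpa using (hB.clm_apply (hasDerivAt_const (0 : ℝ) (EuclideanSpace.single i (1 : ℝ)))).clm_apply
      (hasDerivAt_const (0 : ℝ) (EuclideanSpace.single i (1 : ℝ)))
  have hft : HasDerivAt (fun t : ℝ => f (u (x + t • e))) (deriv f (u x) * fderiv ℝ u x e) 0 := by
    have h1 : HasDerivAt f (deriv f (u x)) (u (x + (0 : ℝ) • e)) := by
      simpa using (hf (u x)).hasDerivAt
    exact h1.comp (0 : ℝ) hut
  have hL := (hn.mul htr).sub hBqq
  have hR := hs.mul hft
  have hev : ∀ᶠ t : ℝ in 𝓝 0, x + t • e ∈ Ω := by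
    have : Continuous (fun t : ℝ => x + t • e) := by fun_prop
    exact this.continuousAt.preimage_mem_nhds (by simpa using hΩ.mem_nhds hx)
  have hR' := hR.congr_of_eventuallyEq (hev.mono fun t ht => h _ ht)
  have := hL.unique hR'
  have hs0 : √(1 + ‖gradient u x‖ ^ 2) ≠ 0 := (Real.sqrt_pos.2 (by positivity)).ne'
  simp only [zero_smul, add_zero, add_apply, Pi.pow_apply] at this
  rw [mcForm]
  have h3 : 3 * √(1 + ‖gradient u x‖ ^ 2) * inner ℝ (gradient u x) q' * f (u x) =
      ((3 : ℕ) : ℝ) * √(1 + ‖gradient u x‖ ^ 2) ^ (3 - 1) *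
        (2 * inner ℝ (gradient u x) q' / (2 * √(1 + ‖gradient u x‖ ^ 2))) * f (u x) := by
    push_cast
    field_simp
  rw [h3]
  linear_combination this

lemma IsMCEquation.exists_linearised_bound {Ω : Set (EuclideanSpace ℝ (Fin n))} {f : ℝ → ℝ}
    {u : EuclideanSpace ℝ (Fin n) → ℝ} (h : IsMCEquation Ω f u) (hΩ : IsOpen Ω)
    (hf : ContDiff ℝ 1 f) (hfm : Monotone f) (hu : ∀ x ∈ Ω, ContDiffAt ℝ 3 u x)
    (e : EuclideanSpace ℝ (Fin n)) {x₀ : EuclideanSpace ℝ (Fin n)} (hx₀ : x₀ ∈ Ω) :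
    ∃ K > 0, ∃ r > 0, ∀ y ∈ ball x₀ r, y ∈ Ω → ‖gradient u y‖ ≤ K ∧ ∃ c, 0 ≤ c ∧ c ≤ K ∧
      |mcForm (gradient u y) (fderiv ℝ (fderiv ℝ fun y => fderiv ℝ u y e) y)
        - c * fderiv ℝ u y e| ≤ K * ‖fderiv ℝ (fun y => fderiv ℝ u y e) y‖ := by
  have hux := hu x₀ hx₀
  have c1 : ContinuousAt (gradient u) x₀ := continuousAt_gradient (hux.of_le (by norm_num))
  have c2 : ContinuousAt (fderiv ℝ (fderiv ℝ u)) x₀ :=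
    ((hux.fderiv_right (m := 2) (by norm_num)).fderiv_right (m := 1) (by norm_num)).continuousAt
  have c3 : ContinuousAt (fun y => deriv f (u y)) x₀ :=
    ((hf.continuous_deriv le_rfl).continuousAt).comp hux.continuousAt
  have c4 : ContinuousAt (fun y => f (u y)) x₀ := hf.continuous.continuousAt.comp hux.continuousAt
  have c5 : ContinuousAt (fun y => √(1 + ‖gradient u y‖ ^ 2)) x₀ :=
    Real.continuous_sqrt.continuousAt.comp ((c1.norm.pow 2).const_add 1)
  have c2n : ContinuousAt (fun y => ‖fderiv ℝ (fderiv ℝ u) y‖) x₀ :=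
    (continuous_norm (E := EuclideanSpace ℝ (Fin n) →L[ℝ] EuclideanSpace ℝ (Fin n) →L[ℝ] ℝ)).continuousAt.comp c2
  have : ∀ {a s d g b : EuclideanSpace ℝ (Fin n) → ℝ}, ContinuousAt a x₀ → ContinuousAt s x₀ →
      ContinuousAt d x₀ → ContinuousAt g x₀ → ContinuousAt b x₀ →
      ContinuousAt (fun y => a y + s y ^ 3 * |d y| + (3 * s y * a y * |g y|
        + 2 * a y * (n * b y) + 2 * (b y * a y))) x₀ := by
    intro a s d g b ha hs hd hg hb
    fun_prop
  obtain ⟨K, hK, r, hr, hKr⟩ := exists_ball_le (x := x₀) (F := fun y => ‖gradient u y‖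
      + √(1 + ‖gradient u y‖ ^ 2) ^ 3 * |deriv f (u y)|
      + (3 * √(1 + ‖gradient u y‖ ^ 2) * ‖gradient u y‖ * |f (u y)|
        + 2 * ‖gradient u y‖ * (n * ‖fderiv ℝ (fderiv ℝ u) y‖)
        + 2 * (‖fderiv ℝ (fderiv ℝ u) y‖ * ‖gradient u y‖)))
    (this c1.norm c5 c3 c4 c2n)
  refine ⟨K, hK, r, hr, fun y hy hyΩ => ?_⟩
  have hKy := hKr y hy
  set q := gradient u y
  set B := fderiv ℝ (fderiv ℝ u) y
  set s := √(1 + ‖q‖ ^ 2)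
  have hs : 0 ≤ s := Real.sqrt_nonneg _
  have hf' : 0 ≤ deriv f (u y) := hfm.deriv_nonneg
  have p1 : 0 ≤ s ^ 3 * deriv f (u y) := by positivity
  have p2 : 0 ≤ 3 * s * ‖q‖ * |f (u y)| + 2 * ‖q‖ * (n * ‖B‖) + 2 * (‖B‖ * ‖q‖) := by positivity
  rw [abs_of_nonneg hf'] at hKy
  refine ⟨by linarith [norm_nonneg q], s ^ 3 * deriv f (u y), p1, by linarith [norm_nonneg q], ?_⟩
  rw [h.mcForm_dirDeriv hΩ (hf.differentiable (by simp)) hyΩ (hu y hyΩ) e, add_sub_cancel_left,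
    ← norm_gradient]
  set q' := gradient (fun y => fderiv ℝ u y e) y
  have i1 : |inner ℝ q q'| ≤ ‖q‖ * ‖q'‖ := abs_real_inner_le_norm q q'
  have i2 : |B q' q| ≤ ‖B‖ * ‖q'‖ * ‖q‖ := B.le_opNorm₂ _ _
  have i3 : |B q q'| ≤ ‖B‖ * ‖q‖ * ‖q'‖ := B.le_opNorm₂ _ _
  have i4 := abs_trace_le B
  have i5 : |3 * s * inner ℝ q q' * f (u y)| ≤ 3 * s * (‖q‖ * ‖q'‖) * |f (u y)| := by
    rw [abs_mul, abs_mul, abs_of_nonneg (by positivity : 0 ≤ 3 * s)]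
    gcongr
  have i6 : |2 * inner ℝ q q' * ∑ i, B (EuclideanSpace.single i 1) (EuclideanSpace.single i 1)| ≤
      2 * (‖q‖ * ‖q'‖) * (n * ‖B‖) := by
    rw [abs_mul, abs_mul, abs_of_nonneg (by positivity : (0 : ℝ) ≤ 2)]
    gcongr
  have i7 : (3 * s * ‖q‖ * |f (u y)| + 2 * ‖q‖ * (n * ‖B‖) + 2 * (‖B‖ * ‖q‖)) * ‖q'‖ ≤ K * ‖q'‖ := by
    gcongr
    linarith [norm_nonneg q]
  refine le_trans ?_ i7
  refine (abs_add_le _ _).trans ?_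
  have j1 := abs_add_le (3 * s * inner ℝ q q' * f (u y)
    - 2 * inner ℝ q q' * ∑ i, B (EuclideanSpace.single i 1) (EuclideanSpace.single i 1)) (B q' q)
  have j2 := abs_sub (3 * s * inner ℝ q q' * f (u y))
    (2 * inner ℝ q q' * ∑ i, B (EuclideanSpace.single i 1) (EuclideanSpace.single i 1))
  nlinarith

variable {Ω : Set (EuclideanSpace ℝ (Fin n))} {f : ℝ → ℝ} {u : EuclideanSpace ℝ (Fin n) → ℝ}

lemma fderiv_const_sub_fun {E : Type*} [NormedAddCommGroup E] [NormedSpace ℝ E] (a : ℝ)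
    (w : E → ℝ) : fderiv ℝ (fun x => a - w x) = fun x => -fderiv ℝ w x := by
  ext x
  simp [fderiv_const_sub]

lemma IsMCEquation.isLocSuper_sub_dirDeriv (h : IsMCEquation Ω f u) (hΩ : IsOpen Ω)
    (hf : ContDiff ℝ 1 f) (hfm : Monotone f) (hu : ∀ x ∈ Ω, ContDiffAt ℝ 3 u x)
    (e : EuclideanSpace ℝ (Fin n)) {D : Set (EuclideanSpace ℝ (Fin n))} (hD : D ⊆ Ω) {M : ℝ}
    (hM : 0 ≤ M) (hvM : ∀ x ∈ D, fderiv ℝ u x e ≤ M)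
    (hv : M = 0 ∨ ∀ x ∈ D, 0 ≤ fderiv ℝ u x e) :
    IsLocSuper D (fun x => M - fderiv ℝ u x e) := by
  intro x hx _ _
  obtain ⟨K, hK, r, hr, hb⟩ := h.exists_linearised_bound hΩ hf hfm hu e (hD hx)
  refine ⟨K, hK, r, hr, fun y hy hyD => ⟨gradient u y, (hb y hy (hD hyD)).1, ?_⟩⟩
  obtain ⟨-, c, hc0, hcK, hc⟩ := hb y hy (hD hyD)
  rw [fderiv_const_sub_fun, fderiv_fun_neg, mcForm_neg, norm_neg]
  have h1 := neg_le_of_abs_le hc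
  have h2 : -(c * fderiv ℝ u y e) ≤ K * (M - fderiv ℝ u y e) := by
    rcases hv with rfl | hv
    · nlinarith [hvM y hyD]
    · nlinarith [hvM y hyD, hv y hyD, mul_nonneg hc0 (hv y hyD),
        mul_nonneg hK.le (sub_nonneg.2 (hvM y hyD))]
  linarith

/-- Weak maximum principle for directional derivatives of a solution. -/
theorem IsMCEquation.dirDeriv_nonpos [NeZero n] (h : IsMCEquation Ω f u) (hΩ : IsOpen Ω)
    (hf : ContDiff ℝ 1 f) (hfm : Monotone f) (hu : ∀ x ∈ Ω, ContDiffAt ℝ 3 u x)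
    (e : EuclideanSpace ℝ (Fin n)) {D : Set (EuclideanSpace ℝ (Fin n))} (hDo : IsOpen D)
    (hDb : Bornology.IsBounded D) (hD : D ⊆ Ω) {w : EuclideanSpace ℝ (Fin n) → ℝ}
    (hw : ∀ x ∈ Ω, w x = fderiv ℝ u x e)
    (hwc : ContinuousOn w (closure D)) (hbd : ∀ x ∈ frontier D, w x ≤ 0) :
    ∀ x ∈ D, fderiv ℝ u x e ≤ 0 := by
  have hev : ∀ x ∈ D, w =ᶠ[𝓝 x] fun y => fderiv ℝ u y e := fun x hx => by
    filter_upwards [hΩ.mem_nhds (hD hx)] with y hy using hw y hy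
  have := nonpos_of_isLocSuper hDo hDb hwc (fun x hx =>
    (((hu x (hD hx)).dirDeriv (m := 2) (by norm_num) e).congr_of_eventuallyEq (hev x hx)))
    hbd ?_
  · intro x hx
    rw [← hw x (hD hx)]
    exact this x hx
  · intro M hM hle
    have hs := h.isLocSuper_sub_dirDeriv hΩ hf hfm hu e (D := {x | x ∈ D ∧ 0 < w x})
      (fun x hx => hD hx.1) hM.le (fun x hx => by
        rw [← hw x (hD hx.1)]; exact hle x hx.1)
      (Or.inr fun x hx => by rw [← hw x (hD hx.1)]; exact hx.2.le)
    have e1 : ∀ x ∈ D, (fun y => M - w y) =ᶠ[𝓝 x] fun y => M - fderiv ℝ u y e := fun x hx =>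
      (hev x hx).mono fun y hy => by simp only [hy]
    intro x hx h0 h1
    obtain ⟨K, hK, r, hr, hb⟩ := hs x hx (by simpa only [hw x (hD hx.1)] using h0)
      (by rw [← (e1 x hx.1).fderiv_eq]; exact h1)
    refine ⟨K, hK, r, hr, fun y hy hyD => ?_⟩
    obtain ⟨q, hq, hq'⟩ := hb y hy hyD
    refine ⟨q, hq, ?_⟩
    rw [(e1 y hyD.1).fderiv.fderiv_eq, (e1 y hyD.1).fderiv_eq]
    simpa only [hw y (hD hyD.1)] using hq'

/-- Strong maximum principle for directional derivatives of a solution. -/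
theorem IsMCEquation.dirDeriv_neg_or_eq_zero (h : IsMCEquation Ω f u) (hΩ : IsOpen Ω)
    (hf : ContDiff ℝ 1 f) (hfm : Monotone f) (hu : ∀ x ∈ Ω, ContDiffAt ℝ 3 u x)
    (e : EuclideanSpace ℝ (Fin n)) {D : Set (EuclideanSpace ℝ (Fin n))} (hDo : IsOpen D)
    (hDc : IsPreconnected D) (hD : D ⊆ Ω) (hle : ∀ x ∈ D, fderiv ℝ u x e ≤ 0) :
    (∀ x ∈ D, fderiv ℝ u x e < 0) ∨ ∀ x ∈ D, fderiv ℝ u x e = 0 := by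
  have := (h.isLocSuper_sub_dirDeriv hΩ hf hfm hu e hD le_rfl hle (Or.inl rfl)).pos_or_eq_zero
    hDo hDc (fun x hx => contDiffAt_const.sub ((hu x (hD hx)).dirDeriv (m := 2) (by norm_num) e))
    (fun x hx => by linarith [hle x hx])
  simpa using this

lemma IsMCEquation.f_nonpos (h : IsMCEquation Ω f u) (hΩ : IsOpen Ω) (hne : Ω.Nonempty)
    (hΩb : Bornology.IsBounded Ω) (hfm : Monotone f)
    (hu : ∀ x ∈ Ω, ContDiffAt ℝ 3 u x) (huc : ContinuousOn u (closure Ω))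
    (hu0 : ∀ x ∈ frontier Ω, u x = 0) (hpos : ∀ x ∈ Ω, 0 < u x) : ∀ x ∈ Ω, f (u x) ≤ 0 := by
  obtain ⟨z, hz⟩ := hne
  obtain ⟨x₀, hx₀, hmax⟩ := hΩb.isCompact_closure.exists_isMaxOn ⟨z, subset_closure hz⟩ huc
  have hx₀Ω : x₀ ∈ Ω := by
    by_contra hcon
    have h1 := hu0 x₀ (by rw [hΩ.frontier_eq]; exact ⟨hx₀, hcon⟩)
    have h2 : u z ≤ u x₀ := hmax (subset_closure hz)
    linarith [hpos z hz]
  have hloc : IsLocalMax u x₀ := by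
    filter_upwards [hΩ.mem_nhds hx₀Ω] with y hy using hmax (subset_closure hy)
  have h2 : 0 ≤ mcForm (gradient u x₀) (-fderiv ℝ (fderiv ℝ u) x₀) := by
    refine mcForm_nonneg _ _ fun ξ => ?_
    have := fderiv_fderiv_nonneg_of_isLocalMin (g := fun x => -u x)
      ((hu x₀ hx₀Ω).of_le (by norm_num)).neg hloc.neg ξ
    have e1 : fderiv ℝ (fun x => -u x) = fun x => -fderiv ℝ u x := by
      ext x; simp
    rw [e1, fderiv_fun_neg] at this
    exact this
  rw [mcForm_neg, h x₀ hx₀Ω] at h2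
  have h3 : 0 < √(1 + ‖gradient u x₀‖ ^ 2) ^ 3 := by positivity
  intro x hx
  have h4 : f (u x) ≤ f (u x₀) := hfm (hmax (subset_closure hx))
  nlinarith

end Linearisation

section Comparison

variable {n : ℕ} {Ω : Set (EuclideanSpace ℝ (Fin n))} {f : ℝ → ℝ}

lemma norm_gradient_sub (u₁ u₂ : EuclideanSpace ℝ (Fin n) → ℝ) (x : EuclideanSpace ℝ (Fin n)) :
    ‖gradient u₁ x - gradient u₂ x‖ = ‖fderiv ℝ u₁ x - fderiv ℝ u₂ x‖ := by
  simp only [gradient, ← map_sub, LinearIsometryEquiv.norm_map]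

/-- Comparison principle for the mean curvature equation with nondecreasing right-hand side. -/
theorem IsMCEquation.comparison [NeZero n] {u₁ u₂ : EuclideanSpace ℝ (Fin n) → ℝ}
    (h₁ : IsMCEquation Ω f u₁) (h₂ : IsMCEquation Ω f u₂) (hΩ : IsOpen Ω)
    (hΩb : Bornology.IsBounded Ω) (hf : Continuous f) (hfm : Monotone f)
    (hu₁ : ∀ x ∈ Ω, ContDiffAt ℝ 2 u₁ x) (hu₂ : ∀ x ∈ Ω, ContDiffAt ℝ 2 u₂ x)
    (hc₁ : ContinuousOn u₁ (closure Ω)) (hc₂ : ContinuousOn u₂ (closure Ω))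
    (hbd : ∀ x ∈ frontier Ω, u₁ x ≤ u₂ x) : ∀ x ∈ Ω, u₁ x ≤ u₂ x := by
  have key := nonpos_of_isLocSuper hΩ hΩb (w := fun x => u₁ x - u₂ x) (hc₁.sub hc₂)
    (fun x hx => (hu₁ x hx).sub (hu₂ x hx)) (fun x hx => sub_nonpos.2 (hbd x hx)) ?_
  · exact fun x hx => sub_nonpos.1 (key x hx)
  intro M hM hle x hx _ _
  have c1 : ContinuousAt (gradient u₁) x := continuousAt_gradient ((hu₁ x hx.1).of_le (by norm_num))
  have c2 : ContinuousAt (gradient u₂) x := continuousAt_gradient ((hu₂ x hx.1).of_le (by norm_num))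
  have c3 : ContinuousAt (fderiv ℝ (fderiv ℝ u₂)) x :=
    (((hu₂ x hx.1).fderiv_right (m := 1) (by norm_num)).fderiv_right
      (m := 0) (by norm_num)).continuousAt
  have c3n : ContinuousAt (fun y => ‖fderiv ℝ (fderiv ℝ u₂) y‖) x :=
    (continuous_norm (E := EuclideanSpace ℝ (Fin n) →L[ℝ]
      EuclideanSpace ℝ (Fin n) →L[ℝ] ℝ)).continuousAt.comp c3
  have c4 : ContinuousAt (fun y => f (u₂ y)) x := hf.continuousAt.comp (hu₂ x hx.1).continuousAt
  have c5 : ContinuousAt (fun y => √(1 + ‖gradient u₁ y‖ ^ 2)) x :=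
    Real.continuous_sqrt.continuousAt.comp ((c1.norm.pow 2).const_add 1)
  have c6 : ContinuousAt (fun y => √(1 + ‖gradient u₂ y‖ ^ 2)) x :=
    Real.continuous_sqrt.continuousAt.comp ((c2.norm.pow 2).const_add 1)
  have : ∀ {a b s t g d : EuclideanSpace ℝ (Fin n) → ℝ}, ContinuousAt a x → ContinuousAt b x →
      ContinuousAt s x → ContinuousAt t x → ContinuousAt g x → ContinuousAt d x →
      ContinuousAt (fun y => a y + ((s y + t y) ^ 2 * |g y|
        + (n + 1) * d y * (a y + b y))) x := by
    intro a b s t g d ha hb hs ht hg hd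
    fun_prop
  obtain ⟨K, hK, r, hr, hKr⟩ := exists_ball_le (this c1.norm c2.norm c5 c6 c4 c3n)
  refine ⟨K, hK, r, hr, fun y hy hyD => ⟨gradient u₁ y, ?_, ?_⟩⟩
  · have := hKr y hy
    have : 0 ≤ ((√(1 + ‖gradient u₁ y‖ ^ 2) + √(1 + ‖gradient u₂ y‖ ^ 2)) ^ 2 * |f (u₂ y)|
        + (n + 1) * ‖fderiv ℝ (fderiv ℝ u₂) y‖ * (‖gradient u₁ y‖ + ‖gradient u₂ y‖)) := by
      positivity
    linarith
  have hev : ∀ᶠ z in 𝓝 y, fderiv ℝ (fun x => M - (u₁ x - u₂ x)) z =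
      fderiv ℝ u₂ z - fderiv ℝ u₁ z := by
    filter_upwards [hΩ.mem_nhds hyD.1] with z hz
    rw [fderiv_const_sub, fderiv_fun_sub ((hu₁ z hz).differentiableAt (by simp))
      ((hu₂ z hz).differentiableAt (by simp)), neg_sub]
  have hd2 : fderiv ℝ (fderiv ℝ (fun x => M - (u₁ x - u₂ x))) y =
      fderiv ℝ (fderiv ℝ u₂) y - fderiv ℝ (fderiv ℝ u₁) y := by
    rw [EventuallyEq.fderiv_eq hev]
    exact fderiv_fun_sub
      (((hu₂ y hyD.1).fderiv_right (m := 1) (by norm_num)).differentiableAt (by simp))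
      (((hu₁ y hyD.1).fderiv_right (m := 1) (by norm_num)).differentiableAt (by simp))
  have hn : ‖fderiv ℝ (fun x => M - (u₁ x - u₂ x)) y‖ = ‖gradient u₁ y - gradient u₂ y‖ := by
    rw [hev.self_of_nhds, norm_gradient_sub, norm_sub_rev]
  have hKy := hKr y hy
  have hwpos : 0 < u₁ y - u₂ y := hyD.2
  have hwM : u₁ y - u₂ y ≤ M := hle y hyD.1
  rw [hd2, hn, mcForm_sub, h₁ y hyD.1]
  have e2 := h₂ y hyD.1
  have i1 := abs_le.1 (abs_mcForm_sub_le (gradient u₁ y) (gradient u₂ y) (fderiv ℝ (fderiv ℝ u₂) y))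
  have i2 := abs_sqrt_cube_sub_le (gradient u₁ y) (gradient u₂ y)
  set q₁ := gradient u₁ y
  set q₂ := gradient u₂ y
  set B := fderiv ℝ (fderiv ℝ u₂) y
  set s := √(1 + ‖q₁‖ ^ 2)
  set t := √(1 + ‖q₂‖ ^ 2)
  have hs : 0 ≤ s ^ 3 := by positivity
  have hff : f (u₂ y) ≤ f (u₁ y) := hfm (by linarith)
  have i3 : (t ^ 3 - s ^ 3) * f (u₂ y) ≤ (s + t) ^ 2 * ‖q₁ - q₂‖ * |f (u₂ y)| := by
    refine (le_abs_self _).trans ?_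
    rw [abs_mul, abs_sub_comm]
    gcongr
  have i4 : ((s + t) ^ 2 * |f (u₂ y)| + (n + 1) * ‖B‖ * (‖q₁‖ + ‖q₂‖)) * ‖q₁ - q₂‖ ≤
      K * ‖q₁ - q₂‖ := by
    gcongr
    linarith [norm_nonneg q₁]
  have i5 : 0 ≤ K * (M - (u₁ y - u₂ y)) := mul_nonneg hK.le (by linarith)
  nlinarith [mul_le_mul_of_nonneg_left hff hs]

lemma sum_bilin_isometry (R : EuclideanSpace ℝ (Fin n) ≃ₗᵢ[ℝ] EuclideanSpace ℝ (Fin n))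
    (B : EuclideanSpace ℝ (Fin n) →L[ℝ] EuclideanSpace ℝ (Fin n) →L[ℝ] ℝ) :
    ∑ i, B (R (EuclideanSpace.single i 1)) (R (EuclideanSpace.single i 1)) =
      ∑ i, B (EuclideanSpace.single i 1) (EuclideanSpace.single i 1) := by
  have h1 : ∀ j k, ∑ i, R (EuclideanSpace.single i 1) j * R (EuclideanSpace.single i 1) k =
      if j = k then (1 : ℝ) else 0 := by
    intro j k
    have h2 : ∀ i j, R (EuclideanSpace.single i (1 : ℝ)) j =
        R.symm (EuclideanSpace.single j (1 : ℝ)) i := by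
      intro i j
      have := R.inner_map_map (EuclideanSpace.single i (1 : ℝ))
        (R.symm (EuclideanSpace.single j (1 : ℝ)))
      rw [R.apply_symm_apply, EuclideanSpace.inner_single_right,
        EuclideanSpace.inner_single_left] at this
      simpa using this
    simp only [h2]
    have h3 := R.symm.inner_map_map (EuclideanSpace.single j (1 : ℝ))
      (EuclideanSpace.single k (1 : ℝ))
    rw [PiLp.inner_apply] at h3
    simp only [EuclideanSpace.inner_single_left] at h3
    simp only [RCLike.inner_apply, conj_trivial] at h3
    simpa [Pi.single_apply, mul_comm] using h3
  simp_rw [bilin_eq_sum_single B (R _)]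
  rw [Finset.sum_comm]
  refine Finset.sum_congr rfl fun j _ => ?_
  rw [Finset.sum_comm]
  simp only [← Finset.sum_mul, h1]
  simp

lemma fderiv_comp_isometry {F : Type*} [NormedAddCommGroup F] [NormedSpace ℝ F]
    (R : EuclideanSpace ℝ (Fin n) ≃ₗᵢ[ℝ] EuclideanSpace ℝ (Fin n))
    (u : EuclideanSpace ℝ (Fin n) → F) (x ξ : EuclideanSpace ℝ (Fin n)) :
    fderiv ℝ (fun y => u (R y)) x ξ = fderiv ℝ u (R x) (R ξ) := by
  have := R.toContinuousLinearEquiv.comp_right_fderiv (f := u) (x := x)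
  have h2 := congrArg (fun L => L ξ) this
  exact h2

lemma fderiv_fderiv_comp_isometry
    (R : EuclideanSpace ℝ (Fin n) ≃ₗᵢ[ℝ] EuclideanSpace ℝ (Fin n))
    {u : EuclideanSpace ℝ (Fin n) → ℝ} {x : EuclideanSpace ℝ (Fin n)}
    (hu : ContDiffAt ℝ 2 u (R x)) (ξ η : EuclideanSpace ℝ (Fin n)) :
    fderiv ℝ (fderiv ℝ fun y => u (R y)) x ξ η = fderiv ℝ (fderiv ℝ u) (R x) (R ξ) (R η) := by
  have huR : ContDiffAt ℝ 2 (fun y => u (R y)) x :=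
    hu.comp x R.contDiff.contDiffAt
  have h1 := fderiv_dirDeriv huR ξ
  have h2 := congrArg (fun L => L η) h1
  rw [← h2]
  simp only [fderiv_comp_isometry R u]
  rw [fderiv_comp_isometry R (fun z => fderiv ℝ u z (R ξ)), fderiv_dirDeriv hu]

lemma IsMCEquation.comp_isometry {u : EuclideanSpace ℝ (Fin n) → ℝ} (h : IsMCEquation Ω f u)
    (hu : ∀ x ∈ Ω, ContDiffAt ℝ 2 u x)
    (R : EuclideanSpace ℝ (Fin n) ≃ₗᵢ[ℝ] EuclideanSpace ℝ (Fin n)) (hR : ∀ x ∈ Ω, R x ∈ Ω) :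
    IsMCEquation Ω f (fun y => u (R y)) := by
  intro x hx
  have hg : R (gradient (fun y => u (R y)) x) = gradient u (R x) := by
    refine ext_inner_right ℝ fun ξ => ?_
    obtain ⟨ξ, rfl⟩ := R.surjective ξ
    rw [R.inner_map_map]
    simp only [gradient, InnerProductSpace.toDual_symm_apply]
    exact fderiv_comp_isometry R u x ξ
  have hn : ‖gradient (fun y => u (R y)) x‖ = ‖gradient u (R x)‖ := by
    rw [← hg, R.norm_map]
  have := h (R x) (hR x hx)
  rw [mcForm] at this ⊢
  simp only [fderiv_fderiv_comp_isometry R (hu _ (hR x hx))]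
  rw [sum_bilin_isometry, hg, hn]
  exact this

/-- A solution of the Dirichlet problem inherits the symmetries of the domain. -/
theorem IsMCEquation.eq_comp_isometry [NeZero n] {u : EuclideanSpace ℝ (Fin n) → ℝ}
    (h : IsMCEquation Ω f u) (hΩ : IsOpen Ω) (hΩb : Bornology.IsBounded Ω) (hf : Continuous f)
    (hfm : Monotone f) (hu : ∀ x ∈ Ω, ContDiffAt ℝ 2 u x) (hc : ContinuousOn u (closure Ω))
    (hbd : ∀ x ∈ frontier Ω, u x = 0)
    (R : EuclideanSpace ℝ (Fin n) ≃ₗᵢ[ℝ] EuclideanSpace ℝ (Fin n)) (hR : R '' Ω = Ω) :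
    ∀ x ∈ Ω, u (R x) = u x := by
  have hmem : ∀ x ∈ Ω, R x ∈ Ω := fun x hx => hR ▸ mem_image_of_mem R hx
  have hcl : ∀ x ∈ closure Ω, R x ∈ closure Ω := fun x hx =>
    map_mem_closure R.continuous hx hmem
  have hmem' : ∀ x, R x ∈ Ω → x ∈ Ω := by
    intro x hx
    rw [← hR] at hx
    obtain ⟨y, hy, hxy⟩ := hx
    rwa [← R.injective hxy]
  have hfr : ∀ x ∈ frontier Ω, R x ∈ frontier Ω := by
    intro x hx
    rw [hΩ.frontier_eq] at hx ⊢
    exact ⟨hcl x hx.1, fun hcon => hx.2 (hmem' x hcon)⟩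
  have h' := h.comp_isometry hu R hmem
  have hu' : ∀ x ∈ Ω, ContDiffAt ℝ 2 (fun y => u (R y)) x := fun x hx =>
    (hu _ (hmem x hx)).comp x R.contDiff.contDiffAt
  have hc' : ContinuousOn (fun y => u (R y)) (closure Ω) :=
    hc.comp R.continuous.continuousOn hcl
  have hbd' : ∀ x ∈ frontier Ω, u (R x) = u x := fun x hx => by
    rw [hbd x hx, hbd _ (hfr x hx)]
  intro x hx
  exact le_antisymm (h'.comparison h hΩ hΩb hf hfm hu' hu hc' hc (fun x hx => (hbd' x hx).le) x hx)
    (h.comparison h' hΩ hΩb hf hfm hu hu' hc hc' (fun x hx => (hbd' x hx).ge) x hx)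

end Comparison

section Boundary

variable {n : ℕ} {Ω : Set (EuclideanSpace ℝ (Fin n))}

/-- The outer normal functional at a boundary point, with its transversality properties and an
interior touching ball. -/
lemma HasSmoothBoundary.exists_normal (hΩ : IsOpen Ω) (h : HasSmoothBoundary Ω)
    {x : EuclideanSpace ℝ (Fin n)} (hx : x ∈ frontier Ω) :
    ∃ l : EuclideanSpace ℝ (Fin n) →L[ℝ] ℝ, l ≠ 0 ∧
      (∀ e, l e < 0 → ∀ᶠ t in 𝓝[>] (0 : ℝ), x + t • e ∈ Ω) ∧
      (∀ e, 0 < l e → ∀ᶠ t in 𝓝[>] (0 : ℝ), x + t • e ∉ closure Ω) ∧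
      ∃ y, ∃ R > 0, ∃ τ > 0, ‖x - y‖ = R ∧ ball y R ⊆ Ω ∧ ∀ e, inner ℝ (y - x) e = -(τ * l e) := by
  obtain ⟨V, φ, hV, hxV, hφ, hφ', hin, hfr⟩ := h x hx
  have hφx : φ x = 0 := (hfr x hxV).1 hx
  have hsm : ContDiffAt ℝ (⊤ : ℕ∞) φ x := hφ.contDiffAt (hV.mem_nhds hxV)
  have hd : HasFDerivAt φ (fderiv ℝ φ x) x := (hsm.differentiableAt (by simp)).hasFDerivAt
  have hVt : ∀ e, ∀ᶠ t in 𝓝 (0 : ℝ), x + t • e ∈ V := fun e => by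
    have : Continuous (fun t : ℝ => x + t • e) := by fun_prop
    exact this.continuousAt.preimage_mem_nhds (by simpa using hV.mem_nhds hxV)
  refine ⟨fderiv ℝ φ x, hφ' x hxV, fun e he => ?_, fun e he => ?_, ?_⟩
  · have h1 := hasDerivAt_comp_line hd e
    have h2 := eventually_nhdsWithin_sign_eq_of_deriv_neg (by rw [h1.deriv]; exact he)
      (by simpa using hφx)
    have h3 : ∀ᶠ t in 𝓝[>] (0 : ℝ), 0 < t := self_mem_nhdsWithin
    filter_upwards [nhdsWithin_le_nhds h2, nhdsWithin_le_nhds (hVt e), h3] with t ht htV htpos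
    rw [hin _ htV]
    rw [sign_neg (by linarith : 0 - t < 0)] at ht
    exact sign_eq_neg_one_iff.1 ht
  · have h1 := hasDerivAt_comp_line hd e
    have h2 := eventually_nhdsWithin_sign_eq_of_deriv_pos (by rw [h1.deriv]; exact he)
      (by simpa using hφx)
    have h3 : ∀ᶠ t in 𝓝[>] (0 : ℝ), 0 < t := self_mem_nhdsWithin
    filter_upwards [nhdsWithin_le_nhds h2, nhdsWithin_le_nhds (hVt e), h3] with t ht htV htpos
    rw [sign_pos (by linarith : 0 < t - 0)] at ht
    have h4 := sign_eq_one_iff.1 ht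
    intro hcl
    by_cases hm : x + t • e ∈ Ω
    · linarith [(hin _ htV).1 hm]
    · have : x + t • e ∈ frontier Ω := by rw [hΩ.frontier_eq]; exact ⟨hcl, hm⟩
      linarith [(hfr _ htV).1 this]
  · have hC1 : ContDiffAt ℝ 1 (fderiv ℝ φ) x :=
      hsm.fderiv_right (m := 1) (by
        norm_num
        exact WithTop.coe_le_coe.2 (le_top : (2 : ℕ∞) ≤ ⊤))
    obtain ⟨K, s, hs, hlip⟩ := hC1.exists_lipschitzOnWith
    obtain ⟨r, hr, hrs⟩ := Metric.mem_nhds_iff.1 (inter_mem hs (hV.mem_nhds hxV))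
    set N := gradient φ x with hN
    have hNe : ∀ e, inner ℝ N e = fderiv ℝ φ x e := fun e => by
      simp [hN, gradient, InnerProductSpace.toDual_symm_apply]
    have hN0 : 0 < ‖N‖ := by
      rw [hN, norm_gradient]
      exact norm_pos_iff.2 (hφ' x hxV)
    obtain ⟨τ, hτ, hτ1, hτ2⟩ : ∃ τ : ℝ, 0 < τ ∧ 2 * (τ * ‖N‖) < r ∧ 2 * τ * K < 1 := by
      refine ⟨min (r / (4 * ‖N‖)) (1 / (4 * (K + 1))), by positivity, ?_, ?_⟩
      · calc 2 * (min (r / (4 * ‖N‖)) (1 / (4 * ((K : ℝ) + 1))) * ‖N‖)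
            ≤ 2 * (r / (4 * ‖N‖) * ‖N‖) := by gcongr; exact min_le_left _ _
          _ = r / 2 := by field_simp; norm_num
          _ < r := by linarith
      · calc 2 * min (r / (4 * ‖N‖)) (1 / (4 * ((K : ℝ) + 1))) * K
            ≤ 2 * (1 / (4 * ((K : ℝ) + 1))) * K := by gcongr; exact min_le_right _ _
          _ = K / (2 * (K + 1)) := by field_simp; ring
          _ < 1 := by
            rw [div_lt_one (by positivity)]
            linarith [K.2, K.coe_nonneg]
    have hquad : ∀ z ∈ ball x r, φ z ≤ fderiv ℝ φ x (z - x) + K * ‖z - x‖ ^ 2 := by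
      intro z hz
      have hsub : closedBall x ‖z - x‖ ⊆ ball x r :=
        closedBall_subset_ball (by rwa [← dist_eq_norm])
      have h1 := (convex_closedBall x ‖z - x‖).norm_image_sub_le_of_norm_fderiv_le'
        (𝕜 := ℝ) (f := φ) (φ := fderiv ℝ φ x) (C := K * ‖z - x‖) (x := x) (y := z)
        (fun w hw => (hφ.contDiffAt (hV.mem_nhds (hrs (hsub hw)).2)).differentiableAt (by simp))
        (fun w hw => by
          refine (hlip.norm_sub_le (hrs (hsub hw)).1 (mem_of_mem_nhds hs)).trans ?_
          gcongr
          rw [← dist_eq_norm]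
          exact hw)
        (by simp) (by rw [mem_closedBall, dist_eq_norm])
      rw [hφx] at h1
      have := (abs_le.1 h1).2
      nlinarith
    refine ⟨x - τ • N, τ * ‖N‖, by positivity, τ, hτ, ?_, ?_, fun e => ?_⟩
    · rw [sub_sub_cancel, norm_smul, Real.norm_of_nonneg hτ.le]
    · intro z hz
      rw [mem_ball, dist_eq_norm] at hz
      have e1 : z - (x - τ • N) = (z - x) + τ • N := by abel
      have hzx : ‖z - x‖ < r := by
        have : ‖z - x‖ ≤ ‖z - (x - τ • N)‖ + ‖τ • N‖ := by
          rw [e1]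
          have := norm_sub_le ((z - x) + τ • N) (τ • N)
          simpa using this
        rw [norm_smul, Real.norm_of_nonneg hτ.le] at this
        linarith
      have hzr : z ∈ ball x r := by rwa [mem_ball, dist_eq_norm]
      rw [hin z (hrs hzr).2]
      have h2 : ‖z - x‖ ^ 2 + 2 * (τ * fderiv ℝ φ x (z - x)) < 0 := by
        have h3 : ‖z - (x - τ • N)‖ ^ 2 < (τ * ‖N‖) ^ 2 := by gcongr
        rw [e1, norm_add_sq_real, inner_smul_right, real_inner_comm, hNe, norm_smul,
          Real.norm_of_nonneg hτ.le] at h3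
        linarith
      have h4 := hquad z hzr
      have h5 : 2 * τ * φ z ≤ 2 * τ * (fderiv ℝ φ x (z - x) + K * ‖z - x‖ ^ 2) := by gcongr
      have h6 : 2 * τ * K * ‖z - x‖ ^ 2 ≤ 1 * ‖z - x‖ ^ 2 := by gcongr
      by_contra! hcon
      nlinarith [mul_nonneg hτ.le hcon]
    · rw [sub_sub_cancel_left, inner_neg_left, inner_smul_left, hNe]
      simp

lemma HasSmoothBoundary.interior_closure (hΩ : IsOpen Ω) (h : HasSmoothBoundary Ω) :
    interior (closure Ω) = Ω := by
  refine subset_antisymm (fun x hx => ?_) (hΩ.subset_interior_closure)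
  by_contra hxΩ
  have hfr : x ∈ frontier Ω := by
    rw [hΩ.frontier_eq]; exact ⟨interior_subset hx, hxΩ⟩
  obtain ⟨l, hl0, -, hout, -⟩ := h.exists_normal hΩ hfr
  obtain ⟨e, he⟩ : ∃ e, l e ≠ 0 := by
    by_contra! hcon
    exact hl0 (ContinuousLinearMap.ext hcon)
  obtain ⟨e, he⟩ : ∃ e, 0 < l e := by
    rcases lt_or_gt_of_ne he with h' | h'
    · exact ⟨-e, by simpa using h'⟩
    · exact ⟨e, h'⟩
  have h2 : ∀ᶠ t in 𝓝 (0 : ℝ), x + t • e ∈ closure Ω := by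
    have : Continuous (fun t : ℝ => x + t • e) := by fun_prop
    refine this.continuousAt.preimage_mem_nhds ?_
    simpa using mem_interior_iff_mem_nhds.1 hx
  obtain ⟨t, ht1, ht2⟩ := ((h2.filter_mono nhdsWithin_le_nhds).and (hout e he)).exists
  exact ht2 ht1

/-- A positive analytic solution of the Dirichlet problem, `C¹` up to the boundary, on a bounded
convex smooth domain. -/
structure IsConvexMCSolution (Ω : Set (EuclideanSpace ℝ (Fin n))) (f : ℝ → ℝ)
    (u : EuclideanSpace ℝ (Fin n) → ℝ) : Prop where
  isOpen : IsOpen Ω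
  nonempty : Ω.Nonempty
  isBounded : Bornology.IsBounded Ω
  convex : Convex ℝ Ω
  smooth : HasSmoothBoundary Ω
  contDiff_rhs : ContDiff ℝ 1 f
  monotone_rhs : Monotone f
  equation : IsMCEquation Ω f u
  eq_zero : ∀ x ∈ frontier Ω, u x = 0
  pos : ∀ x ∈ Ω, 0 < u x
  analytic : AnalyticOnNhd ℝ u Ω
  contDiffOn : ContDiffOn ℝ 1 u (closure Ω)

namespace IsConvexMCSolution

variable {f : ℝ → ℝ} {u : EuclideanSpace ℝ (Fin n) → ℝ} (h : IsConvexMCSolution Ω f u)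
include h

lemma contDiffAt {x : EuclideanSpace ℝ (Fin n)} (hx : x ∈ Ω) {m : WithTop ℕ∞} :
    ContDiffAt ℝ m u x := (h.analytic x hx).contDiffAt

lemma continuousOn : ContinuousOn u (closure Ω) := h.contDiffOn.continuousOn

lemma mem_frontier {x : EuclideanSpace ℝ (Fin n)} : x ∈ frontier Ω ↔ x ∈ closure Ω ∧ x ∉ Ω := by
  rw [h.isOpen.frontier_eq]; rfl

lemma uniqueDiffOn : UniqueDiffOn ℝ (closure Ω) :=
  uniqueDiffOn_convex h.convex.closure
    (by rw [h.smooth.interior_closure h.isOpen]; exact h.nonempty)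

lemma continuousOn_fderivWithin : ContinuousOn (fderivWithin ℝ u (closure Ω)) (closure Ω) :=
  h.contDiffOn.continuousOn_fderivWithin h.uniqueDiffOn le_rfl

lemma continuousOn_dirDeriv (e : EuclideanSpace ℝ (Fin n)) :
    ContinuousOn (fun x => fderivWithin ℝ u (closure Ω) x e) (closure Ω) :=
  h.continuousOn_fderivWithin.clm_apply continuousOn_const

lemma fderivWithin_eq {x : EuclideanSpace ℝ (Fin n)} (hx : x ∈ Ω) :
    fderivWithin ℝ u (closure Ω) x = fderiv ℝ u x :=
  fderivWithin_of_mem_nhds (mem_of_superset (h.isOpen.mem_nhds hx) subset_closure)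

lemma hasDerivWithinAt_line {x : EuclideanSpace ℝ (Fin n)} (hx : x ∈ closure Ω)
    {e : EuclideanSpace ℝ (Fin n)} (he : ∀ᶠ t in 𝓝[>] (0 : ℝ), x + t • e ∈ closure Ω) :
    HasDerivWithinAt (fun t : ℝ => u (x + t • e)) (fderivWithin ℝ u (closure Ω) x e)
      (Ici 0) 0 := by
  have h1 : HasFDerivWithinAt u (fderivWithin ℝ u (closure Ω) x) (closure Ω) x :=
    (h.contDiffOn.differentiableOn (by simp) x hx).hasFDerivWithinAt
  have h3 : HasDerivWithinAt (fun t : ℝ => x + t • e) e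
      ({t | x + t • e ∈ closure Ω}) 0 := by
    simpa using (((hasDerivAt_id (0 : ℝ)).smul_const e).const_add x).hasDerivWithinAt
  have h1' : HasFDerivWithinAt u (fderivWithin ℝ u (closure Ω) x) (closure Ω)
      (x + (0 : ℝ) • e) := by simpa using h1
  have h4 := h1'.comp_hasDerivWithinAt (0 : ℝ) h3 (fun t ht => ht)
  have h5 : HasDerivWithinAt (fun t : ℝ => u (x + t • e)) (fderivWithin ℝ u (closure Ω) x e)
      (Ioi 0) 0 := by
    refine HasDerivWithinAt.mono_of_mem_nhdsWithin h4 he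
  exact hasDerivWithinAt_Ioi_iff_Ici.1 h5

/-- At a boundary point, the solution increases exactly in the inward transversal directions. -/
theorem dirDeriv_pos_iff [NeZero n] {x : EuclideanSpace ℝ (Fin n)} (hx : x ∈ frontier Ω)
    (e : EuclideanSpace ℝ (Fin n)) :
    0 < fderivWithin ℝ u (closure Ω) x e ↔ ∃ t : ℝ, 0 < t ∧ x + t • e ∈ Ω := by
  obtain ⟨l, hl0, hin, hout, y, R, hR, τ, hτ, hxy, hball, hτl⟩ := h.smooth.exists_normal h.isOpen hx
  have hxcl : x ∈ closure Ω := frontier_subset_closure hx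
  obtain ⟨η, hη⟩ : ∃ e, 0 < l e := by
    obtain ⟨e, he⟩ : ∃ e, l e ≠ 0 := by
      by_contra! hcon
      exact hl0 (ContinuousLinearMap.ext hcon)
    rcases lt_or_gt_of_ne he with h' | h'
    · exact ⟨-e, by simpa using h'⟩
    · exact ⟨e, h'⟩
  have hpos : ∀ e, l e < 0 → 0 < fderivWithin ℝ u (closure Ω) x e := by
    intro e he
    have hfn := h.equation.f_nonpos h.isOpen h.nonempty h.isBounded h.monotone_rhs
      (fun x hx => h.contDiffAt hx) h.continuousOn h.eq_zero h.pos
    obtain ⟨K, hK⟩ := h.isBounded.isCompact_closure.exists_bound_of_continuousOn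
      h.continuousOn_fderivWithin
    have hcb : closedBall y R ⊆ closure Ω := by
      rw [← closure_ball y hR.ne']
      exact closure_mono hball
    refine hopf_hasDerivWithinAt_pos (K := max K 0) (le_max_right _ _) hR y
      (h.continuousOn.mono hcb)
      (fun z hz => h.contDiffAt (hball hz)) (fun z hz => h.pos z (hball hz)) (fun z hz => ?_) hxy
      (h.eq_zero x hx) (e := e) (by rw [hτl]; nlinarith)
      (h.hasDerivWithinAt_line hxcl ((hin e he).mono fun t ht => subset_closure ht))
    have hzΩ := hball hz
    refine ⟨gradient u z, ?_, ?_⟩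
    · rw [norm_gradient, ← h.fderivWithin_eq hzΩ]
      exact (hK z (subset_closure hzΩ)).trans (le_max_left _ _)
    · rw [h.equation z hzΩ]
      have h1 : 0 ≤ √(1 + ‖gradient u z‖ ^ 2) ^ 3 := by positivity
      have h2 : 0 ≤ max K 0 * (‖fderiv ℝ u z‖ + u z) :=
        mul_nonneg (le_max_right _ _) (add_nonneg (norm_nonneg _) (h.pos z hzΩ).le)
      nlinarith [hfn z hzΩ]
  constructor
  · intro he
    have hle : l e < 0 := by
      by_contra! hcon
      set A := fderivWithin ℝ u (closure Ω) x
      have h1 : ∀ ε : ℝ, 0 < ε → A e + ε * A η < 0 := by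
        intro ε hε
        have h2 := hpos (-(e + ε • η)) (by
          rw [map_neg, map_add, map_smul, smul_eq_mul]
          nlinarith [mul_pos hε hη])
        rw [map_neg, map_add, map_smul, smul_eq_mul] at h2
        linarith
      have h3 := h1 (A e / (2 * (|A η| + 1))) (by positivity)
      have h4 : |A e / (2 * (|A η| + 1)) * A η| ≤ A e / 2 := by
        rw [abs_mul, abs_of_pos (by positivity : 0 < A e / (2 * (|A η| + 1)))]
        rw [div_mul_eq_mul_div, div_le_div_iff₀ (by positivity) (by norm_num)]
        nlinarith [abs_nonneg (A η)]
      linarith [(abs_le.1 h4).1]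
    have h2 : ∀ᶠ t in 𝓝[>] (0 : ℝ), 0 < t := self_mem_nhdsWithin
    exact (h2.and (hin e hle)).exists
  · rintro ⟨t, ht, htΩ⟩
    refine hpos e ?_
    by_contra! hcon
    have h1 : ∀ᶠ s in 𝓝 (0 : ℝ), x + t • (e + s • η) ∈ Ω := by
      have : Continuous (fun s : ℝ => x + t • (e + s • η)) := by fun_prop
      exact this.continuousAt.preimage_mem_nhds (by simpa using h.isOpen.mem_nhds htΩ)
    have h2 : ∀ᶠ s in 𝓝[>] (0 : ℝ), 0 < s := self_mem_nhdsWithin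
    obtain ⟨s, hs, hsΩ⟩ := (h2.and (h1.filter_mono nhdsWithin_le_nhds)).exists
    have h3 := hout (e + s • η) (by
      rw [map_add, map_smul, smul_eq_mul]
      nlinarith [mul_pos hs hη])
    have h4 : ∀ᶠ r in 𝓝[>] (0 : ℝ), r < t := nhdsWithin_le_nhds (eventually_lt_nhds ht)
    have h2' : ∀ᶠ s in 𝓝[>] (0 : ℝ), 0 < s := self_mem_nhdsWithin
    obtain ⟨r, ⟨hr, hrt⟩, hr0⟩ := ((h3.and h4).and h2').exists
    refine hr ?_
    have h5 := h.convex.closure.add_smul_sub_mem hxcl (subset_closure hsΩ)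
      (t := r / t) ⟨by positivity, by rw [div_le_one ht]; exact hrt.le⟩
    have h6 : x + (r / t) • (x + t • (e + s • η) - x) = x + r • (e + s • η) := by
      rw [add_sub_cancel_left, smul_smul, div_mul_cancel₀ _ ht.ne']
    rwa [h6] at h5

/-- Moving from an interior point in any direction, the solution must decrease somewhere. -/
lemma exists_dirDeriv_neg {x : EuclideanSpace ℝ (Fin n)} (hx : x ∈ Ω)
    {e : EuclideanSpace ℝ (Fin n)} (he : e ≠ 0) :
    ∃ t : ℝ, 0 < t ∧ x + t • e ∈ Ω ∧ fderiv ℝ u (x + t • e) e < 0 := by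
  have hγ : Continuous (fun t : ℝ => x + t • e) := by fun_prop
  set S : Set ℝ := {t | 0 ≤ t ∧ x + t • e ∉ Ω} with hS
  have hScl : IsClosed S :=
    isClosed_Ici.inter (h.isOpen.isClosed_compl.preimage hγ)
  have hSne : S.Nonempty := by
    obtain ⟨C, hC⟩ := h.isBounded.exists_norm_le
    refine ⟨(|C| + ‖x‖ + 1) / ‖e‖, by positivity, fun hcon => ?_⟩
    have h1 := hC _ hcon
    have h2 : ‖((|C| + ‖x‖ + 1) / ‖e‖) • e‖ = |C| + ‖x‖ + 1 := by
      rw [norm_smul, Real.norm_of_nonneg (by positivity),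
        div_mul_cancel₀ _ (norm_ne_zero_iff.2 he)]
    have h3 := norm_sub_le (x + ((|C| + ‖x‖ + 1) / ‖e‖) • e) x
    rw [add_sub_cancel_left, h2] at h3
    linarith [le_abs_self C]
  have hSb : BddBelow S := ⟨0, fun t ht => ht.1⟩
  set T := sInf S
  have hTS : T ∈ S := hScl.csInf_mem hSne hSb
  have hT0 : 0 < T := by
    refine lt_of_le_of_ne hTS.1 fun h0 => hTS.2 ?_
    rw [← h0]
    simpa using hx
  have hlt : ∀ t, 0 ≤ t → t < T → x + t • e ∈ Ω := by
    intro t ht0 htT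
    by_contra hcon
    exact absurd (csInf_le hSb ⟨ht0, hcon⟩) (not_le.2 htT)
  have hTcl : x + T • e ∈ closure Ω := by
    have h1 : ∀ᶠ t in 𝓝[<] T, 0 < t := nhdsWithin_le_nhds (eventually_gt_nhds hT0)
    have h2 : ∀ᶠ t in 𝓝[<] T, t < T := self_mem_nhdsWithin
    exact mem_closure_of_tendsto (hγ.continuousAt.mono_left nhdsWithin_le_nhds)
      ((h1.and h2).mono fun t ht => hlt t ht.1.le ht.2)
  have hTfr : x + T • e ∈ frontier Ω := h.mem_frontier.2 ⟨hTcl, hTS.2⟩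
  have hcont : ContinuousOn (fun t : ℝ => u (x + t • e)) (Icc 0 T) := by
    refine h.continuousOn.comp hγ.continuousOn fun t ht => ?_
    rcases ht.2.lt_or_eq with h1 | h1
    · exact subset_closure (hlt t ht.1 h1)
    · rw [h1]; exact hTcl
  have hder : ∀ t ∈ Ioo 0 T, HasDerivAt (fun t : ℝ => u (x + t • e))
      (fderiv ℝ u (x + t • e) e) t := by
    intro t ht
    have h3 : HasDerivAt (fun t : ℝ => x + t • e) e t := by
      simpa using ((hasDerivAt_id t).smul_const e).const_add x
    exact ((h.contDiffAt (m := 1) (hlt t ht.1.le ht.2)).differentiableAt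
      (by simp)).hasFDerivAt.comp_hasDerivAt t h3
  obtain ⟨t, ht, ht'⟩ := exists_hasDerivAt_eq_slope _ _ hT0 hcont hder
  refine ⟨t, ht.1, hlt t ht.1.le ht.2, ?_⟩
  rw [ht', h.eq_zero _ hTfr]
  simp only [zero_smul, add_zero, zero_sub, sub_zero]
  exact div_neg_of_neg_of_pos (neg_lt_zero.2 (h.pos x hx)) hT0

end IsConvexMCSolution

end Boundary

namespace IsConvexMCSolution

variable {n : ℕ} {Ω : Set (EuclideanSpace ℝ (Fin n))} {f : ℝ → ℝ}
  {u : EuclideanSpace ℝ (Fin n) → ℝ} (h : IsConvexMCSolution Ω f u)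
include h

lemma continuousOn_fderiv_apply (e : EuclideanSpace ℝ (Fin n)) :
    ContinuousOn (fun x => fderiv ℝ u x e) Ω :=
  ((h.continuousOn_dirDeriv e).mono subset_closure).congr fun x hx => by
    simp only [h.fderivWithin_eq hx]

lemma isOpen_dirDeriv_pos (e : EuclideanSpace ℝ (Fin n)) :
    IsOpen {x | x ∈ Ω ∧ 0 < fderiv ℝ u x e} :=
  (h.continuousOn_fderiv_apply e).isOpen_inter_preimage h.isOpen isOpen_Ioi

/-- The part of the boundary where the solution increases in a given direction is the image of
the domain under the projection along that direction, hence connected. -/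
lemma isPreconnected_frontier_dirDeriv_pos [NeZero n] {e : EuclideanSpace ℝ (Fin n)}
    (he : e ≠ 0) :
    IsPreconnected {x | x ∈ frontier Ω ∧ 0 < fderivWithin ℝ u (closure Ω) x e} := by
  set S : EuclideanSpace ℝ (Fin n) → Set ℝ := fun q => {t | q - t • e ∈ closure Ω} with hS
  have hSb : ∀ q, BddAbove (S q) := by
    intro q
    obtain ⟨C, hC⟩ := h.isBounded.closure.exists_norm_le
    refine ⟨(‖q‖ + C) / ‖e‖, fun t ht => ?_⟩
    rw [le_div_iff₀ (norm_pos_iff.2 he)]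
    have h1 := hC _ ht
    have h2 : ‖t • e‖ = |t| * ‖e‖ := by rw [norm_smul, Real.norm_eq_abs]
    have h3 := norm_sub_le q (q - t • e)
    rw [sub_sub_cancel, h2] at h3
    nlinarith [le_abs_self t, norm_nonneg e]
  have hScl : ∀ q, IsClosed (S q) := fun q =>
    isClosed_closure.preimage (by fun_prop : Continuous fun t : ℝ => q - t • e)
  set τ : EuclideanSpace ℝ (Fin n) → ℝ := fun q => sSup (S q) with hτ
  have h0 : ∀ q ∈ Ω, (0 : ℝ) ∈ S q := fun q hq => by
    simpa [hS] using subset_closure hq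
  have hmem : ∀ q ∈ Ω, τ q ∈ S q := fun q hq => (hScl q).csSup_mem ⟨0, h0 q hq⟩ (hSb q)
  have hle : ∀ q t, t ∈ S q → t ≤ τ q := fun q t ht => le_csSup (hSb q) ht
  have hstep : ∀ x ∈ Ω, ∃ s : ℝ, 0 < s ∧ x - s • e ∈ Ω := by
    intro x hx
    have h1 : ∀ᶠ s in 𝓝 (0 : ℝ), x - s • e ∈ Ω := by
      have : Continuous (fun s : ℝ => x - s • e) := by fun_prop
      exact this.continuousAt.preimage_mem_nhds (by simpa using h.isOpen.mem_nhds hx)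
    have h2 : ∀ᶠ s in 𝓝[>] (0 : ℝ), 0 < s := self_mem_nhdsWithin
    exact (h2.and (h1.filter_mono nhdsWithin_le_nhds)).exists
  have hconc : ConcaveOn ℝ Ω τ := by
    refine ⟨h.convex, fun x hx y hy a b ha hb hab => hle _ _ ?_⟩
    have h1 := h.convex.closure (hmem x hx) (hmem y hy) ha hb hab
    have h2 : a • (x - τ x • e) + b • (y - τ y • e)
        = a • x + b • y - (a • τ x + b • τ y) • e := by
      simp only [smul_eq_mul]
      module
    rw [h2] at h1
    exact h1
  have hτc : ContinuousOn τ Ω := hconc.continuousOn h.isOpen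
  have himage : (fun q => q - τ q • e) '' Ω =
      {x | x ∈ frontier Ω ∧ 0 < fderivWithin ℝ u (closure Ω) x e} := by
    ext x
    constructor
    · rintro ⟨q, hq, rfl⟩
      have hfr : q - τ q • e ∈ frontier Ω := by
        refine h.mem_frontier.2 ⟨hmem q hq, fun hcon => ?_⟩
        obtain ⟨s, hs, hs'⟩ := hstep _ hcon
        have := hle q (τ q + s) (subset_closure (by
          rw [add_smul, ← sub_sub]; exact hs'))
        linarith
      refine ⟨hfr, (h.dirDeriv_pos_iff hfr e).2 ⟨τ q, ?_, by simpa using hq⟩⟩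
      obtain ⟨s, hs, hs'⟩ := hstep q hq
      exact hs.trans_le (hle q s (subset_closure hs'))
    · rintro ⟨hx, hpos⟩
      obtain ⟨t, ht, htΩ⟩ := (h.dirDeriv_pos_iff hx e).1 hpos
      refine ⟨x + t • e, htΩ, ?_⟩
      have hxcl := (h.mem_frontier.1 hx).1
      have htle : t ≤ τ (x + t • e) := hle _ _ (by simpa [hS] using hxcl)
      have hτt : τ (x + t • e) = t := by
        refine ((eq_or_lt_of_le htle).resolve_right fun hlt => ?_).symm
        refine (h.mem_frontier.1 hx).2 ?_
        have hΩi : x + t • e ∈ interior Ω := by rwa [h.isOpen.interior_eq]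
        have hseg := h.convex.openSegment_interior_closure_subset_interior hΩi (hmem _ htΩ)
        rw [h.isOpen.interior_eq] at hseg
        set T := τ (x + t • e)
        have hT : 0 < T := ht.trans hlt
        refine hseg ⟨1 - t / T, t / T, ?_, by positivity, by ring, ?_⟩
        · rw [sub_pos, div_lt_one hT]; exact hlt
        · have : (1 - t / T) • (x + t • e) + (t / T) • (x + t • e - T • e)
              = x + (t - t / T * T) • e := by module
          rw [this, div_mul_cancel₀ _ hT.ne']
          simp
      simp [hτt]
  rw [← himage]
  exact h.convex.isPreconnected.image _ (continuousOn_id.sub (hτc.smul continuousOn_const))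

/-- The set where a directional derivative of the solution is positive is connected. -/
theorem isPreconnected_dirDeriv_pos [NeZero n] {e : EuclideanSpace ℝ (Fin n)} (he : e ≠ 0) :
    IsPreconnected {x | x ∈ Ω ∧ 0 < fderiv ℝ u x e} := by
  set D := {x | x ∈ Ω ∧ 0 < fderiv ℝ u x e} with hD
  set Γ := {x | x ∈ frontier Ω ∧ 0 < fderivWithin ℝ u (closure Ω) x e} with hΓ
  have hDo : IsOpen D := h.isOpen_dirDeriv_pos e
  intro U V hU hV hDUV hUne hVne
  by_contra hcon
  rw [not_nonempty_iff_eq_empty] at hcon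
  have hdisj : ∀ x ∈ D, x ∈ U → x ∉ V := fun x hx hxU hxV => by
    have : x ∈ D ∩ (U ∩ V) := ⟨hx, hxU, hxV⟩
    rw [hcon] at this
    exact this
  have hcover : Γ ⊆ interior (D ∩ U ∪ Ωᶜ) ∪ interior (D ∩ V ∪ Ωᶜ) := by
    rintro x ⟨hx, hpos⟩
    have hxcl := (h.mem_frontier.1 hx).1
    have h1 : ∀ᶠ y in 𝓝[closure Ω] x, 0 < fderivWithin ℝ u (closure Ω) y e :=
      (h.continuousOn_dirDeriv e x hxcl).eventually (eventually_gt_nhds hpos)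
    obtain ⟨r, hr, hball⟩ := Metric.mem_nhdsWithin_iff.1 h1
    have hsub : ball x r ∩ Ω ⊆ D := fun y hy => by
      refine ⟨hy.2, ?_⟩
      have := hball ⟨hy.1, subset_closure hy.2⟩
      rw [mem_ofPred_eq, h.fderivWithin_eq hy.2] at this
      exact this
    have hpre : IsPreconnected (ball x r ∩ Ω) :=
      ((convex_ball x r).inter h.convex).isPreconnected
    have hin : ∀ W : Set (EuclideanSpace ℝ (Fin n)), ball x r ∩ Ω ⊆ W →
        x ∈ interior (D ∩ W ∪ Ωᶜ) := fun W hW =>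
      mem_interior.2 ⟨ball x r, fun y hy => by
        by_cases hyΩ : y ∈ Ω
        · exact Or.inl ⟨hsub ⟨hy, hyΩ⟩, hW ⟨hy, hyΩ⟩⟩
        · exact Or.inr hyΩ, isOpen_ball, mem_ball_self hr⟩
    rcases isPreconnected_iff_subset_of_disjoint.1 hpre U V hU hV (hsub.trans hDUV)
      (eq_empty_of_forall_notMem fun y hy => hdisj y (hsub hy.1) hy.2.1 hy.2.2) with hs | hs
    · exact Or.inl (hin U hs)
    · exact Or.inr (hin V hs)
  have hkey : ∀ U V : Set (EuclideanSpace ℝ (Fin n)), IsOpen U → IsOpen V → D ⊆ U ∪ V →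
      (∀ x ∈ D, x ∈ U → x ∉ V) → (D ∩ U).Nonempty →
      Γ ⊆ interior (D ∩ U ∪ Ωᶜ) ∪ interior (D ∩ V ∪ Ωᶜ) →
      (Γ ∩ interior (D ∩ U ∪ Ωᶜ)).Nonempty := by
    intro U V hU hV hDUV hdisj hne hcover
    by_contra hcon
    rw [not_nonempty_iff_eq_empty] at hcon
    have hAΩ : D ∩ U ⊆ Ω := fun x hx => hx.1.1
    have hAcl : closure (D ∩ U) ⊆ closure Ω := closure_mono hAΩ
    obtain ⟨z, hz⟩ := hne
    refine absurd (h.equation.dirDeriv_nonpos h.isOpen h.contDiff_rhs h.monotone_rhs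
      (fun x hx => h.contDiffAt hx) e (hDo.inter hU) (h.isBounded.subset hAΩ) hAΩ
      (w := fun x => fderivWithin ℝ u (closure Ω) x e)
      (fun x hx => by rw [h.fderivWithin_eq hx]) ((h.continuousOn_dirDeriv e).mono hAcl)
      (fun x hx => ?_) z hz) (not_le.2 hz.1.2)
    rw [(hDo.inter hU).frontier_eq] at hx
    by_contra! hpos
    by_cases hxΩ : x ∈ Ω
    · rw [h.fderivWithin_eq hxΩ] at hpos
      have hxD : x ∈ D := ⟨hxΩ, hpos⟩
      have hxV : x ∈ V := (hDUV hxD).resolve_left fun hxU => hx.2 ⟨hxD, hxU⟩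
      obtain ⟨y, hyV, hyA⟩ := mem_closure_iff.1 hx.1 V hV hxV
      exact hdisj y hyA.1 hyA.2 hyV
    · have hxΓ : x ∈ Γ := ⟨h.mem_frontier.2 ⟨hAcl hx.1, hxΩ⟩, hpos⟩
      have hxB : x ∈ interior (D ∩ V ∪ Ωᶜ) := (hcover hxΓ).resolve_left fun hxA => by
        have : x ∈ Γ ∩ interior (D ∩ U ∪ Ωᶜ) := ⟨hxΓ, hxA⟩
        rw [hcon] at this
        exact this
      obtain ⟨y, hyB, hyA⟩ := mem_closure_iff.1 hx.1 _ isOpen_interior hxB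
      rcases interior_subset hyB with hy | hy
      · exact hdisj y hyA.1 hyA.2 hy.2
      · exact hy hyA.1.1
  have hA := hkey U V hU hV hDUV hdisj hUne hcover
  have hB := hkey V U hV hU (by rwa [union_comm]) (fun x hx hxV hxU => hdisj x hx hxU hxV) hVne
    (by rwa [union_comm])
  obtain ⟨x, hxΓ, hxA, hxB⟩ := h.isPreconnected_frontier_dirDeriv_pos he _ _ isOpen_interior
    isOpen_interior hcover hA hB
  obtain ⟨y, ⟨hyA, hyB⟩, hyΩ⟩ := mem_closure_iff.1 (h.mem_frontier.1 hxΓ.1).1 _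
    (isOpen_interior.inter isOpen_interior) ⟨hxA, hxB⟩
  have hyA' := (interior_subset hyA).resolve_right fun hc => hc hyΩ
  have hyB' := (interior_subset hyB).resolve_right fun hc => hc hyΩ
  exact hdisj y hyA'.1 hyA'.2 hyB'.2

end IsConvexMCSolution

lemma exists_reflection {E : Type*} [NormedAddCommGroup E] [InnerProductSpace ℝ E] {e : E}
    (he : ‖e‖ = 1) : ∃ R : E ≃ₗᵢ[ℝ] E, ∀ x, R x = x - (2 * ⟪e, x⟫) • e := by
  refine ⟨(ℝ ∙ e)ᗮ.reflection, fun x => ?_⟩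
  rw [Submodule.reflection_orthogonal_apply, Submodule.reflection_singleton_apply, he]
  simp only [RCLike.ofReal_real_eq_id, id_eq, one_pow, div_one]
  module

namespace IsConvexMCSolution

variable {n : ℕ} {Ω : Set (EuclideanSpace ℝ (Fin n))} {f : ℝ → ℝ}
  {u : EuclideanSpace ℝ (Fin n) → ℝ} (h : IsConvexMCSolution Ω f u)
include h

lemma eventuallyEq_comp_isometry [NeZero n]
    {R : EuclideanSpace ℝ (Fin n) ≃ₗᵢ[ℝ] EuclideanSpace ℝ (Fin n)} (hR : R '' Ω = Ω)
    {x : EuclideanSpace ℝ (Fin n)} (hx : x ∈ Ω) : (fun y => u (R y)) =ᶠ[𝓝 x] u := by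
  filter_upwards [h.isOpen.mem_nhds hx] with y hy
  exact h.equation.eq_comp_isometry h.isOpen h.isBounded h.contDiff_rhs.continuous h.monotone_rhs
    (fun x hx => h.contDiffAt hx) h.continuousOn h.eq_zero R hR y hy

lemma fderiv_isometry [NeZero n]
    {R : EuclideanSpace ℝ (Fin n) ≃ₗᵢ[ℝ] EuclideanSpace ℝ (Fin n)} (hR : R '' Ω = Ω)
    {x : EuclideanSpace ℝ (Fin n)} (hx : x ∈ Ω) (ξ : EuclideanSpace ℝ (Fin n)) :
    fderiv ℝ u (R x) (R ξ) = fderiv ℝ u x ξ := by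
  rw [← fderiv_comp_isometry, (h.eventuallyEq_comp_isometry hR hx).fderiv_eq]

lemma fderiv_fderiv_isometry [NeZero n]
    {R : EuclideanSpace ℝ (Fin n) ≃ₗᵢ[ℝ] EuclideanSpace ℝ (Fin n)} (hR : R '' Ω = Ω)
    {x : EuclideanSpace ℝ (Fin n)} (hx : x ∈ Ω) (ξ η : EuclideanSpace ℝ (Fin n)) :
    fderiv ℝ (fderiv ℝ u) (R x) (R ξ) (R η) = fderiv ℝ (fderiv ℝ u) x ξ η := by
  have hRx : R x ∈ Ω := hR ▸ mem_image_of_mem R hx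
  rw [← fderiv_fderiv_comp_isometry R (h.contDiffAt hRx),
    (h.eventuallyEq_comp_isometry hR hx).fderiv.fderiv_eq]

variable {e : EuclideanSpace ℝ (Fin n)}
  {R : EuclideanSpace ℝ (Fin n) ≃ₗᵢ[ℝ] EuclideanSpace ℝ (Fin n)}

/-- On the positive side of a symmetry hyperplane, the solution decreases in the normal
direction. -/
theorem dirDeriv_neg_of_reflection [NeZero n] (he : ‖e‖ = 1)
    (hRe : ∀ x, R x = x - (2 * ⟪e, x⟫) • e) (hR : R '' Ω = Ω)
    {x : EuclideanSpace ℝ (Fin n)} (hx : x ∈ Ω) (hex : 0 < ⟪e, x⟫) : fderiv ℝ u x e < 0 := by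
  have hee : ⟪e, e⟫ = 1 := by rw [real_inner_self_eq_norm_sq, he]; norm_num
  have hRΩ : ∀ x ∈ Ω, R x ∈ Ω := fun x hx => hR ▸ mem_image_of_mem R hx
  set D := Ω ∩ {x | 0 < ⟪e, x⟫} with hD
  have hic : Continuous fun x : EuclideanSpace ℝ (Fin n) => ⟪e, x⟫ := by fun_prop
  have hDo : IsOpen D := h.isOpen.inter (isOpen_lt continuous_const hic)
  have hDΩ : D ⊆ Ω := inter_subset_left
  have hDc : IsPreconnected D :=
    (h.convex.inter (convex_halfSpace_gt (innerₛₗ ℝ e).isLinear 0)).isPreconnected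
  have hle : ∀ x ∈ D, fderiv ℝ u x e ≤ 0 := by
    refine h.equation.dirDeriv_nonpos h.isOpen h.contDiff_rhs h.monotone_rhs
      (fun x hx => h.contDiffAt hx) e hDo (h.isBounded.subset hDΩ) hDΩ
      (w := fun x => fderivWithin ℝ u (closure Ω) x e)
      (fun x hx => by rw [h.fderivWithin_eq hx])
      ((h.continuousOn_dirDeriv e).mono (closure_mono hDΩ)) fun x hx => ?_
    rw [hDo.frontier_eq] at hx
    have hxcl : x ∈ closure Ω := closure_mono hDΩ hx.1
    have hex : 0 ≤ ⟪e, x⟫ := by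
      have : closure D ⊆ {x | 0 ≤ ⟪e, x⟫} :=
        closure_minimal (fun x hx => (show 0 < ⟪e, x⟫ from hx.2).le) (isClosed_le continuous_const hic)
      exact this hx.1
    by_cases hxΩ : x ∈ Ω
    · have h0 : ⟪e, x⟫ = 0 := le_antisymm (not_lt.1 fun hc => hx.2 ⟨hxΩ, hc⟩) hex
      rw [h.fderivWithin_eq hxΩ]
      have h1 := h.fderiv_isometry hR hxΩ e
      have h2 : R x = x := by rw [hRe, h0]; simp
      have h3 : R e = -e := by rw [hRe, hee]; module
      rw [h2, h3, map_neg] at h1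
      linarith
    · by_contra! hpos
      obtain ⟨t, ht, htΩ⟩ :=
        (h.dirDeriv_pos_iff (h.mem_frontier.2 ⟨hxcl, hxΩ⟩) e).1 hpos
      refine hxΩ ?_
      have h1 := hRΩ _ htΩ
      rw [hRe, inner_add_right, inner_smul_right, hee] at h1
      set a := 2 * ⟪e, x⟫ + t with ha
      have hapos : 0 < a := by positivity
      have h2 := h.convex htΩ h1 (a := a / (a + t)) (b := t / (a + t)) (by positivity)
        (by positivity) (by field_simp)
      have h3 : (a / (a + t)) • (x + t • e)
          + (t / (a + t)) • (x + t • e - (2 * (⟪e, x⟫ + t * 1)) • e)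
          = ((a + t) / (a + t)) • x + ((a * t - t * a) / (a + t)) • e := by
        rw [ha]; module
      rw [h3, div_self (by positivity), sub_eq_zero.2 (mul_comm a t)] at h2
      simpa using h2
  rcases h.equation.dirDeriv_neg_or_eq_zero h.isOpen h.contDiff_rhs h.monotone_rhs
    (fun x hx => h.contDiffAt hx) e hDo hDc hDΩ hle with h1 | h1
  · exact h1 x ⟨hx, hex⟩
  · obtain ⟨t, ht, htΩ, hneg⟩ := h.exists_dirDeriv_neg hx (e := e) (by
      rintro rfl; simp at he)
    refine absurd (h1 _ ⟨htΩ, ?_⟩) hneg.ne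
    simp only [mem_ofPred_eq, inner_add_right, inner_smul_right, hee]
    linarith

lemma inner_eq_zero_of_fderiv_eq_zero [NeZero n] (he : ‖e‖ = 1)
    (hRe : ∀ x, R x = x - (2 * ⟪e, x⟫) • e) (hR : R '' Ω = Ω)
    {p : EuclideanSpace ℝ (Fin n)} (hp : p ∈ Ω) (hcrit : fderiv ℝ u p = 0) : ⟪e, p⟫ = 0 := by
  rcases lt_trichotomy ⟪e, p⟫ 0 with h1 | h1 | h1
  · have := h.dirDeriv_neg_of_reflection (e := -e) (by rwa [norm_neg])
      (fun x => by rw [hRe, inner_neg_left]; module) hR hp (by rw [inner_neg_left]; linarith)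
    simp [hcrit] at this
  · exact h1
  · have := h.dirDeriv_neg_of_reflection he hRe hR hp h1
    simp [hcrit] at this

/-- On a symmetry hyperplane, the second normal derivative of the solution is negative. -/
theorem fderiv_fderiv_neg_of_reflection [NeZero n] (he : ‖e‖ = 1)
    (hRe : ∀ x, R x = x - (2 * ⟪e, x⟫) • e) (hR : R '' Ω = Ω)
    {p : EuclideanSpace ℝ (Fin n)} (hp : p ∈ Ω) (hep : ⟪e, p⟫ = 0) :
    fderiv ℝ (fderiv ℝ u) p e e < 0 := by
  have hee : ⟪e, e⟫ = 1 := by rw [real_inner_self_eq_norm_sq, he]; norm_num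
  obtain ⟨K, hK, r, hr, hb⟩ := h.equation.exists_linearised_bound h.isOpen h.contDiff_rhs
    h.monotone_rhs (fun x hx => h.contDiffAt hx) e hp
  obtain ⟨s, hs, hsΩ⟩ := Metric.isOpen_iff.1 h.isOpen p hp
  obtain ⟨δ, hδ, hδr, hδs⟩ : ∃ δ, 0 < δ ∧ 2 * δ < r ∧ 2 * δ < s :=
    ⟨min r s / 4, by positivity, by linarith [min_le_left r s], by linarith [min_le_right r s]⟩
  have hdist : ∀ x ∈ closedBall (p + δ • e) δ, dist x p ≤ 2 * δ := by
    intro x hx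
    have h1 := dist_triangle x (p + δ • e) p
    have h2 : dist (p + δ • e) p = δ := by
      rw [dist_eq_norm, add_sub_cancel_left, norm_smul, he, mul_one, Real.norm_of_nonneg hδ.le]
    rw [mem_closedBall] at hx
    linarith
  have hΩ : ∀ x ∈ closedBall (p + δ • e) δ, x ∈ Ω := fun x hx =>
    hsΩ (mem_ball.2 ((hdist x hx).trans_lt hδs))
  have hv : ContDiffAt ℝ 2 (fun x => 0 - fderiv ℝ u x e) p :=
    contDiffAt_const.sub ((h.contDiffAt (m := 3) hp).dirDeriv (m := 2) (by norm_num) e)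
  have hcrit : fderiv ℝ u p e = 0 := by
    have h1 := h.fderiv_isometry hR hp e
    have h2 : R p = p := by rw [hRe, hep]; simp
    have h3 : R e = -e := by rw [hRe, hee]; module
    rw [h2, h3, map_neg] at h1
    linarith
  have hd : HasDerivWithinAt (fun t : ℝ => 0 - fderiv ℝ u (p + t • e) e)
      (-(fderiv ℝ (fderiv ℝ u) p e e)) (Ici 0) 0 := by
    have h1 := hasDerivAt_comp_line (hv.differentiableAt (by simp)).hasFDerivAt e
    rw [fderiv_const_sub_fun] at h1
    simp only [neg_apply] at h1
    rw [fderiv_dirDeriv (h.contDiffAt hp)] at h1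
    exact h1.hasDerivWithinAt
  have := hopf_hasDerivWithinAt_pos hK.le hδ (p + δ • e)
    (g := fun x => 0 - fderiv ℝ u x e)
    (fun x hx => (continuousAt_const.sub
      ((h.continuousOn_fderiv_apply e).continuousAt
        (h.isOpen.mem_nhds (hΩ x hx)))).continuousWithinAt)
    (fun x hx => contDiffAt_const.sub
      ((h.contDiffAt (m := 3) (hΩ x (ball_subset_closedBall hx))).dirDeriv (m := 2)
        (by norm_num) e))
    (fun x hx => ?_) (fun x hx => ?_) (x := p) (e := e) ?_ ?_ ?_ hd
  · linarith
  · have h1 := h.dirDeriv_neg_of_reflection he hRe hR (hΩ x (ball_subset_closedBall hx)) ?_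
    · linarith
    · have h2 : |⟪e, x - (p + δ • e)⟫| < δ := by
        refine (abs_real_inner_le_norm _ _).trans_lt ?_
        rw [he, one_mul, ← dist_eq_norm]
        exact hx
      rw [inner_sub_right, inner_add_right, inner_smul_right, hee, hep] at h2
      linarith [(abs_lt.1 h2).1]
  · have hxΩ := hΩ x (ball_subset_closedBall hx)
    obtain ⟨hq, c, hc0, hcK, hc⟩ := hb x
      (mem_ball.2 ((hdist x (ball_subset_closedBall hx)).trans_lt hδr)) hxΩ
    refine ⟨gradient u x, hq, ?_⟩
    rw [fderiv_const_sub_fun, fderiv_fun_neg, mcForm_neg, norm_neg]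
    have h1 := neg_le_of_abs_le hc
    have h2 : |⟪e, x - (p + δ • e)⟫| < δ := by
      refine (abs_real_inner_le_norm _ _).trans_lt ?_
      rw [he, one_mul, ← dist_eq_norm]
      exact hx
    rw [inner_sub_right, inner_add_right, inner_smul_right, hee, hep] at h2
    have h3 := h.dirDeriv_neg_of_reflection he hRe hR hxΩ (by linarith [(abs_lt.1 h2).1])
    nlinarith
  · rw [← dist_eq_norm, dist_eq_norm, sub_add_cancel_left, norm_neg, norm_smul, he, mul_one,
      Real.norm_of_nonneg hδ.le]
  · simp [hcrit]
  · rw [add_sub_cancel_left, inner_smul_left, hee]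
    simpa using hδ

lemma fderiv_fderiv_eq_zero_of_reflection [NeZero n] (he : ‖e‖ = 1)
    (hRe : ∀ x, R x = x - (2 * ⟪e, x⟫) • e) (hR : R '' Ω = Ω)
    {p : EuclideanSpace ℝ (Fin n)} (hp : p ∈ Ω) (hep : ⟪e, p⟫ = 0)
    {ξ : EuclideanSpace ℝ (Fin n)} (hξ : ⟪e, ξ⟫ = 0) :
    fderiv ℝ (fderiv ℝ u) p e ξ = 0 ∧ fderiv ℝ (fderiv ℝ u) p ξ e = 0 := by
  have hee : ⟪e, e⟫ = 1 := by rw [real_inner_self_eq_norm_sq, he]; norm_num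
  have h2 : R p = p := by rw [hRe, hep]; simp
  have h3 : R e = -e := by rw [hRe, hee]; module
  have h4 : R ξ = ξ := by rw [hRe, hξ]; simp
  have h5 := h.fderiv_fderiv_isometry hR hp e ξ
  have h6 := h.fderiv_fderiv_isometry hR hp ξ e
  rw [h2, h3, h4] at h5 h6
  simp only [map_neg, neg_apply] at h5 h6
  constructor <;> linarith

end IsConvexMCSolution

section Crossing

lemma Continuous.lt_of_forall_ne {g : ℝ → ℝ} (hg : Continuous g) {a : ℝ}
    (h : ∀ s ∈ Icc (0 : ℝ) 1, g s ≠ a) {s t : ℝ} (hs : s ∈ Icc (0 : ℝ) 1)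
    (ht : t ∈ Icc (0 : ℝ) 1) (hlt : g s < a) : g t < a := by
  by_contra! hcon
  obtain ⟨r, hr, hra⟩ :=
    isPreconnected_Icc.intermediate_value hs ht hg.continuousOn ⟨hlt.le, hcon⟩
  exact h r hr hra

/-- A nonvanishing continuous function on the square has no winding along the boundary. -/
lemma false_of_winding {F : ℝ × ℝ → ℂ} (hF : Continuous F) (h0 : ∀ z, F z ≠ 0)
    (hbot : ∀ s ∈ Icc (0 : ℝ) 1, 0 ≤ (F (s, 0)).im)
    (hright : ∀ t ∈ Icc (0 : ℝ) 1, (F (1, t)).im ≤ 0)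
    (hleft : ∀ t ∈ Icc (0 : ℝ) 1, (F (0, t)).re ≤ 0)
    (htop : ∀ s ∈ Icc (0 : ℝ) 1, (F (s, 1)).re ≤ 0) (h1 : 0 < (F (1, 0)).re) : False := by
  have m0 : (0 : ℝ) ∈ Icc (0 : ℝ) 1 := by simp
  have m1 : (1 : ℝ) ∈ Icc (0 : ℝ) 1 := by simp
  obtain ⟨g, ⟨hg0, hg⟩, -⟩ := Complex.isCoveringMapOn_exp.existsUnique_continuousMap_lifts
    ⟨F, hF⟩ (a₀ := (1, 0)) (e₀ := Complex.log (F (1, 0))) (Complex.exp_log (h0 _)) (fun a => h0 a)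
  have hexp : ∀ z, Complex.exp (g z) = F z := fun z => congrFun hg z
  set θ : ℝ × ℝ → ℝ := fun z => (g z).im with hθ
  have hθc : Continuous θ := Complex.continuous_im.comp g.continuous
  have hre : ∀ z, (F z).re = Real.exp (g z).re * Real.cos (θ z) := fun z => by
    rw [← hexp, Complex.exp_re]
  have him : ∀ z, (F z).im = Real.exp (g z).re * Real.sin (θ z) := fun z => by
    rw [← hexp, Complex.exp_im]
  have hcos : ∀ z, (F z).re ≤ 0 → Real.cos (θ z) ≤ 0 := fun z hz => by
    rw [hre] at hz
    exact nonpos_of_mul_nonpos_right hz (Real.exp_pos _)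
  have hθ1 : θ (1, 0) = 0 := by
    simp only [hθ, hg0, Complex.log_im, Complex.arg_eq_zero_iff]
    exact ⟨h1.le, le_antisymm (hright 0 m0) (hbot 1 m1)⟩
  have hsb : ∀ s ∈ Icc (0 : ℝ) 1, 0 ≤ Real.sin (θ (s, 0)) := fun s hs => by
    have := hbot s hs
    rw [him] at this
    exact nonneg_of_mul_nonneg_right this (Real.exp_pos _)
  have hsr : ∀ t ∈ Icc (0 : ℝ) 1, Real.sin (θ (1, t)) ≤ 0 := fun t ht => by
    have := hright t ht
    rw [him] at this
    exact nonpos_of_mul_nonpos_right this (Real.exp_pos _)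
  have hsin : Real.sin (3 * Real.pi / 2) = -1 := by
    rw [show 3 * Real.pi / 2 = Real.pi / 2 + Real.pi by ring, Real.sin_add_pi, Real.sin_pi_div_two]
  have hpi := Real.pi_pos
  have cb : Continuous fun s : ℝ => θ (s, 0) := by fun_prop
  have cr : Continuous fun s : ℝ => θ (1, s) := by fun_prop
  have cl : Continuous fun s : ℝ => θ (0, s) := by fun_prop
  have ct : Continuous fun s : ℝ => θ (s, 1) := by fun_prop
  have b1 : θ (0, 0) < 3 * Real.pi / 2 := cb.lt_of_forall_ne (fun s hs he => by
    have := hsb s hs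
    rw [he, hsin] at this
    linarith) m1 m0 (by rw [hθ1]; positivity)
  have b2 : -θ (0, 0) < Real.pi / 2 :=
    (show Continuous fun s : ℝ => -θ (s, 0) from cb.neg).lt_of_forall_ne (fun s hs he => by
    have := hsb s hs
    rw [← neg_neg (θ (s, 0)), he, Real.sin_neg, Real.sin_pi_div_two] at this
    linarith) m1 m0 (by rw [hθ1, neg_zero]; positivity)
  have r1 : θ (1, 1) < Real.pi / 2 := cr.lt_of_forall_ne (fun s hs he => by
    have := hsr s hs
    rw [he, Real.sin_pi_div_two] at this
    linarith) m0 m1 (by rw [hθ1]; positivity)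
  have b3 : 0 < θ (0, 0) := by
    by_contra! hcon
    exact absurd (hcos _ (hleft 0 m0))
      (not_le.2 (Real.cos_pos_of_mem_Ioo ⟨by linarith, by linarith⟩))
  have r2 : θ (1, 1) < 0 := by
    by_contra! hcon
    exact absurd (hcos _ (htop 1 m1))
      (not_le.2 (Real.cos_pos_of_mem_Ioo ⟨by linarith, by linarith⟩))
  have t1 : θ (0, 1) < 0 := ct.lt_of_forall_ne (fun s hs he => by
    have := hcos _ (htop s hs)
    rw [he, Real.cos_zero] at this
    linarith) m1 m0 r2
  have l1 : θ (0, 0) < 0 := cl.lt_of_forall_ne (fun s hs he => by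
    have := hcos _ (hleft s hs)
    rw [he, Real.cos_zero] at this
    linarith) m1 m0 t1
  linarith

/-- Two planar curves crossing a half strip between its walls and its bottom must meet. -/
lemma exists_eq_of_crossing {a b c d : ℝ → ℝ} (ha : Continuous a) (hb : Continuous b)
    (hc : Continuous c) (hd : Continuous d) (ha0 : ∀ t ∈ Icc (0 : ℝ) 1, a 0 ≤ b t)
    (hb1 : ∀ s ∈ Icc (0 : ℝ) 1, a s ≤ b 1) (hd0 : ∀ s ∈ Icc (0 : ℝ) 1, d 0 ≤ c s)
    (hc1 : ∀ t ∈ Icc (0 : ℝ) 1, c 1 ≤ d t) (hab : b 0 < a 1) :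
    ∃ s t, a s = b t ∧ c s = d t := by
  by_contra! hcon
  refine false_of_winding (F := fun z => Complex.mk (a z.1 - b z.2) (c z.1 - d z.2)) ?_
    (fun z hz => ?_) (fun s hs => ?_) (fun t ht => ?_) (fun t ht => ?_) (fun s hs => ?_) ?_
  · have : Continuous fun z : ℝ × ℝ => ((a z.1 - b z.2, c z.1 - d z.2) : ℝ × ℝ) := by fun_prop
    exact Complex.equivRealProdCLM.symm.continuous.comp this
  · have h1 := congrArg Complex.re hz
    have h2 := congrArg Complex.im hz
    simp only [Complex.zero_re, Complex.zero_im, sub_eq_zero] at h1 h2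
    exact hcon _ _ h1 h2
  · exact sub_nonneg.2 (hd0 s hs)
  · exact sub_nonpos.2 (hc1 t ht)
  · exact sub_nonpos.2 (ha0 t ht)
  · exact sub_nonpos.2 (hb1 s hs)
  · exact sub_pos.2 hab

end Crossing

namespace IsConvexMCSolution

variable {n : ℕ} {Ω : Set (EuclideanSpace ℝ (Fin n))} {f : ℝ → ℝ}
  {u : EuclideanSpace ℝ (Fin n) → ℝ} (h : IsConvexMCSolution Ω f u)
include h

/-- Starting on a ray along which a directional derivative is positive, one can reach a point
behind the vertex while keeping away from the vertex. -/
lemma exists_joinedIn_dirDeriv_pos [NeZero n] {e p y : EuclideanSpace ℝ (Fin n)} (he : e ≠ 0)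
    (hp : p ∈ Ω) (hcrit : fderiv ℝ u p e = 0) (hy : ‖y‖ = 1) {r : ℝ} (hr : 0 < r)
    (hray : ∀ ρ : ℝ, 0 < ρ → ρ ≤ r → p + ρ • y ∈ Ω ∧ 0 < fderiv ℝ u (p + ρ • y) e) :
    ∃ t : ℝ, 0 < t ∧ ∃ δ : ℝ, 0 < δ ∧ ∀ ε : ℝ, 0 < ε → ε ≤ δ →
      JoinedIn {x | (x ∈ Ω ∧ 0 < fderiv ℝ u x e) ∧ ε ≤ ‖x - p‖} (p - t • e) (p + ε • y) := by
  obtain ⟨t, ht, htΩ, htneg⟩ := h.exists_dirDeriv_neg hp (neg_ne_zero.2 he)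
  rw [smul_neg, ← sub_eq_add_neg] at htΩ htneg
  rw [map_neg, neg_lt_zero] at htneg
  have hpc : IsPathConnected {x | x ∈ Ω ∧ 0 < fderiv ℝ u x e} :=
    (h.isOpen_dirDeriv_pos e).isConnected_iff_isPathConnected.1
      ⟨⟨_, htΩ, htneg⟩, h.isPreconnected_dirDeriv_pos he⟩
  obtain ⟨γ, hγ⟩ := hpc.joinedIn _ ⟨htΩ, htneg⟩ _ (hray r hr le_rfl)
  have hγp : ∀ s, 0 < ‖γ s - p‖ := fun s => by
    rw [norm_pos_iff, sub_ne_zero]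
    intro hcon
    have := (hγ s).2
    rw [hcon, hcrit] at this
    exact this.false
  obtain ⟨s₀, hs₀⟩ := (isCompact_univ (X := unitInterval)).exists_isMinOn univ_nonempty
    (f := fun s => ‖γ s - p‖) (by fun_prop)
  refine ⟨t, ht, min r ‖γ s₀ - p‖, lt_min hr (hγp s₀), fun ε hε hεδ => ?_⟩
  have hεr := hεδ.trans (min_le_left _ _)
  refine JoinedIn.trans (y := p + r • y)
    ⟨γ, fun s => ⟨hγ s, (hεδ.trans (min_le_right _ _)).trans (hs₀.2 (mem_univ s))⟩⟩
    (JoinedIn.of_segment_subset ?_)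
  rintro _ ⟨a, b, ha, hb, hab, rfl⟩
  have h1 : a • (p + r • y) + b • (p + ε • y) = p + (a * r + b * ε) • y := by
    rw [show a • (p + r • y) + b • (p + ε • y) = (a + b) • p + (a * r + b * ε) • y by module,
      hab, one_smul]
  have h2 : ε ≤ a * r + b * ε := by nlinarith
  have h3 : a * r + b * ε ≤ r := by nlinarith
  rw [h1]
  refine ⟨hray _ (hε.trans_le h2) h3, ?_⟩
  rwa [add_sub_cancel_left, norm_smul, hy, mul_one, Real.norm_of_nonneg (hε.le.trans h2)]

/-- An axially symmetric directional derivative cannot vanish at a point of the axis and be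
positive along a ray that is closer to the positive half axis than a ray along which it is
negative. -/
theorem false_of_rays [NeZero n] {e p x y : EuclideanSpace ℝ (Fin n)} (he : ‖e‖ = 1)
    (hp : p ∈ Ω) (hcrit : fderiv ℝ u p e = 0) (hx : ‖x‖ = 1) (hy : ‖y‖ = 1)
    (hsym : ∀ z ∈ Ω, ∀ w ∈ Ω, ⟪e, z - p⟫ = ⟪e, w - p⟫ → ‖z - p‖ = ‖w - p‖ →
      fderiv ℝ u z e = fderiv ℝ u w e)
    (hxy : ⟪e, x⟫ < ⟪e, y⟫) {r : ℝ} (hr : 0 < r)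
    (hxr : ∀ ρ : ℝ, 0 < ρ → ρ ≤ r → p + ρ • x ∈ Ω ∧ fderiv ℝ u (p + ρ • x) e < 0)
    (hyr : ∀ ρ : ℝ, 0 < ρ → ρ ≤ r → p + ρ • y ∈ Ω ∧ 0 < fderiv ℝ u (p + ρ • y) e) : False := by
  have he0 : e ≠ 0 := by rintro rfl; simp at he
  have hee : ⟪e, e⟫ = 1 := by rw [real_inner_self_eq_norm_sq, he]; norm_num
  obtain ⟨t₁, ht₁, δ₁, hδ₁, hJ₁⟩ := h.exists_joinedIn_dirDeriv_pos he0 hp hcrit hy hr hyr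
  obtain ⟨t₂, ht₂, δ₂, hδ₂, hJ₂⟩ := h.exists_joinedIn_dirDeriv_pos (neg_ne_zero.2 he0) hp
    (by rw [map_neg, hcrit, neg_zero]) hx hr
    (fun ρ h1 h2 => ⟨(hxr ρ h1 h2).1, by rw [map_neg]; exact neg_pos.2 (hxr ρ h1 h2).2⟩)
  set ε := min δ₁ δ₂
  have hε : 0 < ε := lt_min hδ₁ hδ₂
  obtain ⟨γ, hγ⟩ := hJ₁ ε hε (min_le_left _ _)
  obtain ⟨η, hη⟩ := (hJ₂ ε hε (min_le_right _ _)).symm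
  have hγ' : ∀ s, (γ.extend s ∈ Ω ∧ 0 < fderiv ℝ u (γ.extend s) e) ∧ ε ≤ ‖γ.extend s - p‖ :=
    fun s => hγ _
  have hη' : ∀ s, (η.extend s ∈ Ω ∧ 0 < fderiv ℝ u (η.extend s) (-e)) ∧ ε ≤ ‖η.extend s - p‖ :=
    fun s => hη _
  have hγ0 : ∀ s, ‖γ.extend s - p‖ ≠ 0 := fun s => (hε.trans_le (hγ' s).2).ne'
  have hη0 : ∀ s, ‖η.extend s - p‖ ≠ 0 := fun s => (hε.trans_le (hη' s).2).ne'
  have hcs : ∀ z : EuclideanSpace ℝ (Fin n), |⟪e, z⟫ / ‖z‖| ≤ 1 := fun z => by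
    simpa [he] using abs_real_inner_div_norm_mul_norm_le_one e z
  have hγc := γ.continuous_extend
  have hηc := η.continuous_extend
  have hstart : ⟪e, γ.extend 0 - p⟫ / ‖γ.extend 0 - p‖ = -1 := by
    rw [γ.extend_zero, sub_sub_cancel_left, inner_neg_right, inner_smul_right, hee, norm_neg,
      norm_smul, he, Real.norm_of_nonneg ht₁.le]
    field_simp
  have hend : ⟪e, η.extend 1 - p⟫ / ‖η.extend 1 - p‖ = 1 := by
    rw [η.extend_one, smul_neg, sub_neg_eq_add, add_sub_cancel_left, inner_smul_right, hee,
      norm_smul, he, Real.norm_of_nonneg ht₂.le]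
    field_simp
  have hγ1 : γ.extend 1 - p = ε • y := by rw [γ.extend_one, add_sub_cancel_left]
  have hη1 : η.extend 0 - p = ε • x := by rw [η.extend_zero, add_sub_cancel_left]
  obtain ⟨s, t, h1, h2⟩ := exists_eq_of_crossing
    (a := fun s => ⟪e, γ.extend s - p⟫ / ‖γ.extend s - p‖)
    (b := fun t => ⟪e, η.extend t - p⟫ / ‖η.extend t - p‖)
    (c := fun s => ‖γ.extend s - p‖) (d := fun t => ‖η.extend t - p‖)
    (Continuous.div (by fun_prop) (by fun_prop) hγ0)
    (Continuous.div (by fun_prop) (by fun_prop) hη0) (by fun_prop) (by fun_prop)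
    (fun t _ => by rw [hstart]; exact neg_le_of_abs_le (hcs _))
    (fun s _ => by rw [hend]; exact le_of_abs_le (hcs _))
    (fun s _ => by
      rw [hη1, norm_smul, hx, mul_one, Real.norm_of_nonneg hε.le]; exact (hγ' s).2)
    (fun t _ => by
      rw [hγ1, norm_smul, hy, mul_one, Real.norm_of_nonneg hε.le]; exact (hη' t).2)
    (by
      rw [hγ1, hη1, norm_smul, norm_smul, hx, hy, inner_smul_right, inner_smul_right, mul_one,
        Real.norm_of_nonneg hε.le, mul_div_cancel_left₀ _ hε.ne', mul_div_cancel_left₀ _ hε.ne']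
      exact hxy)
  rw [h2, div_left_inj' (hη0 t)] at h1
  have h3 := (hη' t).1.2
  rw [map_neg, ← hsym _ (hγ' s).1.1 _ (hη' t).1.1 h1 h2] at h3
  linarith [(hγ' s).1.2]

end IsConvexMCSolution

section TaylorTerm

variable {E : Type*} [NormedAddCommGroup E] [NormedSpace ℝ E] {F : E → ℝ} {p : E}

/-- The homogeneous term of degree `k` in the Taylor expansion of `F` at `p`, up to the
factor `k!`. -/
def taylorTerm (F : E → ℝ) (p : E) (k : ℕ) (z : E) : ℝ :=
  iteratedFDeriv ℝ k F p fun _ => z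

lemma taylorTerm_smul (F : E → ℝ) (p : E) (k : ℕ) (c : ℝ) (z : E) :
    taylorTerm F p k (c • z) = c ^ k * taylorTerm F p k z := by
  have := (iteratedFDeriv ℝ k F p).map_smul_univ (fun _ => c) (fun _ => z)
  simpa [taylorTerm] using this

lemma taylorTerm_zero (F : E → ℝ) (p z : E) : taylorTerm F p 0 z = F p := by
  simp [taylorTerm]

lemma contDiff_taylorTerm (F : E → ℝ) (p : E) (k : ℕ) {m : WithTop ℕ∞} :
    ContDiff ℝ m (taylorTerm F p k) :=
  (iteratedFDeriv ℝ k F p).contDiff.comp (contDiff_pi.2 fun _ => contDiff_id)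

lemma fderiv_taylorTerm_succ (hF : AnalyticAt ℝ F p) (k : ℕ) (z ξ : E) :
    fderiv ℝ (taylorTerm F p (k + 1)) z ξ =
      (k + 1) * taylorTerm (fun y => fderiv ℝ F y ξ) p k z := by
  have hterm : ∀ i : Fin (k + 1), iteratedFDeriv ℝ (k + 1) F p (Function.update (fun _ => z) i ξ)
      = taylorTerm (fun y => fderiv ℝ F y ξ) p k z := by
    intro i
    have hup : Function.update (fun _ : Fin (k + 1) => z) i ξ =
        Function.update (fun _ : Fin (k + 1) => z) (Fin.last k) ξ ∘
          Equiv.swap i (Fin.last k) := by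
      ext1 j
      by_cases hj : j = i
      · subst hj; simp
      · have : Equiv.swap i (Fin.last k) j ≠ Fin.last k := by
          intro hc
          apply hj
          have := congrArg (Equiv.swap i (Fin.last k)) hc
          simpa using this
        simp [Function.update_of_ne hj, Function.update_of_ne this]
    rw [hup, ContDiffAt.iteratedFDeriv_comp_perm hF.contDiffAt, iteratedFDeriv_succ_apply_right]
    have hev := ContinuousLinearMap.iteratedFDeriv_comp_left
      (ContinuousLinearMap.apply ℝ ℝ ξ) (hF.fderiv.contDiffAt (n := k)) (i := k) le_rfl
    have h2 := congrArg (fun M => M fun _ => z) hev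
    have hinit : Fin.init (Function.update (fun _ : Fin (k + 1) => z) (Fin.last k) ξ)
        = fun _ => z := by
      ext1 j
      simp [Fin.init]
    rw [hinit]
    simp only [Function.update_self]
    exact h2.symm
  have hpi : HasFDerivAt (fun (y : E) (_ : Fin (k + 1)) => y)
      (ContinuousLinearMap.pi fun _ => ContinuousLinearMap.id ℝ E) z :=
    hasFDerivAt_pi.2 fun _ => hasFDerivAt_id z
  have hM := ((iteratedFDeriv ℝ (k + 1) F p).hasFDerivAt (fun _ => z)).comp z hpi
  have := congrArg (fun L : E →L[ℝ] ℝ => L ξ) hM.fderiv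
  simp only [ContinuousLinearMap.comp_apply, ContinuousMultilinearMap.linearDeriv_apply] at this
  refine Eq.trans this ?_
  simp [hterm]

lemma tendsto_taylorTerm (hF : AnalyticAt ℝ F p) {k : ℕ} {z : E}
    (hlow : ∀ j < k, taylorTerm F p j z = 0) :
    Tendsto (fun ρ : ℝ => (ρ ^ k)⁻¹ * F (p + ρ • z)) (𝓝[>] 0)
      (𝓝 ((k.factorial : ℝ)⁻¹ * taylorTerm F p k z)) := by
  obtain ⟨q, hq⟩ := hF
  have hcoef : ∀ (j : ℕ) (y : E), q j (fun _ => y) = (j.factorial : ℝ)⁻¹ * taylorTerm F p j y := by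
    intro j y
    obtain ⟨r, hr⟩ := hq
    have := hr.factorial_smul y j
    rw [taylorTerm, ← this, nsmul_eq_mul, inv_mul_cancel_left₀ (by positivity)]
  have hpart : ∀ ρ : ℝ, q.partialSum (k + 1) (ρ • z) =
      ρ ^ k * ((k.factorial : ℝ)⁻¹ * taylorTerm F p k z) := by
    intro ρ
    rw [FormalMultilinearSeries.partialSum, Finset.sum_range_succ,
      Finset.sum_eq_zero, zero_add, hcoef, taylorTerm_smul]
    · ring
    · intro j hj
      rw [hcoef, taylorTerm_smul, hlow j (Finset.mem_range.1 hj)]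
      simp
  have hline : Tendsto (fun ρ : ℝ => ρ • z) (𝓝[>] 0) (𝓝 0) := by
    have : Tendsto (fun ρ : ℝ => ρ • z) (𝓝 0) (𝓝 ((0 : ℝ) • z)) :=
      (continuous_id.smul continuous_const).tendsto 0
    rw [zero_smul] at this
    exact this.mono_left nhdsWithin_le_nhds
  obtain ⟨C, hC⟩ := ((hq.isBigO_sub_partialSum_pow (k + 1)).comp_tendsto hline).bound
  rw [tendsto_iff_norm_sub_tendsto_zero]
  have hlim : Tendsto (fun ρ : ℝ => C * ‖z‖ ^ (k + 1) * ρ) (𝓝[>] 0) (𝓝 0) := by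
    have : Tendsto (fun ρ : ℝ => C * ‖z‖ ^ (k + 1) * ρ) (𝓝 0) (𝓝 (C * ‖z‖ ^ (k + 1) * 0)) :=
      (continuous_const.mul continuous_id).tendsto 0
    rw [mul_zero] at this
    exact this.mono_left nhdsWithin_le_nhds
  refine squeeze_zero' (Eventually.of_forall fun _ => norm_nonneg _) ?_ hlim
  filter_upwards [hC, self_mem_nhdsWithin] with ρ hρ hρ0
  have hρ0 : 0 < ρ := hρ0
  simp only [Function.comp_apply, hpart, norm_pow, norm_smul,
    norm_mul, norm_norm, Real.norm_of_nonneg hρ0.le] at hρ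
  have heq : (ρ ^ k)⁻¹ * F (p + ρ • z) - (k.factorial : ℝ)⁻¹ * taylorTerm F p k z =
      (ρ ^ k)⁻¹ * (F (p + ρ • z) - ρ ^ k * ((k.factorial : ℝ)⁻¹ * taylorTerm F p k z)) := by
    field_simp
  rw [heq, norm_mul, norm_inv, norm_pow, Real.norm_of_nonneg hρ0.le]
  calc (ρ ^ k)⁻¹ * ‖F (p + ρ • z) - ρ ^ k * ((k.factorial : ℝ)⁻¹ * taylorTerm F p k z)‖
      ≤ (ρ ^ k)⁻¹ * (C * (ρ * ‖z‖) ^ (k + 1)) := by gcongr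
    _ = C * ‖z‖ ^ (k + 1) * ρ := by field_simp; ring

lemma eventually_pos_of_taylorTerm_pos (hF : AnalyticAt ℝ F p) {k : ℕ} {z : E}
    (hlow : ∀ j < k, taylorTerm F p j z = 0) (hpos : 0 < taylorTerm F p k z) :
    ∀ᶠ ρ : ℝ in 𝓝[>] 0, 0 < F (p + ρ • z) := by
  have h0 : 0 < (k.factorial : ℝ)⁻¹ * taylorTerm F p k z := by positivity
  filter_upwards [(tendsto_taylorTerm hF hlow).eventually_const_lt h0, self_mem_nhdsWithin]
    with ρ hρ hρ0
  have hρ0 : 0 < ρ := hρ0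
  exact pos_of_mul_pos_right hρ (by positivity)

lemma taylorTerm_neg (F : E → ℝ) (p : E) (k : ℕ) (z : E) :
    taylorTerm (fun y => -F y) p k z = -taylorTerm F p k z := by
  have : (fun y => -F y) = -F := rfl
  rw [taylorTerm, this, iteratedFDeriv_neg_apply]
  rfl

lemma eventually_neg_of_taylorTerm_neg (hF : AnalyticAt ℝ F p) {k : ℕ} {z : E}
    (hlow : ∀ j < k, taylorTerm F p j z = 0) (hneg : taylorTerm F p k z < 0) :
    ∀ᶠ ρ : ℝ in 𝓝[>] 0, F (p + ρ • z) < 0 := by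
  have := eventually_pos_of_taylorTerm_pos (F := fun y => -F y) hF.neg (k := k) (z := z)
    (fun j hj => by rw [taylorTerm_neg, hlow j hj, neg_zero])
    (by rw [taylorTerm_neg]; linarith)
  filter_upwards [this] with ρ hρ using by linarith

lemma taylorTerm_dirDeriv_eq_zero (hF : AnalyticAt ℝ F p) {k : ℕ}
    (h : ∀ z, taylorTerm F p (k + 1) z = 0) (ξ z : E) :
    taylorTerm (fun y => fderiv ℝ F y ξ) p k z = 0 := by
  have h1 := fderiv_taylorTerm_succ hF k z ξ
  have h2 : taylorTerm F p (k + 1) = fun _ => 0 := funext h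
  rw [h2] at h1
  simp only [fderiv_fun_const, Pi.zero_apply, zero_apply] at h1
  have hk : (k + 1 : ℝ) ≠ 0 := by positivity
  simpa [hk] using h1.symm

lemma AnalyticAt.dirDeriv (hF : AnalyticAt ℝ F p) (ξ : E) :
    AnalyticAt ℝ (fun y => fderiv ℝ F y ξ) p :=
  ((ContinuousLinearMap.apply ℝ ℝ ξ).analyticAt _).comp hF.fderiv

lemma fderiv_fderiv_taylorTerm (hF : AnalyticAt ℝ F p) (k : ℕ) (z ξ η : E) :
    fderiv ℝ (fderiv ℝ (taylorTerm F p (k + 2))) z ξ η =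
      (k + 2) * (k + 1) *
        taylorTerm (fun y => fderiv ℝ (fun w => fderiv ℝ F w ξ) y η) p k z := by
  rw [← fderiv_dirDeriv (contDiff_taylorTerm F p (k + 2)).contDiffAt ξ]
  have : (fun y => fderiv ℝ (taylorTerm F p (k + 2)) y ξ) =
      fun y => ((k + 1 : ℕ) + 1 : ℝ) * taylorTerm (fun y => fderiv ℝ F y ξ) p (k + 1) y :=
    funext fun y => fderiv_taylorTerm_succ hF (k + 1) y ξ
  rw [this, fderiv_const_mul ((contDiff_taylorTerm _ p (k + 1) (m := 1)).differentiable
    (by norm_num) z), smul_apply, fderiv_taylorTerm_succ (hF.dirDeriv ξ)]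
  push_cast
  simp only [smul_eq_mul]
  ring

lemma eventually_eq_zero_of_taylorTerm (hF : AnalyticAt ℝ F p)
    (h : ∀ k z, taylorTerm F p k z = 0) : ∀ᶠ y in 𝓝 p, F y = 0 := by
  obtain ⟨q, r, hr⟩ := hF
  filter_upwards [Metric.eball_mem_nhds p hr.r_pos] with y hy
  have hs := hr.hasSum_sub hy
  have h0 : (fun m => q m fun _ => y - p) = fun _ => 0 := by
    ext m
    have := hr.factorial_smul (y - p) m
    rw [show iteratedFDeriv ℝ m F p (fun _ => y - p) = 0 from h m (y - p)] at this
    simpa [Nat.factorial_ne_zero] using this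
  rw [h0] at hs
  exact hs.unique hasSum_zero

end TaylorTerm

section HarmonicPolynomial

variable {n : ℕ} {e : EuclideanSpace ℝ (Fin n)} {Q : EuclideanSpace ℝ (Fin n) → ℝ}

/-- A harmonic function that is nonnegative on a half-space and has a critical zero on its
boundary vanishes on the half-space. -/
lemma eq_zero_of_nonneg_halfSpace (he : ‖e‖ = 1) (hQ : ContDiff ℝ 2 Q)
    (hharm : ∀ z, mcForm 0 (fderiv ℝ (fderiv ℝ Q) z) = 0) (hQ0 : Q 0 = 0)
    (hDQ0 : fderiv ℝ Q 0 = 0) (hnn : ∀ z, 0 < ⟪e, z⟫ → 0 ≤ Q z) :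
    ∀ z, 0 < ⟪e, z⟫ → Q z = 0 := by
  have hee : ⟪e, e⟫ = 1 := by rw [real_inner_self_eq_norm_sq, he]; norm_num
  have hic : Continuous fun x : EuclideanSpace ℝ (Fin n) => ⟪e, x⟫ := by fun_prop
  have hD : IsOpen {z : EuclideanSpace ℝ (Fin n) | 0 < ⟪e, z⟫} := isOpen_lt continuous_const hic
  have hDc : IsPreconnected {z : EuclideanSpace ℝ (Fin n) | 0 < ⟪e, z⟫} :=
    (convex_halfSpace_gt (f := fun z => ⟪e, z⟫)
      ⟨fun _ _ => inner_add_right _ _ _, fun _ _ => inner_smul_right _ _ _⟩ 0).isPreconnected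
  have hsuper : IsLocSuper {z : EuclideanSpace ℝ (Fin n) | 0 < ⟪e, z⟫} Q := by
    intro x _ _ _
    refine ⟨1, one_pos, 1, one_pos, fun y _ hyD => ⟨0, by simp, ?_⟩⟩
    rw [hharm, one_mul]
    exact add_nonneg (norm_nonneg _) (hnn y hyD)
  refine (hsuper.pos_or_eq_zero hD hDc (fun x _ => hQ.contDiffAt)
    (fun x hx => hnn x hx)).resolve_left fun hpos => ?_
  have hball : ∀ x ∈ ball e 1, 0 < ⟪e, x⟫ := by
    intro x hx
    have h1 : |⟪e, x - e⟫| < 1 := by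
      refine (abs_real_inner_le_norm _ _).trans_lt ?_
      rw [he, one_mul, ← dist_eq_norm]
      exact hx
    rw [inner_sub_right, hee] at h1
    linarith [(abs_lt.1 h1).1]
  have hd := hasDerivWithinAt_line_of_hasFDerivAt
    (hQ.differentiable (by norm_num) 0).hasFDerivAt e
  rw [hDQ0] at hd
  have := hopf_hasDerivWithinAt_pos (K := 0) (R := 1) le_rfl one_pos e
    hQ.continuous.continuousOn (fun x _ => hQ.contDiffAt) (fun x hx => hpos x (hball x hx))
    (fun x _ => ⟨0, by simp, by rw [hharm]; simp⟩) (x := 0) (e := e) (by simp [he]) hQ0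
    (by rw [sub_zero, hee]; exact one_pos) hd
  simp at this

/-- A nonzero harmonic function of definite parity with a critical zero at the origin takes
positive values in every half-space and negative values in the opposite one. -/
lemma exists_neg_pos_halfSpaces (he : ‖e‖ = 1) (hQ : ContDiff ℝ 2 Q)
    (hharm : ∀ z, mcForm 0 (fderiv ℝ (fderiv ℝ Q) z) = 0) (hQ0 : Q 0 = 0)
    (hDQ0 : fderiv ℝ Q 0 = 0) (hpar : ∀ z, Q z = 0 → Q (-z) = 0)
    {z₀ : EuclideanSpace ℝ (Fin n)} (hz₀ : Q z₀ ≠ 0) :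
    ∃ x y, ⟪e, x⟫ < 0 ∧ Q x < 0 ∧ 0 < ⟪e, y⟫ ∧ 0 < Q y := by
  have hee : ⟪e, e⟫ = 1 := by rw [real_inner_self_eq_norm_sq, he]; norm_num
  have key : ¬ ∀ z, 0 < ⟪e, z⟫ → Q z = 0 := by
    intro hzero
    have hall : ∀ z, ⟪e, z⟫ ≠ 0 → Q z = 0 := by
      intro z hz
      rcases hz.lt_or_gt with h1 | h1
      · have := hpar (-z) (hzero (-z) (by rw [inner_neg_right]; linarith))
        rwa [neg_neg] at this
      · exact hzero z h1
    have hz : ⟪e, z₀⟫ = 0 := by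
      by_contra hz
      exact hz₀ (hall z₀ hz)
    have hcont : Continuous fun t : ℝ => Q (z₀ + t • e) := hQ.continuous.comp (by fun_prop)
    have h0 : ∀ᶠ t : ℝ in 𝓝[>] 0, Q (z₀ + t • e) ≠ 0 :=
      (hcont.continuousAt.eventually_ne (by simpa using hz₀)).filter_mono nhdsWithin_le_nhds
    obtain ⟨t, ht, ht0⟩ := (h0.and self_mem_nhdsWithin).exists
    have ht0 : 0 < t := ht0
    refine ht (hall _ ?_)
    rw [inner_add_right, inner_smul_right, hz, hee]
    linarith
  by_contra! hcon
  by_cases hx : ∃ x, ⟪e, x⟫ < 0 ∧ Q x < 0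
  · obtain ⟨x, hx1, hx2⟩ := hx
    refine key fun z hz => ?_
    have := eq_zero_of_nonneg_halfSpace (Q := fun z => -Q z) he hQ.neg (fun z => ?_) (by simp [hQ0])
      ?_ (fun z hz => by linarith [hcon x z hx1 hx2 hz]) z hz
    · linarith
    · have h1 : fderiv ℝ (fun z => -Q z) = fun z => -fderiv ℝ Q z := by
        ext1 z; exact fderiv_fun_neg
      rw [h1, fderiv_fun_neg, mcForm_neg, hharm, neg_zero]
    · rw [fderiv_fun_neg, hDQ0, neg_zero]
  · push Not at hx
    refine key fun z hz => ?_
    have := eq_zero_of_nonneg_halfSpace (e := -e) (by rwa [norm_neg]) hQ hharm hQ0 hDQ0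
      (fun z hz => hx z (by rw [inner_neg_left] at hz; linarith)) (-z)
      (by rwa [inner_neg_neg])
    have := hpar _ this
    rwa [neg_neg] at this

end HarmonicPolynomial

lemma norm_le_sum_single {n : ℕ} (L : EuclideanSpace ℝ (Fin n) →L[ℝ] ℝ) :
    ‖L‖ ≤ ∑ i, |L (EuclideanSpace.single i 1)| := by
  refine L.opNorm_le_bound (Finset.sum_nonneg fun i _ => abs_nonneg _) fun x => ?_
  conv_lhs => rw [euclidean_eq_sum_single x]
  rw [map_sum, Finset.sum_mul]
  refine (norm_sum_le _ _).trans (Finset.sum_le_sum fun i _ => ?_)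
  rw [map_smul, norm_smul, Real.norm_eq_abs, mul_comm]
  exact mul_le_mul_of_nonneg_left (PiLp.norm_apply_le x i) (abs_nonneg _)

namespace IsConvexMCSolution

variable {n : ℕ} {Ω : Set (EuclideanSpace ℝ (Fin n))} {f : ℝ → ℝ}
  {u : EuclideanSpace ℝ (Fin n) → ℝ} (h : IsConvexMCSolution Ω f u)
include h

/-- At a critical point the lowest-order Taylor term of a directional derivative is harmonic. -/
lemma mcForm_zero_taylorTerm {p : EuclideanSpace ℝ (Fin n)} (hp : p ∈ Ω)
    (hcrit : fderiv ℝ u p = 0) (e : EuclideanSpace ℝ (Fin n)) {k : ℕ}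
    (hlow : ∀ j < k + 2, ∀ z, taylorTerm (fun y => fderiv ℝ u y e) p j z = 0)
    (z : EuclideanSpace ℝ (Fin n)) :
    mcForm 0 (fderiv ℝ (fderiv ℝ (taylorTerm (fun y => fderiv ℝ u y e) p (k + 2))) z) = 0 := by
  set v : EuclideanSpace ℝ (Fin n) → ℝ := fun y => fderiv ℝ u y e with hv
  set b : Fin n → EuclideanSpace ℝ (Fin n) := fun i => EuclideanSpace.single i 1 with hb
  have hvan : AnalyticAt ℝ v p := (h.analytic p hp).dirDeriv e
  set w : Fin n → Fin n → EuclideanSpace ℝ (Fin n) → ℝ := fun i j y =>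
    fderiv ℝ (fun y => fderiv ℝ v y (b i)) y (b j) with hw
  have hwlim : ∀ i j, Tendsto (fun ρ : ℝ => (ρ ^ k)⁻¹ * w i j (p + ρ • z)) (𝓝[>] 0)
      (𝓝 ((k.factorial : ℝ)⁻¹ * taylorTerm (w i j) p k z)) := fun i j =>
    tendsto_taylorTerm ((hvan.dirDeriv (b i)).dirDeriv (b j)) fun l hl =>
      taylorTerm_dirDeriv_eq_zero (hvan.dirDeriv (b i))
        (fun z => taylorTerm_dirDeriv_eq_zero hvan (hlow (l + 2) (by omega)) _ z) _ z
  have hDlim : ∀ i, Tendsto (fun ρ : ℝ => (ρ ^ k)⁻¹ * fderiv ℝ v (p + ρ • z) (b i)) (𝓝[>] 0)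
      (𝓝 0) := by
    intro i
    have := tendsto_taylorTerm (z := z) (k := k) (hvan.dirDeriv (b i)) fun l hl =>
      taylorTerm_dirDeriv_eq_zero hvan (hlow (l + 1) (by omega)) _ z
    rwa [taylorTerm_dirDeriv_eq_zero hvan (hlow (k + 1) (by omega)) _ z, mul_zero] at this
  have hvlim : Tendsto (fun ρ : ℝ => (ρ ^ k)⁻¹ * v (p + ρ • z)) (𝓝[>] 0) (𝓝 0) := by
    have := tendsto_taylorTerm (z := z) (k := k) hvan fun l hl => hlow l (by omega) z
    rwa [hlow k (by omega), mul_zero] at this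
  have hline : Tendsto (fun ρ : ℝ => p + ρ • z) (𝓝[>] 0) (𝓝 p) := by
    have : Tendsto (fun ρ : ℝ => p + ρ • z) (𝓝 0) (𝓝 (p + (0 : ℝ) • z)) :=
      (continuous_const.add (continuous_id.smul continuous_const)).tendsto 0
    rw [zero_smul, add_zero] at this
    exact this.mono_left nhdsWithin_le_nhds
  have hq : Tendsto (fun ρ : ℝ => gradient u (p + ρ • z)) (𝓝[>] 0) (𝓝 0) := by
    have h1 := (continuousAt_gradient (h.contDiffAt (m := 1) hp)).tendsto
    rw [(gradient_eq_zero_iff u p).2 hcrit] at h1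
    exact h1.comp hline
  have hqi : ∀ i, Tendsto (fun ρ : ℝ => gradient u (p + ρ • z) i) (𝓝[>] 0) (𝓝 0) := fun i =>
    ((EuclideanSpace.proj (𝕜 := ℝ) i).continuous.tendsto 0).comp hq
  obtain ⟨K, hK, r, hr, hbd⟩ := h.equation.exists_linearised_bound h.isOpen h.contDiff_rhs
    h.monotone_rhs (fun x hx => h.contDiffAt hx) e hp
  have hform : ∀ y ∈ Ω, ∀ q, mcForm q (fderiv ℝ (fderiv ℝ v) y) =
      (1 + ‖q‖ ^ 2) * ∑ i, w i i y - ∑ i, ∑ j, q i * q j * w i j y := by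
    intro y hy q
    have h2 : ContDiffAt ℝ 2 v y := (h.contDiffAt (m := 3) hy).dirDeriv (m := 2) (by norm_num) e
    rw [mcForm, bilin_eq_sum_single]
    simp only [hw, fderiv_dirDeriv h2, hb]
  have hlim1 : Tendsto (fun ρ : ℝ => (1 + ‖gradient u (p + ρ • z)‖ ^ 2) *
      ∑ i, (ρ ^ k)⁻¹ * w i i (p + ρ • z) - ∑ i, ∑ j, gradient u (p + ρ • z) i *
        gradient u (p + ρ • z) j * ((ρ ^ k)⁻¹ * w i j (p + ρ • z))) (𝓝[>] 0)
      (𝓝 ((1 + ‖(0 : EuclideanSpace ℝ (Fin n))‖ ^ 2) *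
        ∑ i, (k.factorial : ℝ)⁻¹ * taylorTerm (w i i) p k z - ∑ i, ∑ j, (0 : ℝ) * 0 *
          ((k.factorial : ℝ)⁻¹ * taylorTerm (w i j) p k z))) :=
    (((hq.norm.pow 2).const_add 1).mul (tendsto_finsetSum _ fun i _ => hwlim i i)).sub
      (tendsto_finsetSum _ fun i _ => tendsto_finsetSum _ fun j _ =>
        ((hqi i).mul (hqi j)).mul (hwlim i j))
  have hlim2 : Tendsto (fun ρ : ℝ => K * |(ρ ^ k)⁻¹ * v (p + ρ • z)| +
      K * ∑ i, |(ρ ^ k)⁻¹ * fderiv ℝ v (p + ρ • z) (b i)|) (𝓝[>] 0)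
      (𝓝 (K * |0| + K * ∑ _i : Fin n, |0|)) :=
    (hvlim.abs.const_mul K).add ((tendsto_finsetSum _ fun i _ => (hDlim i).abs).const_mul K)
  have hle := le_of_tendsto_of_tendsto hlim1.abs hlim2 (by
    filter_upwards [self_mem_nhdsWithin, hline (h.isOpen.mem_nhds hp), hline (ball_mem_nhds p hr)]
      with ρ hρ0 hρΩ hρr
    have hρ0 : 0 < ρ := hρ0
    have hρk : 0 < (ρ ^ k)⁻¹ := by positivity
    obtain ⟨-, c, hc0, hcK, hc⟩ := hbd _ hρr hρΩ
    have hL := norm_le_sum_single (fderiv ℝ v (p + ρ • z))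
    have hB := hform _ hρΩ (gradient u (p + ρ • z))
    have h1 : |mcForm (gradient u (p + ρ • z)) (fderiv ℝ (fderiv ℝ v) (p + ρ • z))| ≤
        K * |v (p + ρ • z)| + K * ∑ i, |fderiv ℝ v (p + ρ • z) (b i)| := by
      have h2 : |c * v (p + ρ • z)| ≤ K * |v (p + ρ • z)| := by
        rw [abs_mul, abs_of_nonneg hc0]
        gcongr
      have h3 := abs_sub_abs_le_abs_sub
        (mcForm (gradient u (p + ρ • z)) (fderiv ℝ (fderiv ℝ v) (p + ρ • z))) (c * v (p + ρ • z))
      have h4 := mul_le_mul_of_nonneg_left hL hK.le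
      linarith
    have h5 : (1 + ‖gradient u (p + ρ • z)‖ ^ 2) *
        ∑ i, (ρ ^ k)⁻¹ * w i i (p + ρ • z) - ∑ i, ∑ j, gradient u (p + ρ • z) i *
        gradient u (p + ρ • z) j * ((ρ ^ k)⁻¹ * w i j (p + ρ • z)) = (ρ ^ k)⁻¹ *
        mcForm (gradient u (p + ρ • z)) (fderiv ℝ (fderiv ℝ v) (p + ρ • z)) := by
      rw [hB, mul_sub, ← Finset.mul_sum, Finset.mul_sum (a := (ρ ^ k)⁻¹) (s := Finset.univ)
        (f := fun i => ∑ j, _)]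
      simp only [Finset.mul_sum]
      congr 1
      · exact Finset.sum_congr rfl fun i _ => by ring
      · exact Finset.sum_congr rfl fun i _ => Finset.sum_congr rfl fun j _ => by ring
    rw [h5, abs_mul, abs_of_pos hρk]
    simp only [abs_mul, abs_of_pos hρk, ← Finset.mul_sum]
    calc _ ≤ (ρ ^ k)⁻¹ * (K * |v (p + ρ • z)| + K * ∑ i, |fderiv ℝ v (p + ρ • z) (b i)|) := by
          gcongr
      _ = _ := by ring)
  simp only [norm_zero, ne_eq, OfNat.ofNat_ne_zero, not_false_eq_true, zero_pow, add_zero, one_mul,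
    mul_zero, zero_mul, Finset.sum_const_zero, sub_zero, abs_zero, ← Finset.mul_sum] at hle
  have hsum : ∑ i, taylorTerm (w i i) p k z = 0 := by
    have h1 := abs_eq_zero.1 (le_antisymm hle (abs_nonneg _))
    exact (mul_eq_zero.1 h1).resolve_left (by positivity)
  rw [mcForm]
  simp only [map_zero, sub_zero, fderiv_fderiv_taylorTerm hvan, ← Finset.mul_sum]
  rw [show ∑ i, taylorTerm (fun y => fderiv ℝ (fun w => fderiv ℝ v w (EuclideanSpace.single i 1)) y
    (EuclideanSpace.single i 1)) p k z = 0 from hsum]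
  simp

end IsConvexMCSolution

namespace IsConvexMCSolution

variable {n : ℕ} {Ω : Set (EuclideanSpace ℝ (Fin n))} {f : ℝ → ℝ}
  {u : EuclideanSpace ℝ (Fin n) → ℝ} (h : IsConvexMCSolution Ω f u)
include h

lemma exists_taylorTerm_dirDeriv_ne_zero [NeZero n] {e p : EuclideanSpace ℝ (Fin n)} (he : e ≠ 0)
    (hp : p ∈ Ω) : ∃ m z, taylorTerm (fun y => fderiv ℝ u y e) p m z ≠ 0 := by
  by_contra! hcon
  have hvan : AnalyticOnNhd ℝ (fun y => fderiv ℝ u y e) Ω := fun y hy =>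
    (h.analytic y hy).dirDeriv e
  have hzero := hvan.eqOn_zero_of_preconnected_of_eventuallyEq_zero h.convex.isPreconnected hp
    (eventually_eq_zero_of_taylorTerm (hvan p hp) hcon)
  obtain ⟨t, -, htΩ, ht⟩ := h.exists_dirDeriv_neg hp he
  exact ht.ne (hzero htΩ)

/-- If the second derivative of the solution at a critical point is nonnegative in a direction
that is orthogonal for the Hessian, the derivative in that direction has a lowest-order Taylor
term that is negative somewhere behind and positive somewhere in front. -/
lemma exists_taylorTerm_neg_pos [NeZero n] {e p : EuclideanSpace ℝ (Fin n)} (he : ‖e‖ = 1)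
    (hp : p ∈ Ω) (hcrit : fderiv ℝ u p = 0)
    (hoff : ∀ ξ, ⟪e, ξ⟫ = 0 → fderiv ℝ (fderiv ℝ u) p e ξ = 0)
    (hnn : 0 ≤ fderiv ℝ (fderiv ℝ u) p e e) :
    ∃ m x y, (∀ j < m, ∀ z, taylorTerm (fun y => fderiv ℝ u y e) p j z = 0) ∧
      ⟪e, x⟫ < 0 ∧ taylorTerm (fun y => fderiv ℝ u y e) p m x < 0 ∧
      0 < ⟪e, y⟫ ∧ 0 < taylorTerm (fun y => fderiv ℝ u y e) p m y := by
  have hee : ⟪e, e⟫ = 1 := by rw [real_inner_self_eq_norm_sq, he]; norm_num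
  have hex := h.exists_taylorTerm_dirDeriv_ne_zero (norm_ne_zero_iff.1 (he ▸ one_ne_zero)) hp
  classical
  obtain ⟨z₀, hz₀⟩ := Nat.find_spec hex
  have hlow : ∀ j < Nat.find hex, ∀ z, taylorTerm (fun y => fderiv ℝ u y e) p j z = 0 := by
    intro j hj
    simpa using Nat.find_min hex hj
  refine ⟨Nat.find hex, ?_⟩
  generalize Nat.find hex = m at hz₀ hlow
  match m, hz₀, hlow with
  | 0, hz₀, _ => simp [taylorTerm_zero, hcrit] at hz₀
  | 1, hz₀, hlow =>
    have hT : ∀ z, taylorTerm (fun y => fderiv ℝ u y e) p 1 z =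
        ⟪e, z⟫ * fderiv ℝ (fderiv ℝ u) p e e := by
      intro z
      have h1 : taylorTerm (fun y => fderiv ℝ u y e) p 1 z =
          fderiv ℝ (fun y => fderiv ℝ u y e) p z := by
        simp [taylorTerm]
      rw [h1, fderiv_dirDeriv (h.contDiffAt hp)]
      have h2 := hoff (z - ⟪e, z⟫ • e) (by rw [inner_sub_right, inner_smul_right, hee]; ring)
      rw [map_sub, map_smul, smul_eq_mul] at h2
      linarith
    simp only [hT] at hz₀ ⊢
    have hc : 0 < fderiv ℝ (fderiv ℝ u) p e e := hnn.lt_of_ne' (right_ne_zero_of_mul hz₀)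
    refine ⟨-e, e, hlow, ?_⟩
    rw [inner_neg_right, hee]
    exact ⟨by norm_num, by linarith, one_pos, by linarith⟩
  | k + 2, hz₀, hlow =>
    have hT0 : ∀ (F : EuclideanSpace ℝ (Fin n) → ℝ) (j : ℕ), taylorTerm F p (j + 1) 0 = 0 := by
      intro F j
      have := taylorTerm_smul F p (j + 1) 0 0
      rwa [zero_smul, zero_pow (by omega), zero_mul] at this
    obtain ⟨x, y, hxy⟩ := exists_neg_pos_halfSpaces he
      (contDiff_taylorTerm (fun y => fderiv ℝ u y e) p (k + 2))
      (h.mcForm_zero_taylorTerm hp hcrit e hlow) (hT0 _ (k + 1))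
      (by
        ext ξ
        rw [fderiv_taylorTerm_succ ((h.analytic p hp).dirDeriv e), hT0]
        simp)
      (fun z hz => by
        have := taylorTerm_smul (fun y => fderiv ℝ u y e) p (k + 2) (-1) z
        rwa [hz, mul_zero, neg_one_smul] at this) hz₀
    exact ⟨x, y, hlow, hxy⟩

/-- At a critical point on an axis of symmetry, the second derivative along the axis is
negative. -/
theorem fderiv_fderiv_neg_of_axis [NeZero n] {e p : EuclideanSpace ℝ (Fin n)} (he : ‖e‖ = 1)
    (hp : p ∈ Ω) (hcrit : fderiv ℝ u p = 0)
    (hoff : ∀ ξ, ⟪e, ξ⟫ = 0 → fderiv ℝ (fderiv ℝ u) p e ξ = 0)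
    (hsym : ∀ z ∈ Ω, ∀ w ∈ Ω, ⟪e, z - p⟫ = ⟪e, w - p⟫ → ‖z - p‖ = ‖w - p‖ →
      fderiv ℝ u z e = fderiv ℝ u w e) :
    fderiv ℝ (fderiv ℝ u) p e e < 0 := by
  by_contra! hnn
  obtain ⟨m, x, y, hlow, hx, hTx, hy, hTy⟩ := h.exists_taylorTerm_neg_pos he hp hcrit hoff hnn
  have hvan : AnalyticAt ℝ (fun y => fderiv ℝ u y e) p := (h.analytic p hp).dirDeriv e
  have hx0 : 0 < ‖x‖ := norm_pos_iff.2 fun hc => by simp [hc] at hx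
  have hy0 : 0 < ‖y‖ := norm_pos_iff.2 fun hc => by simp [hc] at hy
  have hunit : ∀ z : EuclideanSpace ℝ (Fin n), 0 < ‖z‖ → ‖‖z‖⁻¹ • z‖ = 1 := fun z hz => by
    rw [norm_smul, norm_inv, norm_norm, inv_mul_cancel₀ hz.ne']
  have hline : ∀ z : EuclideanSpace ℝ (Fin n), ∀ᶠ ρ : ℝ in 𝓝[>] 0, p + ρ • z ∈ Ω := fun z => by
    have h1 : ContinuousAt (fun ρ : ℝ => p + ρ • z) 0 := by fun_prop
    exact (h1.eventually_mem (by simpa using h.isOpen.mem_nhds hp)).filter_mono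
      nhdsWithin_le_nhds
  have hxe := eventually_neg_of_taylorTerm_neg (z := ‖x‖⁻¹ • x) hvan (fun j hj => hlow j hj _)
    (by rw [taylorTerm_smul]; exact mul_neg_of_pos_of_neg (by positivity) hTx)
  have hye := eventually_pos_of_taylorTerm_pos (z := ‖y‖⁻¹ • y) hvan (fun j hj => hlow j hj _)
    (by rw [taylorTerm_smul]; positivity)
  obtain ⟨r, hr, hrs⟩ := mem_nhdsGT_iff_exists_Ioc_subset.1
    ((((hline _).and hxe).and ((hline _).and hye)))
  refine h.false_of_rays he hp (by simp [hcrit]) (hunit x hx0) (hunit y hy0) hsym ?_ hr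
    (fun ρ hρ hρr => (hrs ⟨hρ, hρr⟩).1) (fun ρ hρ hρr => (hrs ⟨hρ, hρr⟩).2)
  rw [inner_smul_right, inner_smul_right]
  exact (mul_neg_of_pos_of_neg (by positivity) hx).trans (by positivity)

end IsConvexMCSolution

lemma isAxisRotation_of_reflection {n : ℕ} {k : Fin n} {e : EuclideanSpace ℝ (Fin n)}
    {R : EuclideanSpace ℝ (Fin n) ≃ₗᵢ[ℝ] EuclideanSpace ℝ (Fin n)}
    (hRe : ∀ x, R x = x - (2 * ⟪e, x⟫) • e) (he : e k = 0) : IsAxisRotation k R := by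
  constructor
  · rw [hRe, EuclideanSpace.inner_single_right, he]
    simp
  · intro x hx
    rw [hRe]
    simp [he, hx]

/-- The derivative along the axis of symmetry is constant on circles around the axis. -/
lemma IsConvexMCSolution.fderiv_single_eq_of_axis {n : ℕ} [NeZero n]
    {Ω : Set (EuclideanSpace ℝ (Fin n))} {f : ℝ → ℝ} {u : EuclideanSpace ℝ (Fin n) → ℝ}
    (h : IsConvexMCSolution Ω f u) {k : Fin n}
    (hΩsym : ∀ g : EuclideanSpace ℝ (Fin n) ≃ₗᵢ[ℝ] EuclideanSpace ℝ (Fin n),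
      IsAxisRotation k g → g '' Ω = Ω)
    {p z w : EuclideanSpace ℝ (Fin n)} (hp : ∀ i, i ≠ k → p i = 0) (hz : z ∈ Ω)
    (hzw : z k = w k) (hnorm : ‖z - p‖ = ‖w - p‖) :
    fderiv ℝ u z (EuclideanSpace.single k 1) = fderiv ℝ u w (EuclideanSpace.single k 1) := by
  rcases eq_or_ne z w with rfl | hne
  · rfl
  have hd : 0 < ‖z - w‖ := norm_pos_iff.2 (sub_ne_zero.2 hne)
  obtain ⟨R, hR⟩ := exists_reflection (e := ‖z - w‖⁻¹ • (z - w))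
    (by rw [norm_smul, norm_inv, norm_norm, inv_mul_cancel₀ hd.ne'])
  have hrot : IsAxisRotation k R := isAxisRotation_of_reflection hR (by simp [hzw])
  have hpe : ⟪z - w, p⟫ = 0 := by
    rw [PiLp.inner_apply]
    refine Finset.sum_eq_zero fun i _ => ?_
    by_cases hi : i = k
    · subst hi; simp [hzw]
    · simp [hp i hi]
  have h1 : 2 * ⟪z - w, z⟫ = ‖z - w‖ ^ 2 := by
    have h2 : ⟪z - w, z⟫ = ⟪z - w, z - p⟫ := by rw [inner_sub_right, hpe, sub_zero]
    have h3 : z - w = (z - p) - (w - p) := by abel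
    rw [h2, h3, norm_sub_sq_real, inner_sub_left, real_inner_self_eq_norm_sq,
      real_inner_comm, ← hnorm]
    ring
  have hRz : R z = w := by
    rw [hR, real_inner_smul_left, smul_smul,
      show 2 * (‖z - w‖⁻¹ * ⟪z - w, z⟫) * ‖z - w‖⁻¹ = 1 by
        rw [show 2 * (‖z - w‖⁻¹ * ⟪z - w, z⟫) * ‖z - w‖⁻¹ =
          (2 * ⟪z - w, z⟫) * (‖z - w‖⁻¹) ^ 2 by ring, h1]
        field_simp, one_smul, sub_sub_cancel]
  have := h.fderiv_isometry (hΩsym R hrot) hz (EuclideanSpace.single k 1)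
  rw [hRz, hrot.1] at this
  exact this.symm

/-- Every critical point of a positive analytic solution in a bounded,
strictly convex, smooth, rotationally symmetric domain of `ℝⁿ` (`n ≥ 3`) lies on the axis
of symmetry, and there the Hessian is diagonal and negative definite. -/
theorem critical_points_on_axis_hessian_diag_negdef
    (n : ℕ) (hn : 3 ≤ n) (k : Fin n) (hk : (k : ℕ) = n - 1)
    (Ω : Set (EuclideanSpace ℝ (Fin n)))
    (hΩne : Ω.Nonempty) (hΩopen : IsOpen Ω) (hΩbd : Bornology.IsBounded Ω)
    (hΩconv : StrictConvex ℝ (closure Ω)) (hΩsmooth : HasSmoothBoundary Ω)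
    (hΩsym : ∀ g : EuclideanSpace ℝ (Fin n) ≃ₗᵢ[ℝ] EuclideanSpace ℝ (Fin n),
      IsAxisRotation k g → g '' Ω = Ω)
    (f : ℝ → ℝ) (hf : AnalyticOnNhd ℝ f Set.univ) (hfmono : Monotone f)
    (u : EuclideanSpace ℝ (Fin n) → ℝ)
    (hsol : IsMCSolution Ω f u) (hupos : ∀ x ∈ Ω, 0 < u x)
    (huan : AnalyticOnNhd ℝ u Ω)
    (huC1 : ContDiffOn ℝ 1 u (closure Ω)) :
    ∀ p ∈ Ω, gradient u p = 0 →
      (∀ i : Fin n, i ≠ k → p i = 0) ∧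
      (∀ i j : Fin n, i ≠ j → hessMatrix u p i j = 0) ∧
      (∀ i : Fin n, hessMatrix u p i i < 0) := by
  have : NeZero n := ⟨by omega⟩
  have hconv : Convex ℝ Ω := by
    rw [← HasSmoothBoundary.interior_closure hΩopen hΩsmooth]
    exact hΩconv.convex.interior
  have h : IsConvexMCSolution Ω f u :=
    { isOpen := hΩopen
      nonempty := hΩne
      isBounded := hΩbd
      convex := hconv
      smooth := hΩsmooth
      contDiff_rhs := contDiff_iff_contDiffAt.2 fun x => (hf x (mem_univ x)).contDiffAt
      monotone_rhs := hfmono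
      equation := hsol.isMCEquation
      eq_zero := hsol.2.2.2
      pos := hupos
      analytic := huan
      contDiffOn := huC1 }
  intro p hp hgrad
  have hcrit : fderiv ℝ u p = 0 := (gradient_eq_zero_iff u p).1 hgrad
  have hunit : ∀ i : Fin n, ‖(EuclideanSpace.single i (1 : ℝ) : EuclideanSpace ℝ (Fin n))‖ = 1 :=
    fun i => by simp
  have hinner : ∀ (i : Fin n) (x : EuclideanSpace ℝ (Fin n)),
      inner ℝ (EuclideanSpace.single i (1 : ℝ)) x = x i := fun i x => by
    rw [EuclideanSpace.inner_single_left, map_one, one_mul]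
  have hrefl : ∀ i : Fin n, i ≠ k → ∃ R : EuclideanSpace ℝ (Fin n) ≃ₗᵢ[ℝ] EuclideanSpace ℝ (Fin n),
      (∀ x, R x = x - (2 * inner ℝ (EuclideanSpace.single i 1) x) • EuclideanSpace.single i 1) ∧
        R '' Ω = Ω := by
    intro i hi
    obtain ⟨R, hR⟩ := exists_reflection (hunit i)
    exact ⟨R, hR, hΩsym R (isAxisRotation_of_reflection hR (by simp [hi.symm]))⟩
  have haxis : ∀ i : Fin n, i ≠ k → p i = 0 := by
    intro i hi
    obtain ⟨R, hR, hRΩ⟩ := hrefl i hi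
    rw [← hinner]
    exact h.inner_eq_zero_of_fderiv_eq_zero (hunit i) hR hRΩ hp hcrit
  have hoff : ∀ i j : Fin n, i ≠ j → fderiv ℝ (fderiv ℝ u) p (EuclideanSpace.single i 1)
      (EuclideanSpace.single j 1) = 0 := by
    intro i j hij
    by_cases hi : i = k
    · have hj : j ≠ k := fun hj => hij (hi.trans hj.symm)
      obtain ⟨R, hR, hRΩ⟩ := hrefl j hj
      exact (h.fderiv_fderiv_eq_zero_of_reflection (hunit j) hR hRΩ hp
        ((hinner j p).trans (haxis j hj)) (by rw [hinner]; simp [hij.symm])).2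
    · obtain ⟨R, hR, hRΩ⟩ := hrefl i hi
      exact (h.fderiv_fderiv_eq_zero_of_reflection (hunit i) hR hRΩ hp
        ((hinner i p).trans (haxis i hi)) (by rw [hinner]; simp [hij])).1
  refine ⟨haxis, fun i j hij => ?_, fun i => ?_⟩
  · rw [hessMatrix, Matrix.of_apply, hessEntry_eq]
    exact hoff i j hij
  · rw [hessMatrix, Matrix.of_apply, hessEntry_eq]
    by_cases hi : i = k
    · subst hi
      refine h.fderiv_fderiv_neg_of_axis (hunit i) hp hcrit (fun ξ hξ => ?_) ?_
      · conv_lhs => rw [euclidean_eq_sum_single ξ]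
        rw [map_sum]
        refine Finset.sum_eq_zero fun j _ => ?_
        rw [map_smul]
        by_cases hj : i = j
        · subst hj
          have : ξ i = 0 := (hinner i ξ).symm.trans hξ
          rw [this, zero_smul]
        · rw [hoff i j hj, smul_zero]
      · intro z hz w _ hzw hnorm
        rw [hinner, hinner] at hzw
        exact h.fderiv_single_eq_of_axis hΩsym haxis hz (by simpa using hzw) hnorm
    · obtain ⟨R, hR, hRΩ⟩ := hrefl i hi
      exact h.fderiv_fderiv_neg_of_reflection (hunit i) hR hRΩ hp ((hinner i p).trans (haxis i hi))
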